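/- arXiv:1806.03135 — 2 statements merged into one kernel-verified Lean document; each statement's English description precedes it below -/
import Mathlib

section
/- Assume (H0), (H1) and (H2) hold for V with parameters D, C, s, let δ_n = n^{−α} with 0 < α ≤ 1, and let a be a variation sequence of length L and order M with M > D + s/2 + 1/4; set n' = n − L + 1. For each n, assume the n' × n' symmetric matrix Σ_n with entries Σ_n(i,i') = −Σ_j (a^{2*})_j V((i−i'+j)δ_n) is positive semidefinite, and let Z^{(n)} be a centered Gaussian random vector in ℝ^{n'} with covariance matrix Σ_n. Set V_{a,n} = Σ_{i=1}^{n'} (Z^{(n)}_i)². Then (V_{a,n} − E[V_{a,n}]) / √(Var(V_{a,n})) converges in distribution to the standard normal distribution N(0,1) as n → ∞. -/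
open Filter MeasureTheory ProbabilityTheory Matrix

/-- Convolution of finitely supported sequences: `(a*a')_m = Σ_{k-l=m} a_k a'_l`. -/
noncomputable def seqConv (a a' : ℤ → ℝ) (m : ℤ) : ℝ := ∑ᶠ k : ℤ, a k * a' (k - m)

/-- The law of the centered Gaussian vector `Z^{(n)} = A_n G_n` (with `G_n` a vector of
i.i.d. standard normal variables), a measure on `ℝ^{n-L+1}`. -/
noncomputable def gaussVec (L : ℕ)
    (A : (n : ℕ) → Matrix (Fin (n - L + 1)) (Fin (n - L + 1)) ℝ) (n : ℕ) :
    Measure (Fin (n - L + 1) → ℝ) :=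
  Measure.map (A n).mulVec (Measure.pi fun _ => gaussianReal 0 1)

/-- The quadratic variation functional `z ↦ Σ_i z_i²`. -/
noncomputable def quadVar (m : ℕ) (z : Fin m → ℝ) : ℝ := ∑ i, (z i) ^ 2

/-- Expectation of the quadratic `a`-variation. -/
noncomputable def expV (L : ℕ)
    (A : (n : ℕ) → Matrix (Fin (n - L + 1)) (Fin (n - L + 1)) ℝ) (n : ℕ) : ℝ :=
  ∫ z, quadVar (n - L + 1) z ∂(gaussVec L A n)

/-- Variance of the quadratic `a`-variation. -/
noncomputable def varV (L : ℕ)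
    (A : (n : ℕ) → Matrix (Fin (n - L + 1)) (Fin (n - L + 1)) ℝ) (n : ℕ) : ℝ :=
  ∫ z, (quadVar (n - L + 1) z - expV L A n) ^ 2 ∂(gaussVec L A n)

theorem norm_prod_sub_prod_le {ι : Type*} (s : Finset ι) (z w : ι → ℂ)
    (hz : ∀ i ∈ s, ‖z i‖ ≤ 1) (hw : ∀ i ∈ s, ‖w i‖ ≤ 1) :
    ‖∏ i ∈ s, z i - ∏ i ∈ s, w i‖ ≤ ∑ i ∈ s, ‖z i - w i‖ := by
  classical
  induction s using Finset.induction_on with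
  | empty => simp
  | insert j s hj ih =>
    have hz' : ∀ i ∈ s, ‖z i‖ ≤ 1 := fun i hi => hz i (Finset.mem_insert_of_mem hi)
    have hw' : ∀ i ∈ s, ‖w i‖ ≤ 1 := fun i hi => hw i (Finset.mem_insert_of_mem hi)
    rw [Finset.prod_insert hj, Finset.prod_insert hj, Finset.sum_insert hj]
    have hp : ‖∏ i ∈ s, z i‖ ≤ 1 := by
      rw [norm_prod]
      exact Finset.prod_le_one (fun _ _ => norm_nonneg _) hz'
    calc ‖z j * ∏ i ∈ s, z i - w j * ∏ i ∈ s, w i‖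
        = ‖(z j - w j) * ∏ i ∈ s, z i + w j * (∏ i ∈ s, z i - ∏ i ∈ s, w i)‖ := by
          congr 1; ring
      _ ≤ ‖z j - w j‖ * ‖∏ i ∈ s, z i‖ + ‖w j‖ * ‖∏ i ∈ s, z i - ∏ i ∈ s, w i‖ := by
          refine (norm_add_le _ _).trans ?_
          rw [norm_mul, norm_mul]
      _ ≤ ‖z j - w j‖ * 1 + 1 * ∑ i ∈ s, ‖z i - w i‖ := by
          gcongr
          · exact hw j (Finset.mem_insert_self j s)
          · exact ih hz' hw'
      _ = _ := by ring

theorem charFun_sub_exp_isLittleO (ρ : Measure ℝ) [IsProbabilityMeasure ρ]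
    (h0 : ∫ x, x ∂ρ = 0) (h1 : ∫ x, x ^ 2 ∂ρ = 1) :
    (fun t : ℝ => charFun ρ t - Complex.exp (-(t : ℂ) ^ 2 / 2)) =o[nhds 0]
      fun t : ℝ => t ^ 2 := by
  have key : ∀ (ν : Measure ℝ) [IsProbabilityMeasure ν], ∫ x, x ∂ν = 0 → ∫ x, x ^ 2 ∂ν = 1 →
      (fun t : ℝ => charFun ν t - (1 - (t : ℂ) ^ 2 / 2)) =o[nhds 0] fun t : ℝ => t ^ 2 := by
    intro ν _ h0 h1
    have := taylor_charFun_two (P := ν) (X := id) aemeasurable_id h0 (by simpa using h1)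
    simpa using this
  have hg := key (gaussianReal 0 1) (by simp) (by
    have := variance_fun_id_gaussianReal (μ := 0) (v := 1)
    rw [variance_eq_integral (by fun_prop)] at this
    simpa using this)
  refine ((key ρ h0 h1).sub hg).congr_left fun t => ?_
  simp [charFun_gaussianReal, neg_div]

/-- Lindeberg-type limit for weighted sums of i.i.d. variables, in terms of characteristic
functions. -/
theorem tendsto_prod_charFun (ρ : Measure ℝ) [IsProbabilityMeasure ρ]
    (h0 : ∫ x, x ∂ρ = 0) (h1 : ∫ x, x ^ 2 ∂ρ = 1)
    (ι : ℕ → Type*) [∀ n, Fintype (ι n)] (w : (n : ℕ) → ι n → ℝ) (ε : ℕ → ℝ)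
    (hw : ∀ᶠ n in atTop, ∑ i, w n i ^ 2 = 1) (hε : Tendsto ε atTop (nhds 0))
    (hwε : ∀ᶠ n in atTop, ∀ i, |w n i| ≤ ε n) (t : ℝ) :
    Tendsto (fun n => ∏ i, charFun ρ (w n i * t)) atTop
      (nhds (Complex.exp (-(t : ℂ) ^ 2 / 2))) := by
  rw [Metric.tendsto_nhds]
  intro e he
  have hc : 0 < e / 2 / (t ^ 2 + 1) := by positivity
  have ho := (charFun_sub_exp_isLittleO ρ h0 h1).def hc
  obtain ⟨η, hη, hηb⟩ := Metric.eventually_nhds_iff.1 ho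
  have hεt : Tendsto (fun n => ε n * |t|) atTop (nhds 0) := by
    simpa using hε.mul_const |t|
  filter_upwards [hw, hwε, hεt.eventually (gt_mem_nhds hη)] with n hn hn' hn''
  have hb : ∀ i, dist (w n i * t) 0 < η := fun i => by
    rw [Real.dist_eq, sub_zero, abs_mul]
    exact (mul_le_mul_of_nonneg_right (hn' i) (abs_nonneg t)).trans_lt hn''
  have hexp : Complex.exp (-(t : ℂ) ^ 2 / 2)
      = ∏ i, Complex.exp (-((w n i * t : ℝ) : ℂ) ^ 2 / 2) := by
    rw [← Complex.exp_sum]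
    congr 1
    have : (∑ i, (w n i : ℂ) ^ 2) = 1 := by exact_mod_cast hn
    calc -(t : ℂ) ^ 2 / 2 = (∑ i, (w n i : ℂ) ^ 2) * (-(t : ℂ) ^ 2 / 2) := by rw [this, one_mul]
      _ = _ := by
        rw [Finset.sum_mul]
        refine Finset.sum_congr rfl fun i _ => ?_
        push_cast; ring
  rw [dist_eq_norm, hexp]
  calc _ ≤ ∑ i, ‖charFun ρ (w n i * t) - Complex.exp (-((w n i * t : ℝ) : ℂ) ^ 2 / 2)‖ := by
        refine norm_prod_sub_prod_le _ _ _ (fun i _ => norm_charFun_le_one _) fun i _ => ?_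
        rw [Complex.norm_exp, Real.exp_le_one_iff]
        have : (-((w n i * t : ℝ) : ℂ) ^ 2 / 2).re = -((w n i * t) ^ 2 / 2) := by
          rw [← neg_div', ← Complex.ofReal_pow]
          norm_cast
        rw [this]
        have := sq_nonneg (w n i * t)
        linarith
    _ ≤ ∑ i, e / 2 / (t ^ 2 + 1) * (w n i * t) ^ 2 := by
        refine Finset.sum_le_sum fun i _ => ?_
        simpa only [norm_pow, Real.norm_eq_abs, sq_abs] using hηb (hb i)
    _ = e / 2 / (t ^ 2 + 1) * t ^ 2 := by
        rw [← Finset.mul_sum]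
        simp_rw [mul_pow]
        rw [← Finset.sum_mul, hn, one_mul]
    _ ≤ e / 2 := by
        rw [div_mul_eq_mul_div, div_le_iff₀ (by positivity)]
        nlinarith [sq_nonneg t]
    _ < e := by linarith

theorem trace_mul_self_eq_sum_eigenvalues_sq {ι : Type*} [Fintype ι] [DecidableEq ι]
    {H : Matrix ι ι ℝ} (hH : H.IsHermitian) :
    (H * H).trace = ∑ i, hH.eigenvalues i ^ 2 := by
  have hs := hH.spectral_theorem
  have : H * H = Unitary.conjStarAlgAut ℝ _ hH.eigenvectorUnitary
      (diagonal (RCLike.ofReal ∘ hH.eigenvalues) * diagonal (RCLike.ofReal ∘ hH.eigenvalues)) := by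
    rw [map_mul, ← hs]
  rw [this, Unitary.conjStarAlgAut_apply, trace_mul_comm, ← mul_assoc]
  simp [diagonal_mul_diagonal, trace_diagonal, sq]

theorem quadVar_mulVec_sum_eigenvectorBasis {m : ℕ} (B : Matrix (Fin m) (Fin m) ℝ)
    (hH : (Bᵀ * B).IsHermitian) (y : Fin m → ℝ) :
    quadVar m (B *ᵥ (WithLp.ofLp (∑ i, y i • hH.eigenvectorBasis i)))
      = ∑ i, hH.eigenvalues i * y i ^ 2 := by
  set x : EuclideanSpace ℝ (Fin m) := ∑ i, y i • hH.eigenvectorBasis i with hx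
  have h1 : quadVar m (B *ᵥ x.ofLp) = x.ofLp ⬝ᵥ ((Bᵀ * B) *ᵥ x.ofLp) := by
    rw [← mulVec_mulVec, dotProduct_mulVec, vecMul_transpose]
    simp [quadVar, dotProduct, sq]
  have h2 : (Bᵀ * B) *ᵥ x.ofLp
      = (∑ i, (y i * hH.eigenvalues i) • hH.eigenvectorBasis i :
        EuclideanSpace ℝ (Fin m)).ofLp := by
    rw [hx, WithLp.ofLp_sum, WithLp.ofLp_sum, Matrix.mulVec_sum]
    refine Finset.sum_congr rfl fun i _ => ?_
    rw [WithLp.ofLp_smul, WithLp.ofLp_smul, Matrix.mulVec_smul, hH.mulVec_eigenvectorBasis,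
      smul_smul]
  have h3 : ∀ u v : EuclideanSpace ℝ (Fin m), u.ofLp ⬝ᵥ v.ofLp = inner ℝ u v := by
    intro u v
    simp [EuclideanSpace.inner_eq_star_dotProduct, dotProduct_comm]
  rw [h1, h2, h3, hx, hH.eigenvectorBasis.orthonormal.inner_sum]
  refine Finset.sum_congr rfl fun i _ => ?_
  simp
  ring

theorem abs_eigenvalues_transpose_mul_self_le {m : ℕ} (B : Matrix (Fin m) (Fin m) ℝ)
    (hH : (Bᵀ * B).IsHermitian) (R : ℝ) (hR0 : 0 ≤ R)
    (hR : ∀ i, ∑ j, |(B * Bᵀ) i j| ≤ R) (i : Fin m) : |hH.eigenvalues i| ≤ R := by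
  by_cases h0 : hH.eigenvalues i = 0
  · simpa [h0] using hR0
  set v : Fin m → ℝ := (hH.eigenvectorBasis i).ofLp with hv
  set l := hH.eigenvalues i
  have hv1 : (Bᵀ * B) *ᵥ v = l • v := hH.mulVec_eigenvectorBasis i
  set w := B *ᵥ v with hw
  have hv0 : v ≠ 0 := by
    intro h
    have : hH.eigenvectorBasis i = 0 := by
      apply WithLp.ofLp_injective 2
      exact h
    exact hH.eigenvectorBasis.orthonormal.ne_zero i this
  have hw0 : w ≠ 0 := by
    intro h
    have : (Bᵀ * B) *ᵥ v = 0 := by rw [← mulVec_mulVec, ← hw, h, mulVec_zero]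
    rw [hv1] at this
    exact (smul_ne_zero h0 hv0) this
  have hww : (B * Bᵀ) *ᵥ w = l • w := by
    rw [hw, mulVec_mulVec, mul_assoc, ← mulVec_mulVec, hv1, mulVec_smul]
  have : Nonempty (Fin m) := ⟨i⟩
  obtain ⟨k, hk⟩ := Finite.exists_max fun j => |w j|
  have hk0 : 0 < |w k| := by
    obtain ⟨j, hj⟩ := Function.ne_iff.1 hw0
    exact (abs_pos.2 hj).trans_le (hk j)
  have h4 : |l| * |w k| ≤ R * |w k| := by
    have := congrFun hww k
    rw [← abs_mul, ← smul_eq_mul, ← Pi.smul_apply, ← this]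
    calc |((B * Bᵀ) *ᵥ w) k| ≤ ∑ j, |(B * Bᵀ) k j * w j| := by
          rw [mulVec, dotProduct]
          exact Finset.abs_sum_le_sum_abs _ _
      _ ≤ ∑ j, |(B * Bᵀ) k j| * |w k| := by
        refine Finset.sum_le_sum fun j _ => ?_
        rw [abs_mul]
        exact mul_le_mul_of_nonneg_left (hk j) (abs_nonneg _)
      _ ≤ R * |w k| := by
        rw [← Finset.sum_mul]
        exact mul_le_mul_of_nonneg_right (hR k) (abs_nonneg _)
  exact le_of_mul_le_mul_right h4 hk0

theorem sum_eigenvalues_transpose_mul_self_sq {m : ℕ} (B : Matrix (Fin m) (Fin m) ℝ)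
    (hH : (Bᵀ * B).IsHermitian) :
    ∑ i, hH.eigenvalues i ^ 2 = ∑ i, ∑ j, (B * Bᵀ) i j ^ 2 := by
  rw [← trace_mul_self_eq_sum_eigenvalues_sq hH]
  have : (Bᵀ * B * (Bᵀ * B)).trace = ((B * Bᵀ) * (B * Bᵀ)).trace := by
    rw [mul_assoc, trace_mul_comm, ← mul_assoc, ← mul_assoc]
  rw [this, trace]
  refine Finset.sum_congr rfl fun i _ => ?_
  rw [diag_apply, mul_apply]
  refine Finset.sum_congr rfl fun j _ => ?_
  have : (B * Bᵀ) j i = (B * Bᵀ) i j := by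
    rw [← transpose_apply (B * Bᵀ) j i, transpose_mul, transpose_transpose]
  rw [this, sq]

theorem continuous_quadVar (m : ℕ) : Continuous (quadVar m) := by
  unfold quadVar; fun_prop

/-- The law of `‖B G‖²` for a standard Gaussian vector `G` is that of a weighted sum of squares
of independent standard normal variables. -/
theorem map_quadVar_map_mulVec {m : ℕ} (B : Matrix (Fin m) (Fin m) ℝ)
    (hH : (Bᵀ * B).IsHermitian) :
    ((Measure.pi fun _ => gaussianReal 0 1).map B.mulVec).map (quadVar m)
      = (Measure.pi fun _ => gaussianReal 0 1).map
          (fun y : Fin m → ℝ => ∑ i, hH.eigenvalues i * y i ^ 2) := by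
  have hB : Measurable B.mulVec :=
    (Continuous.matrix_mulVec continuous_const continuous_id).measurable
  have hq := (continuous_quadVar m).measurable
  have h1 := map_pi_eq_stdGaussian (ι := Fin m)
  rw [stdGaussian_eq_map_pi_orthonormalBasis hH.eigenvectorBasis] at h1
  have hF : Measurable fun x : EuclideanSpace ℝ (Fin m) => quadVar m (B *ᵥ x.ofLp) :=
    hq.comp (hB.comp (by fun_prop))
  have h2 := congrArg (Measure.map fun x : EuclideanSpace ℝ (Fin m) => quadVar m (B *ᵥ x.ofLp)) h1
  rw [Measure.map_map hF (by fun_prop), Measure.map_map hF (by fun_prop)] at h2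
  rw [Measure.map_map hq hB]
  refine h2.trans ?_
  congr 1
  funext y
  exact quadVar_mulVec_sum_eigenvectorBasis B hH y

theorem integrable_sq_sub_one_gaussianReal :
    Integrable (fun x : ℝ => x ^ 2 - 1) (gaussianReal 0 1) := by
  have h : MemLp (fun x : ℝ => x) 2 (gaussianReal 0 1) := memLp_id_gaussianReal' 2 (by simp)
  exact h.integrable_sq.sub (integrable_const _)

theorem integral_sq_gaussianReal : ∫ x, x ^ 2 ∂(gaussianReal 0 1) = 1 := by
  have := variance_fun_id_gaussianReal (μ := 0) (v := 1)
  rw [variance_eq_integral (by fun_prop)] at this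
  simpa using this

theorem integral_sq_sub_one_gaussianReal :
    ∫ x, (x ^ 2 - 1) ∂(gaussianReal 0 1) = 0 := by
  have h : MemLp (fun x : ℝ => x) 2 (gaussianReal 0 1) := memLp_id_gaussianReal' 2 (by simp)
  rw [integral_sub h.integrable_sq (integrable_const _), integral_sq_gaussianReal]
  simp

theorem memLp_sq_sub_one_gaussianReal :
    MemLp (fun x : ℝ => x ^ 2 - 1) 2 (gaussianReal 0 1) := by
  have h : MemLp (fun x : ℝ => x) 4 (gaussianReal 0 1) := memLp_id_gaussianReal' 4 (by simp)
  refine MemLp.sub ?_ (memLp_const 1)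
  rw [memLp_two_iff_integrable_sq (by fun_prop)]
  have := h.integrable_norm_pow (p := 4) (by norm_num)
  refine this.congr (ae_of_all _ fun x => ?_)
  simp only [Real.norm_eq_abs]
  rw [← pow_mul]
  exact Even.pow_abs (by decide) x

theorem integral_sq_sub_one_sq_gaussianReal_pos :
    0 < ∫ x, (x ^ 2 - 1) ^ 2 ∂(gaussianReal 0 1) := by
  have hi : Integrable (fun x : ℝ => (x ^ 2 - 1) ^ 2) (gaussianReal 0 1) :=
    memLp_sq_sub_one_gaussianReal.integrable_sq
  rw [integral_pos_iff_support_of_nonneg (fun x => sq_nonneg _) hi, pos_iff_ne_zero]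
  intro h
  have := nullSingletonClass_gaussianReal (μ := 0) (v := 1) (by simp)
  have h2 : (gaussianReal 0 1) ({1, -1} : Set ℝ) = 0 :=
    (Set.toFinite _).measure_zero _
  have h3 : (gaussianReal 0 1) Set.univ = 0 := by
    refine measure_mono_null (fun x _ => ?_) (measure_union_null h h2)
    by_cases hx : (x ^ 2 - 1) ^ 2 = 0
    · right
      have : (x - 1) * (x + 1) = 0 := by
        rw [sq_eq_zero_iff] at hx
        linarith
      rcases mul_eq_zero.1 this with h | h
      · left; linarith
      · right
        rw [Set.mem_singleton_iff]; linarith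
    · left; exact hx
  simp at h3

theorem integral_comp_quadVar {m : ℕ} (B : Matrix (Fin m) (Fin m) ℝ)
    (hH : (Bᵀ * B).IsHermitian) {f : ℝ → ℝ} (hf : Measurable f) :
    ∫ z, f (quadVar m z) ∂((Measure.pi fun _ => gaussianReal 0 1).map B.mulVec)
      = ∫ y : Fin m → ℝ, f (∑ i, hH.eigenvalues i * y i ^ 2)
          ∂(Measure.pi fun _ => gaussianReal 0 1) := by
  have hq := (continuous_quadVar m).measurable
  have h1 := congrArg (fun μ : Measure ℝ => ∫ x, f x ∂μ) (map_quadVar_map_mulVec B hH)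
  simp only at h1
  rwa [integral_map hq.aemeasurable hf.aestronglyMeasurable,
    integral_map (Measurable.aemeasurable (by fun_prop)) hf.aestronglyMeasurable] at h1

theorem integrable_eval_gaussian {m : ℕ} (i : Fin m) {f : ℝ → ℝ}
    (hf : Integrable f (gaussianReal 0 1)) :
    Integrable (fun y : Fin m → ℝ => f (y i)) (Measure.pi fun _ => gaussianReal 0 1) :=
  integrable_comp_eval (μ := fun _ : Fin m => gaussianReal 0 1) hf

theorem integral_eval_gaussian {m : ℕ} (i : Fin m) {f : ℝ → ℝ} (hf : Measurable f) :
    ∫ y : Fin m → ℝ, f (y i) ∂(Measure.pi fun _ => gaussianReal 0 1)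
      = ∫ x, f x ∂(gaussianReal 0 1) :=
  integral_comp_eval (μ := fun _ : Fin m => gaussianReal 0 1) hf.aestronglyMeasurable

theorem integral_weighted_sum_sq {m : ℕ} (l : Fin m → ℝ) :
    ∫ y : Fin m → ℝ, ∑ i, l i * y i ^ 2 ∂(Measure.pi fun _ => gaussianReal 0 1) = ∑ i, l i := by
  have h : MemLp (fun x : ℝ => x) 2 (gaussianReal 0 1) := memLp_id_gaussianReal' 2 (by simp)
  rw [integral_finsetSum _ fun i _ =>
    (integrable_eval_gaussian i h.integrable_sq).const_mul (l i)]
  refine Finset.sum_congr rfl fun i _ => ?_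
  rw [integral_const_mul, integral_eval_gaussian i (f := fun x => x ^ 2) (by fun_prop),
    integral_sq_gaussianReal, mul_one]

theorem integral_weighted_sum_sq_sub_sq {m : ℕ} (l : Fin m → ℝ) :
    ∫ y : Fin m → ℝ, (∑ i, l i * y i ^ 2 - ∑ i, l i) ^ 2 ∂(Measure.pi fun _ => gaussianReal 0 1)
      = (∫ x, (x ^ 2 - 1) ^ 2 ∂(gaussianReal 0 1)) * ∑ i, l i ^ 2 := by
  have hv : Var[fun x : ℝ => x ^ 2 - 1; gaussianReal 0 1]
      = ∫ x, (x ^ 2 - 1) ^ 2 ∂(gaussianReal 0 1) :=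
    variance_of_integral_eq_zero (by fun_prop) integral_sq_sub_one_gaussianReal
  have hs := variance_sum_pi (ι := Fin m) (μ := fun _ => gaussianReal 0 1)
    (X := fun i x => l i * (x ^ 2 - 1)) (fun i => memLp_sq_sub_one_gaussianReal.const_mul (l i))
  simp_rw [variance_const_mul, hv] at hs
  rw [mul_comm, Finset.sum_mul, ← hs, variance_of_integral_eq_zero]
  · refine integral_congr_ae (ae_of_all _ fun y => ?_)
    simp only [Finset.sum_apply]
    congr 1
    rw [← Finset.sum_sub_distrib]
    exact Finset.sum_congr rfl fun i _ => by ring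
  · exact Measurable.aemeasurable (by fun_prop)
  · simp only [Finset.sum_apply]
    rw [integral_finsetSum _ fun i _ =>
      (integrable_eval_gaussian i integrable_sq_sub_one_gaussianReal).const_mul (l i)]
    refine Finset.sum_eq_zero fun i _ => ?_
    rw [integral_const_mul, integral_eval_gaussian i (f := fun x => x ^ 2 - 1) (by fun_prop),
      integral_sq_sub_one_gaussianReal, mul_zero]

/-- The law of a standardized square of a standard normal variable. -/
noncomputable def stdChiSq : Measure ℝ :=
  (gaussianReal 0 1).map fun x => (x ^ 2 - 1) / √(∫ x, (x ^ 2 - 1) ^ 2 ∂(gaussianReal 0 1))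

instance : IsProbabilityMeasure stdChiSq :=
  Measure.isProbabilityMeasure_map (Measurable.aemeasurable (by fun_prop))

theorem integral_stdChiSq : ∫ x, x ∂stdChiSq = 0 := by
  rw [stdChiSq, integral_map (Measurable.aemeasurable (by fun_prop)) (by fun_prop), integral_div,
    integral_sq_sub_one_gaussianReal, zero_div]

theorem integral_sq_stdChiSq : ∫ x, x ^ 2 ∂stdChiSq = 1 := by
  have := integral_sq_sub_one_sq_gaussianReal_pos
  rw [stdChiSq, integral_map (Measurable.aemeasurable (by fun_prop)) (by fun_prop)]
  simp_rw [div_pow]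
  rw [integral_div, Real.sq_sqrt this.le, div_self this.ne']

theorem charFun_weighted_sum_sq {m : ℕ} (l : Fin m → ℝ) (t : ℝ) :
    charFun ((Measure.pi fun _ => gaussianReal 0 1).map fun y : Fin m → ℝ =>
      (∑ i, l i * y i ^ 2 - ∑ i, l i) /
        √((∫ x, (x ^ 2 - 1) ^ 2 ∂(gaussianReal 0 1)) * ∑ i, l i ^ 2)) t
      = ∏ i, charFun stdChiSq (l i / √(∑ i, l i ^ 2) * t) := by
  set v := ∫ x, (x ^ 2 - 1) ^ 2 ∂(gaussianReal 0 1) with hv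
  have hv0 : 0 < v := integral_sq_sub_one_sq_gaussianReal_pos
  have hfun : (fun y : Fin m → ℝ => (∑ i, l i * y i ^ 2 - ∑ i, l i) / √(v * ∑ i, l i ^ 2))
      = fun y => ∑ i, l i / √(∑ i, l i ^ 2) * ((y i ^ 2 - 1) / √v) := by
    funext y
    rw [← Finset.sum_sub_distrib, Finset.sum_div, Real.sqrt_mul hv0.le]
    refine Finset.sum_congr rfl fun i _ => ?_
    rw [div_mul_div_comm, mul_comm (√v)]
    congr 1; ring
  rw [hfun, iIndepFun.charFun_map_fun_sum_eq_prod
    (X := fun i (y : Fin m → ℝ) => l i / √(∑ i, l i ^ 2) * ((y i ^ 2 - 1) / √v))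
    (fun i => Measurable.aemeasurable (by fun_prop))]
  · rw [Finset.prod_apply]
    refine Finset.prod_congr rfl fun i _ => ?_
    rw [← charFun_map_mul, stdChiSq, Measure.map_map (by fun_prop) (by fun_prop),
      ← (measurePreserving_eval (fun _ : Fin m => gaussianReal 0 1) i).map_eq,
      Measure.map_map (by fun_prop) (by fun_prop)]
    rw [(measurePreserving_eval (fun _ : Fin m => gaussianReal 0 1) i).map_eq]
    rfl
  · exact iIndepFun_pi (μ := fun _ : Fin m => gaussianReal 0 1)
      (X := fun i x => l i / √(∑ i, l i ^ 2) * ((x ^ 2 - 1) / √v))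
      (fun i => Measurable.aemeasurable (by fun_prop))

/-- Central limit theorem for quadratic functionals of Gaussian vectors: it holds as soon as the
maximal absolute row sum of the covariance matrix is negligible with respect to its Frobenius
norm. -/
theorem tendsto_integral_normalized_quadVar (L : ℕ)
    (A : (n : ℕ) → Matrix (Fin (n - L + 1)) (Fin (n - L + 1)) ℝ) (ε : ℕ → ℝ)
    (hε : Tendsto ε atTop (nhds 0))
    (hpos : ∀ᶠ n in atTop, 0 < ∑ i, ∑ j, (A n * (A n)ᵀ) i j ^ 2)
    (hrow : ∀ᶠ n in atTop, ∀ i, ∑ j, |(A n * (A n)ᵀ) i j|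
      ≤ ε n * √(∑ i, ∑ j, (A n * (A n)ᵀ) i j ^ 2))
    (g : BoundedContinuousFunction ℝ ℝ) :
    Tendsto (fun n : ℕ =>
        ∫ z, g ((quadVar (n - L + 1) z - expV L A n) / Real.sqrt (varV L A n))
          ∂(gaussVec L A n))
      atTop (nhds (∫ x, g x ∂(gaussianReal 0 1))) := by
  have hH : ∀ n, ((A n)ᵀ * A n).IsHermitian := fun n => by
    simpa using isHermitian_conjTranspose_mul_self (A n)
  set l : (n : ℕ) → Fin (n - L + 1) → ℝ := fun n => (hH n).eigenvalues with hl
  set v := ∫ x, (x ^ 2 - 1) ^ 2 ∂(gaussianReal 0 1) with hv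
  have hE : ∀ n, expV L A n = ∑ i, l n i := fun n => by
    rw [expV, gaussVec, integral_comp_quadVar (A n) (hH n) (f := fun x => x) measurable_id,
      integral_weighted_sum_sq]
  have hV : ∀ n, varV L A n = v * ∑ i, l n i ^ 2 := fun n => by
    rw [varV, gaussVec, integral_comp_quadVar (A n) (hH n) (f := fun x => (x - expV L A n) ^ 2)
      (by fun_prop), hE, integral_weighted_sum_sq_sub_sq]
  set T : (n : ℕ) → (Fin (n - L + 1) → ℝ) → ℝ := fun n y =>
    (∑ i, l n i * y i ^ 2 - ∑ i, l n i) / √(v * ∑ i, l n i ^ 2) with hT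
  have hTm : ∀ n, Measurable (T n) := fun n => by fun_prop
  let P : ℕ → ProbabilityMeasure ℝ := fun n =>
    ⟨(Measure.pi fun _ => gaussianReal 0 1).map (T n),
      Measure.isProbabilityMeasure_map (hTm n).aemeasurable⟩
  let P₀ : ProbabilityMeasure ℝ := ⟨gaussianReal 0 1, inferInstance⟩
  have hlim : Tendsto P atTop (nhds P₀) := by
    rw [ProbabilityMeasure.tendsto_iff_tendsto_charFun]
    intro t
    have h0 : charFun (P₀ : Measure ℝ) t = Complex.exp (-(t : ℂ) ^ 2 / 2) := by
      change charFun (gaussianReal 0 1) t = _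
      simp [charFun_gaussianReal, neg_div]
    rw [h0]
    have hp : ∀ n, charFun (P n : Measure ℝ) t
        = ∏ i, charFun stdChiSq (l n i / √(∑ i, l n i ^ 2) * t) :=
      fun n => charFun_weighted_sum_sq (l n) t
    simp_rw [hp]
    refine tendsto_prod_charFun stdChiSq integral_stdChiSq integral_sq_stdChiSq
      (fun n => Fin (n - L + 1)) (fun n i => l n i / √(∑ i, l n i ^ 2)) ε ?_ hε ?_ t
    · filter_upwards [hpos] with n hn
      rw [← sum_eigenvalues_transpose_mul_self_sq (A n) (hH n)] at hn
      simp_rw [div_pow]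
      rw [← Finset.sum_div, Real.sq_sqrt hn.le, div_self hn.ne']
    · filter_upwards [hpos, hrow] with n hn hr i
      rw [← sum_eigenvalues_transpose_mul_self_sq (A n) (hH n)] at hn hr
      have hs := Real.sqrt_pos.2 hn
      rw [abs_div, abs_of_pos hs, div_le_iff₀ hs]
      refine abs_eigenvalues_transpose_mul_self_le (A n) (hH n) _ ?_ hr i
      exact (Finset.sum_nonneg fun _ _ => abs_nonneg _).trans (hr i)
  have h := (ProbabilityMeasure.tendsto_iff_forall_integral_tendsto.1 hlim) g
  refine h.congr fun n => ?_
  rw [gaussVec, integral_comp_quadVar (A n) (hH n)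
    (f := fun x => g ((x - expV L A n) / √(varV L A n)))
    (g.continuous.measurable.comp (by fun_prop)), hE, hV]
  exact integral_map (hTm n).aemeasurable g.continuous.aestronglyMeasurable

/-- `Σ_{k,l} a_k a_l F(k-l)`, the sum over `j` of `(a^{2*})_j F(j)`. -/
noncomputable def autoSum (a : ℤ → ℝ) (L : ℕ) (F : ℤ → ℝ) : ℝ :=
  ∑ k ∈ Finset.Ico (0 : ℤ) L, ∑ l ∈ Finset.Ico (0 : ℤ) L, a k * a l * F (k - l)

section autoSum

variable {a : ℤ → ℝ} {L : ℕ}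

theorem finsum_mul_eq_sum (hsupp : ∀ j : ℤ, a j ≠ 0 → 0 ≤ j ∧ j ≤ (L : ℤ) - 1) (F : ℤ → ℝ) :
    ∑ᶠ j : ℤ, a j * F j = ∑ j ∈ Finset.Ico (0 : ℤ) L, a j * F j := by
  refine finsum_eq_sum_of_support_subset _ fun j hj => ?_
  have := hsupp j (left_ne_zero_of_mul hj)
  simp only [Finset.coe_Ico, Set.mem_Ico]
  omega

theorem finsum_seqConv_mul (hsupp : ∀ j : ℤ, a j ≠ 0 → 0 ≤ j ∧ j ≤ (L : ℤ) - 1) (F : ℤ → ℝ) :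
    ∑ᶠ j : ℤ, seqConv a a j * F j = autoSum a L F := by
  have h1 : ∀ j, seqConv a a j * F j
      = ∑ k ∈ Finset.Ico (0 : ℤ) L, a k * a (k - j) * F j := fun j => by
    rw [seqConv, finsum_mul_eq_sum hsupp, Finset.sum_mul]
  simp_rw [h1]
  rw [finsum_sum_comm]
  · refine Finset.sum_congr rfl fun k _ => ?_
    rw [← finsum_comp_equiv (Equiv.subLeft k)]
    simp only [Equiv.subLeft_apply, sub_sub_cancel]
    trans ∑ᶠ l : ℤ, a l * (a k * F (k - l))
    · exact finsum_congr fun l => by ring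
    · rw [finsum_mul_eq_sum hsupp]
      exact Finset.sum_congr rfl fun l _ => by ring
  · intro k _
    refine (Finset.finite_toSet (Finset.Ioc (k - L) k)).subset fun j hj => ?_
    have := hsupp _ (right_ne_zero_of_mul (left_ne_zero_of_mul hj))
    simp only [Finset.coe_Ioc, Set.mem_Ioc]
    omega

theorem autoSum_sub (F G : ℤ → ℝ) :
    autoSum a L (fun j => F j - G j) = autoSum a L F - autoSum a L G := by
  simp only [autoSum, mul_sub, Finset.sum_sub_distrib]

theorem autoSum_const_mul (c : ℝ) (F : ℤ → ℝ) :
    autoSum a L (fun j => c * F j) = c * autoSum a L F := by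
  simp only [autoSum, Finset.mul_sum]
  exact Finset.sum_congr rfl fun k _ => Finset.sum_congr rfl fun l _ => by ring

theorem autoSum_finset_sum {ι : Type*} (s : Finset ι) (F : ι → ℤ → ℝ) :
    autoSum a L (fun j => ∑ i ∈ s, F i j) = ∑ i ∈ s, autoSum a L (F i) := by
  simp only [autoSum, Finset.mul_sum]
  refine Eq.trans (Finset.sum_congr rfl fun k _ => ?_) Finset.sum_comm
  exact Finset.sum_comm

theorem abs_autoSum_le {F : ℤ → ℝ} {B : ℝ} (hF : ∀ j : ℤ, |j| ≤ L → |F j| ≤ B) :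
    |autoSum a L F|
      ≤ (∑ k ∈ Finset.Ico (0 : ℤ) L, ∑ l ∈ Finset.Ico (0 : ℤ) L, |a k * a l|) * B := by
  rw [autoSum, Finset.sum_mul]
  refine (Finset.abs_sum_le_sum_abs _ _).trans (Finset.sum_le_sum fun k hk => ?_)
  rw [Finset.sum_mul]
  refine (Finset.abs_sum_le_sum_abs _ _).trans (Finset.sum_le_sum fun l hl => ?_)
  rw [abs_mul]
  refine mul_le_mul_of_nonneg_left (hF _ ?_) (abs_nonneg _)
  rw [Finset.mem_Ico] at hk hl
  rw [abs_le]
  omega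

theorem autoSum_pow (p : ℕ) :
    autoSum a L (fun j => (j : ℝ) ^ p)
      = ∑ i ∈ Finset.range (p + 1), (p.choose i : ℝ) * (-1) ^ (p - i)
          * (∑ k ∈ Finset.Ico (0 : ℤ) L, a k * (k : ℝ) ^ i)
          * (∑ k ∈ Finset.Ico (0 : ℤ) L, a k * (k : ℝ) ^ (p - i)) := by
  have h : ∀ k l : ℤ, (((k - l : ℤ) : ℝ)) ^ p
      = ∑ i ∈ Finset.range (p + 1), (p.choose i : ℝ) * (-1) ^ (p - i)
        * (k : ℝ) ^ i * (l : ℝ) ^ (p - i) := by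
    intro k l
    push_cast
    rw [sub_eq_add_neg, add_pow]
    refine Finset.sum_congr rfl fun i _ => ?_
    rw [neg_pow (l : ℝ)]
    ring
  have h2 : autoSum a L (fun j => (j : ℝ) ^ p)
      = ∑ i ∈ Finset.range (p + 1), ∑ k ∈ Finset.Ico (0 : ℤ) L, ∑ l ∈ Finset.Ico (0 : ℤ) L,
        a k * a l * ((p.choose i : ℝ) * (-1) ^ (p - i) * (k : ℝ) ^ i * (l : ℝ) ^ (p - i)) := by
    simp only [autoSum, h, Finset.mul_sum]
    refine Eq.trans (Finset.sum_congr rfl fun k _ => ?_) Finset.sum_comm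
    exact Finset.sum_comm
  rw [h2]
  refine Finset.sum_congr rfl fun i _ => ?_
  rw [mul_assoc, Finset.sum_mul_sum, Finset.mul_sum]
  refine Finset.sum_congr rfl fun k _ => ?_
  rw [Finset.mul_sum]
  exact Finset.sum_congr rfl fun l _ => by ring

variable {M : ℕ}

theorem autoSum_pow_eq_zero
    (hmom : ∀ k : ℕ, k < M → ∑ j ∈ Finset.Ico (0 : ℤ) L, a j * (j : ℝ) ^ k = 0)
    {p : ℕ} (hp : p < 2 * M) :
    autoSum a L (fun j => (j : ℝ) ^ p) = 0 := by
  rw [autoSum_pow]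
  refine Finset.sum_eq_zero fun i hi => ?_
  rcases lt_or_ge i M with h | h
  · rw [hmom i h]; ring
  · rw [hmom (p - i) (by omega)]; ring

theorem autoSum_pow_ne_zero
    (hmom : ∀ k : ℕ, k < M → ∑ j ∈ Finset.Ico (0 : ℤ) L, a j * (j : ℝ) ^ k = 0)
    (hmomM : ∑ j ∈ Finset.Ico (0 : ℤ) L, a j * (j : ℝ) ^ M ≠ 0) :
    autoSum a L (fun j => (j : ℝ) ^ (2 * M)) ≠ 0 := by
  rw [autoSum_pow, Finset.sum_eq_single M]
  · rw [show 2 * M - M = M by omega]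
    have : ((2 * M).choose M : ℝ) ≠ 0 := by
      exact_mod_cast (Nat.choose_pos (by omega)).ne'
    positivity
  · intro i hi hiM
    rcases lt_or_gt_of_ne hiM with h | h
    · rw [hmom i h]; ring
    · rw [hmom (2 * M - i) (by simp at hi; omega)]; ring
  · intro h
    simp at h
    omega

theorem autoSum_polynomial_eq_zero
    (hmom : ∀ k : ℕ, k < M → ∑ j ∈ Finset.Ico (0 : ℤ) L, a j * (j : ℝ) ^ k = 0)
    (P : Polynomial ℝ) (hP : P.natDegree < 2 * M) :
    autoSum a L (fun j => P.eval (j : ℝ)) = 0 := by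
  simp_rw [Polynomial.eval_eq_sum_range]
  rw [autoSum_finset_sum]
  refine Finset.sum_eq_zero fun i hi => ?_
  rw [autoSum_const_mul, autoSum_pow_eq_zero hmom (by simp at hi; omega), mul_zero]

theorem autoSum_polynomial_affine_eq_zero
    (hmom : ∀ k : ℕ, k < M → ∑ j ∈ Finset.Ico (0 : ℤ) L, a j * (j : ℝ) ^ k = 0)
    (P : Polynomial ℝ) (hP : P.natDegree < 2 * M)
    (x δ : ℝ) : autoSum a L (fun j => P.eval (x + j * δ)) = 0 := by
  have h := autoSum_polynomial_eq_zero hmom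
    (P.comp (Polynomial.C x + Polynomial.X * Polynomial.C δ)) ?_
  · simpa only [Polynomial.eval_comp, Polynomial.eval_add, Polynomial.eval_mul,
      Polynomial.eval_C, Polynomial.eval_X] using h
  · refine (Polynomial.natDegree_comp_le).trans_lt ?_
    refine lt_of_le_of_lt ?_ hP
    refine (Nat.mul_le_mul_left _ ?_).trans (mul_one _).le
    compute_degree

end autoSum

theorem hasDerivAt_abs_rpow_mul_pow {s : ℝ} (hs : 0 < s) (m : ℕ) (h : ℝ) :
    HasDerivAt (fun h : ℝ => |h| ^ s * h ^ (m + 1)) ((s + (m + 1)) * (|h| ^ s * h ^ m)) h := by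
  rcases eq_or_ne h 0 with rfl | h0
  · have hc : ContinuousAt (fun h : ℝ => |h| ^ s * h ^ m) 0 :=
      (continuousAt_id.abs.rpow_const (Or.inr hs.le)).mul (continuousAt_id.pow m)
    rw [hasDerivAt_iff_tendsto_slope]
    have h1 : (fun h : ℝ => |h| ^ s * h ^ m) 0 = 0 := by simp [Real.zero_rpow hs.ne']
    have h2 : (s + (m + 1)) * (|(0 : ℝ)| ^ s * 0 ^ m) = (fun h : ℝ => |h| ^ s * h ^ m) 0 := by
      rw [h1]; simp [Real.zero_rpow hs.ne']
    rw [h2]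
    refine (hc.tendsto.mono_left nhdsWithin_le_nhds).congr' ?_
    filter_upwards [self_mem_nhdsWithin] with y hy
    rw [slope_def_field]
    field_simp [show y ≠ 0 from hy]
    simp
    ring
  · have h1 : HasDerivAt (fun h : ℝ => |h| ^ s) (s * |h| ^ s / h) h := by
      have hd : HasDerivAt (fun h : ℝ => |h|) (SignType.sign h : ℝ) h := hasDerivAt_abs h0
      have := hd.rpow_const (p := s) (Or.inl (abs_ne_zero.2 h0))
      refine this.congr_deriv ?_
      rw [Real.rpow_sub_one (abs_ne_zero.2 h0)]
      rcases lt_or_gt_of_ne h0 with hn | hp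
      · simp [hn, abs_of_neg hn]; field_simp
      · simp [hp, abs_of_pos hp]; field_simp
    have h2 := h1.mul (hasDerivAt_pow (m + 1) h)
    refine h2.congr_deriv ?_
    rw [Nat.add_sub_cancel]
    push_cast
    field_simp
    ring

/-- Integration of a small-`o` estimate. -/
theorem isLittleO_of_deriv_isLittleO {f f' : ℝ → ℝ} {q : ℝ} (hq : 0 < q) (h0 : f 0 = 0)
    (hf : ∀ x, HasDerivAt f (f' x) x) (ho : f' =o[nhds 0] fun h : ℝ => |h| ^ q) :
    f =o[nhds 0] fun h : ℝ => |h| ^ (q + 1) := by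
  rw [Asymptotics.isLittleO_iff] at ho ⊢
  intro c hc
  obtain ⟨η, hη, hb⟩ := Metric.eventually_nhds_iff.1 (ho hc)
  refine Metric.eventually_nhds_iff.2 ⟨η, hη, fun y hy => ?_⟩
  rw [Real.dist_eq, sub_zero] at hy
  have hbound : ∀ x ∈ Metric.closedBall (0 : ℝ) |y|, ‖f' x‖ ≤ c * |y| ^ q := by
    intro x hx
    rw [Metric.mem_closedBall, Real.dist_eq, sub_zero] at hx
    have := hb (y := x) (by rw [Real.dist_eq, sub_zero]; exact hx.trans_lt hy)
    refine this.trans ?_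
    rw [Real.norm_of_nonneg (by positivity)]
    gcongr
  have := (convex_closedBall (0 : ℝ) |y|).norm_image_sub_le_of_norm_hasDerivWithin_le
    (fun x _ => (hf x).hasDerivWithinAt) hbound (x := 0) (y := y) (by simp) (by simp)
  rw [h0, sub_zero, sub_zero, Real.norm_eq_abs y] at this
  refine this.trans (le_of_eq ?_)
  rw [Real.norm_of_nonneg (by positivity)]
  rcases eq_or_ne y 0 with rfl | hy0
  · simp [Real.zero_rpow (by linarith : q + 1 ≠ 0)]
  · rw [Real.rpow_add_one (abs_ne_zero.2 hy0)]; ring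

/-- Taylor–Peano expansion for a function whose `m`-th derivative has a power singularity. -/
theorem exists_expansion {s : ℝ} (hs : 0 < s) (m : ℕ) : ∀ (f : ℝ → ℝ) (c K : ℝ),
    ContDiff ℝ m f →
    ((fun h => iteratedDeriv m f h - c - K * |h| ^ s) =o[nhds 0] fun h : ℝ => |h| ^ s) →
    K ≠ 0 →
    ∃ (P : Polynomial ℝ) (K' : ℝ), P.natDegree ≤ m ∧ K' ≠ 0 ∧
      (fun h => f h - P.eval h - K' * (|h| ^ s * h ^ m)) =o[nhds 0] fun h : ℝ => |h| ^ (s + m) := by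
  induction m with
  | zero =>
    intro f c K hf ho hK
    refine ⟨Polynomial.C c, K, by simp, hK, ?_⟩
    simpa using ho
  | succ m ih =>
    intro f c K hf ho hK
    have hf' : ContDiff ℝ m (deriv f) := by
      have : ContDiff ℝ ((m : WithTop ℕ∞) + 1) f := by exact_mod_cast hf
      exact (contDiff_succ_iff_deriv.1 this).2.2
    have hdf : Differentiable ℝ f := hf.differentiable (by simp)
    obtain ⟨P, K', hP, hK', ho'⟩ := ih (deriv f) c K hf'
      (by rw [iteratedDeriv_succ'] at ho; exact ho) hK
    set Q : Polynomial ℝ := ∑ i ∈ Finset.range (m + 1),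
      Polynomial.C (P.coeff i / (i + 1)) * Polynomial.X ^ (i + 1) with hQ
    have hQd : Q.derivative = P := by
      rw [hQ, Polynomial.derivative_sum]
      conv_rhs => rw [P.as_sum_range' (m + 1) (by omega)]
      refine Finset.sum_congr rfl fun i _ => ?_
      rw [Polynomial.derivative_C_mul_X_pow, ← Polynomial.C_mul_X_pow_eq_monomial]
      congr 2
      push_cast
      field_simp
    have hQ0 : Q.eval 0 = 0 := by
      rw [hQ, Polynomial.eval_finsetSum]
      refine Finset.sum_eq_zero fun i _ => by simp
    have hQn : Q.natDegree ≤ m + 1 := by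
      refine Polynomial.natDegree_sum_le_of_forall_le _ _ fun i hi => ?_
      refine (Polynomial.natDegree_C_mul_X_pow_le _ _).trans ?_
      simp at hi; omega
    have hsm : (s + (m + 1) : ℝ) ≠ 0 := by positivity
    refine ⟨Q + Polynomial.C (f 0), K' / (s + (m + 1)), ?_, div_ne_zero hK' hsm, ?_⟩
    · refine (Polynomial.natDegree_add_le _ _).trans (max_le hQn ?_)
      simp
    · have := isLittleO_of_deriv_isLittleO (q := s + m)
        (f := fun h => f h - (Q + Polynomial.C (f 0)).eval h
          - K' / (s + (m + 1)) * (|h| ^ s * h ^ (m + 1))) (by positivity)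
        (by simp [hQ0]) (fun x => ?_) ho'
      · simpa only [Nat.cast_add, Nat.cast_one, add_assoc] using this
      · have h1 := (hdf x).hasDerivAt
        have h2 := (Q + Polynomial.C (f 0)).hasDerivAt x
        have h3 := (hasDerivAt_abs_rpow_mul_pow hs m x).const_mul (K' / (s + (m + 1)))
        refine ((h1.sub h2).sub h3).congr_deriv ?_
        rw [Polynomial.derivative_add, hQd, Polynomial.derivative_C, add_zero, ← mul_assoc,
          div_mul_cancel₀ _ hsm]

theorem abs_autoSum_le_of_iteratedDeriv_le {a : ℤ → ℝ} {L M n : ℕ}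
    (hmom : ∀ k : ℕ, k < M → ∑ j ∈ Finset.Ico (0 : ℤ) L, a j * (j : ℝ) ^ k = 0)
    (hn : n + 1 ≤ 2 * M) {f : ℝ → ℝ} (hf : ContDiffOn ℝ (⊤ : ℕ∞) f (Set.Ioi 0))
    {x δ B : ℝ} (hL : 1 ≤ L) (hδ : 0 < δ) (hx : L * δ < x)
    (hB : ∀ y, x - L * δ ≤ y → |iteratedDeriv (n + 1) f y| ≤ B) :
    |autoSum a L (fun j => f (x + j * δ))|
      ≤ (∑ k ∈ Finset.Ico (0 : ℤ) L, ∑ l ∈ Finset.Ico (0 : ℤ) L, |a k * a l|)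
        * (B * (2 * L * δ) ^ (n + 1) / n.factorial) := by
  set u := x - L * δ with hu
  set v := x + L * δ with hv
  have hLδ : 0 < (L : ℝ) * δ := by positivity
  have huv : u < v := by linarith
  have hu0 : 0 < u := by linarith
  have hsub : Set.Icc u v ⊆ Set.Ioi 0 := fun y hy => hu0.trans_le hy.1
  have hfI : ContDiffOn ℝ (n + 1) f (Set.Icc u v) :=
    (hf.mono hsub).of_le (by exact_mod_cast le_top)
  have hder : ∀ y ∈ Set.Icc u v, ‖iteratedDerivWithin (n + 1) f (Set.Icc u v) y‖ ≤ B := by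
    intro y hy
    rw [iteratedDerivWithin_eq_iteratedDeriv (uniqueDiffOn_Icc huv) _ hy]
    · exact hB y hy.1
    · exact (hf.contDiffAt (isOpen_Ioi.mem_nhds (hsub hy))).of_le (by exact_mod_cast le_top)
  have hB0 : 0 ≤ B := (norm_nonneg _).trans (hder u ⟨le_rfl, huv.le⟩)
  set P : Polynomial ℝ := ∑ k ∈ Finset.range (n + 1),
    Polynomial.C ((k.factorial : ℝ)⁻¹ * iteratedDerivWithin k f (Set.Icc u v) u)
      * (Polynomial.X - Polynomial.C u) ^ k with hP
  have hPeval : ∀ y, taylorWithinEval f n (Set.Icc u v) u y = P.eval y := by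
    intro y
    rw [taylor_within_apply, hP, Polynomial.eval_finsetSum]
    refine Finset.sum_congr rfl fun k _ => ?_
    simp only [smul_eq_mul, Polynomial.eval_mul, Polynomial.eval_C, Polynomial.eval_pow,
      Polynomial.eval_sub, Polynomial.eval_X]
    ring
  have hPdeg : P.natDegree < 2 * M := by
    refine lt_of_le_of_lt (Polynomial.natDegree_sum_le_of_forall_le (n := n) _ _ fun k hk => ?_)
      (by omega)
    refine (Polynomial.natDegree_C_mul_le _ _).trans ?_
    rw [Polynomial.natDegree_pow, Polynomial.natDegree_X_sub_C]
    simp at hk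
    omega
  have h0 := autoSum_polynomial_affine_eq_zero hmom P hPdeg x δ
  have h1 := autoSum_sub (a := a) (L := L) (fun j => f (x + j * δ)) (fun j => P.eval (x + j * δ))
  rw [h0, sub_zero] at h1
  rw [← h1]
  refine abs_autoSum_le fun j hj => ?_
  have hj' : |(j : ℝ) * δ| ≤ L * δ := by
    rw [abs_mul, abs_of_pos hδ]
    gcongr
    exact_mod_cast hj
  obtain ⟨hj1, hj2⟩ := abs_le.1 hj'
  have hmem : x + j * δ ∈ Set.Icc u v := ⟨by linarith, by linarith⟩
  have h2 := taylor_mean_remainder_bound huv.le hfI hmem hder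
  rw [hPeval, Real.norm_eq_abs] at h2
  refine h2.trans ?_
  have : x + j * δ - u ≤ 2 * L * δ := by linarith
  have : 0 ≤ x + j * δ - u := by linarith [hmem.1]
  gcongr

theorem exists_abs_iteratedDeriv_le {f r : ℝ → ℝ} {m d : ℕ} {c C s β K : ℝ} (hd : 1 ≤ d)
    (hf : ∀ h : ℝ, iteratedDeriv m f h = c + C * |h| ^ s + r h)
    (hr : ContDiffOn ℝ d r {(0 : ℝ)}ᶜ)
    (hK : ∀ h : ℝ, h ≠ 0 → |iteratedDeriv d r h| ≤ K * |h| ^ β) :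
    ∃ B : ℝ, 0 ≤ B ∧ ∀ y : ℝ, 0 < y → |iteratedDeriv (m + d) f y| ≤ B * (y ^ (s - d) + y ^ β) := by
  refine ⟨|C * (descPochhammer ℝ d).eval s| + |K|, by positivity, fun y hy => ?_⟩
  have h1 : iteratedDeriv (m + d) f y = iteratedDeriv d (iteratedDeriv m f) y := by
    simp only [iteratedDeriv_eq_iterate, add_comm m d, Function.iterate_add_apply]
  have h2 : iteratedDeriv m f =ᶠ[nhds y] fun h => (c + C * h ^ s) + r h := by
    filter_upwards [lt_mem_nhds hy] with h hh
    rw [hf, abs_of_pos hh]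
  have hrp : ContDiffAt ℝ d (fun h : ℝ => h ^ s) y := Real.contDiffAt_rpow_const_of_ne hy.ne'
  have hr' : ContDiffAt ℝ d r y :=
    hr.contDiffAt (isOpen_compl_singleton.mem_nhds hy.ne')
  have h3 : iteratedDeriv (m + d) f y
      = C * ((descPochhammer ℝ d).eval s * y ^ (s - d)) + iteratedDeriv d r y := by
    rw [h1, h2.iteratedDeriv_eq,
      iteratedDeriv_fun_add (contDiffAt_const.add (contDiffAt_const.mul hrp)) hr',
      iteratedDeriv_fun_add contDiffAt_const (contDiffAt_const.mul hrp),
      iteratedDeriv_const_mul_field, iteratedDeriv_eq_iterate (f := fun h : ℝ => h ^ s),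
      Real.iter_deriv_rpow_const, iteratedDeriv_const, if_neg (by omega), zero_add]
  have h4 := hK y hy.ne'
  rw [abs_of_pos hy] at h4
  have hp1 : 0 < y ^ (s - d) := Real.rpow_pos_of_pos hy _
  have hp2 : 0 < y ^ β := Real.rpow_pos_of_pos hy _
  rw [h3, ← mul_assoc]
  calc _ ≤ |C * (descPochhammer ℝ d).eval s * y ^ (s - d)| + |iteratedDeriv d r y| :=
        abs_add_le _ _
    _ ≤ |C * (descPochhammer ℝ d).eval s| * y ^ (s - d) + |K| * y ^ β := by
        rw [abs_mul _ (y ^ _), abs_of_pos hp1]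
        gcongr
        exact h4.trans (by gcongr; exact le_abs_self K)
    _ ≤ _ := by
        nlinarith [abs_nonneg (C * (descPochhammer ℝ d).eval s), abs_nonneg K,
          mul_nonneg (abs_nonneg (C * (descPochhammer ℝ d).eval s)) hp2.le,
          mul_nonneg (abs_nonneg K) hp1.le]

/-- Decay of the covariance at distance `k` of the increments on a grid of mesh `δ`. -/
theorem exists_abs_autoSum_le_rpow {a : ℤ → ℝ} {L M m d : ℕ} {f r : ℝ → ℝ} {c C s β K : ℝ}
    (hmom : ∀ k : ℕ, k < M → ∑ j ∈ Finset.Ico (0 : ℤ) L, a j * (j : ℝ) ^ k = 0)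
    (hL : 1 ≤ L) (hd : 1 ≤ d) (hmd : m + d ≤ 2 * M)
    (hsm : ContDiffOn ℝ (⊤ : ℕ∞) f (Set.Ioi 0))
    (hf : ∀ h : ℝ, iteratedDeriv m f h = c + C * |h| ^ s + r h)
    (hr : ContDiffOn ℝ d r {(0 : ℝ)}ᶜ) (hβ : s - d < β) (hβ0 : β < 0)
    (hK : ∀ h : ℝ, h ≠ 0 → |iteratedDeriv d r h| ≤ K * |h| ^ β) :
    ∃ B : ℝ, 0 ≤ B ∧ ∀ δ : ℝ, 0 < δ → δ ≤ 1 → ∀ k : ℕ, 2 * L ≤ k →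
      |autoSum a L (fun j => f (((k : ℝ) + j) * δ))| ≤ B * (δ ^ (m + s) * (k : ℝ) ^ β) := by
  obtain ⟨B, hB0, hB⟩ := exists_abs_iteratedDeriv_le hd hf hr hK
  obtain ⟨n, rfl⟩ := Nat.exists_eq_add_of_le' hd
  set S := ∑ k ∈ Finset.Ico (0 : ℤ) L, ∑ l ∈ Finset.Ico (0 : ℤ) L, |a k * a l| with hS
  have hS0 : 0 ≤ S := Finset.sum_nonneg fun _ _ => Finset.sum_nonneg fun _ _ => abs_nonneg _
  set e : ℝ := s - (n + 1 : ℕ) with he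
  have he0 : e < 0 := hβ.trans hβ0
  set T : ℝ := (2⁻¹ : ℝ) ^ e + (2⁻¹ : ℝ) ^ β with hT
  refine ⟨S * (B * T * (2 * L) ^ (m + n + 1) / (m + n).factorial), by positivity,
    fun δ hδ hδ1 k hk => ?_⟩
  have hk1 : (1 : ℝ) ≤ k := by exact_mod_cast (by omega : 1 ≤ k)
  have hk0 : (0 : ℝ) < k := by linarith
  have hkL : 2 * (L : ℝ) ≤ k := by exact_mod_cast hk
  have hL0 : (1 : ℝ) ≤ L := by exact_mod_cast hL
  have hkδ : 0 < k * δ := by positivity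
  have hbase : 2⁻¹ * (k * δ) ≤ k * δ - L * δ := by nlinarith
  have hmain := abs_autoSum_le_of_iteratedDeriv_le hmom (n := m + n) hmd hsm
    (x := k * δ) (δ := δ) (B := B * (T * (k ^ β * δ ^ e))) hL hδ (by nlinarith) fun y hy => by
      have hy' : 2⁻¹ * (k * δ) ≤ y := hbase.trans hy
      have hpos : 0 < 2⁻¹ * (k * δ) := by positivity
      refine (hB y (hpos.trans_le hy')).trans ?_
      refine mul_le_mul_of_nonneg_left ?_ hB0
      have h1 : y ^ e ≤ (2⁻¹ : ℝ) ^ e * (k ^ β * δ ^ e) := by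
        refine (Real.rpow_le_rpow_of_nonpos hpos hy' he0.le).trans ?_
        rw [Real.mul_rpow (by norm_num) hkδ.le, Real.mul_rpow hk0.le hδ.le]
        gcongr
      have h2 : y ^ β ≤ (2⁻¹ : ℝ) ^ β * (k ^ β * δ ^ e) := by
        refine (Real.rpow_le_rpow_of_nonpos hpos hy' hβ0.le).trans ?_
        rw [Real.mul_rpow (by norm_num) hkδ.le, Real.mul_rpow hk0.le hδ.le]
        gcongr _ * (_ * ?_)
        exact Real.rpow_le_rpow_of_exponent_ge hδ hδ1 hβ.le
      rw [hT, add_mul]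
      exact add_le_add h1 h2
  simp_rw [add_mul]
  refine hmain.trans (le_of_eq ?_)
  have hpow : δ ^ ((m : ℝ) + s) = δ ^ e * δ ^ (m + n + 1) := by
    rw [← Real.rpow_natCast δ (m + n + 1), ← Real.rpow_add hδ]
    congr 1
    rw [he]; push_cast; ring
  rw [hpow, ← hS, mul_pow _ δ]
  ring

theorem descPochhammer_eval_ne_zero {p : ℝ} {n : ℕ} (hp : ∀ i : ℕ, p ≠ i) :
    (descPochhammer ℝ n).eval p ≠ 0 := by
  rw [descPochhammer_eval_eq_prod_range]
  exact Finset.prod_ne_zero_iff.2 fun i _ => sub_ne_zero.2 (hp i)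

theorem exists_rpow_expansion_one (p : ℝ) (n : ℕ) :
    ∃ c : ℕ → ℝ, c n = (n.factorial : ℝ)⁻¹ * (descPochhammer ℝ n).eval p ∧
      (fun t : ℝ => (1 + t) ^ p - ∑ i ∈ Finset.range (n + 1), c i * t ^ i) =o[nhds 0]
        fun t : ℝ => t ^ n := by
  refine ⟨fun i => (i.factorial : ℝ)⁻¹ * iteratedDeriv i (fun x : ℝ => x ^ p) 1, ?_, ?_⟩
  · simp only [iteratedDeriv_eq_iterate, Real.iter_deriv_rpow_const, Real.one_rpow, mul_one]
  · have hsm : ∀ m : ℕ, ∀ x ∈ Set.Ioi (0 : ℝ), ContDiffAt ℝ m (fun x : ℝ => x ^ p) x :=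
      fun m x hx => Real.contDiffAt_rpow_const_of_ne (ne_of_gt hx)
    have h := taylor_isLittleO (convex_Ioi (0 : ℝ)) (x₀ := 1) (by simp)
      (f := fun x : ℝ => x ^ p) (n := n) fun x hx => (hsm n x hx).contDiffWithinAt
    rw [IsOpen.nhdsWithin_eq isOpen_Ioi (by simp)] at h
    have ht : Tendsto (fun t : ℝ => 1 + t) (nhds 0) (nhds 1) := by
      have : Continuous fun t : ℝ => 1 + t := by fun_prop
      simpa using this.tendsto 0
    have := h.comp_tendsto ht
    refine (this.congr_left fun t => ?_).congr_right fun t => by simp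
    simp only [Function.comp_apply, taylor_within_apply, add_sub_cancel_left, smul_eq_mul]
    congr 1
    refine Finset.sum_congr rfl fun i _ => ?_
    rw [iteratedDerivWithin_eq_iteratedDeriv (uniqueDiffOn_Ioi 0) (hsm i 1 (by simp)) (by simp)]
    ring

section nonvanishing

variable {a : ℤ → ℝ} {L M D : ℕ} {s : ℝ}

theorem exists_autoSum_ne_zero_of_one
    (hmom : ∀ k : ℕ, k < M → ∑ j ∈ Finset.Ico (0 : ℤ) L, a j * (j : ℝ) ^ k = 0)
    (hL : 2 ≤ L) (ha0 : a 0 ≠ 0)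
    (haL : a ((L : ℤ) - 1) ≠ 0) (hMD : D < M) :
    ∃ k : ℕ, autoSum a L (fun j => |(k : ℝ) + j| * ((k : ℝ) + j) ^ (2 * D)) ≠ 0 := by
  obtain ⟨k, rfl⟩ := Nat.exists_eq_add_of_le' hL
  refine ⟨k, ?_⟩
  have hP := autoSum_polynomial_affine_eq_zero hmom (Polynomial.X ^ (2 * D + 1))
    (by rw [Polynomial.natDegree_X_pow]; omega) k 1
  simp only [mul_one, Polynomial.eval_pow, Polynomial.eval_X] at hP
  suffices h : autoSum a (k + 2) (fun j => |(k : ℝ) + j| * ((k : ℝ) + j) ^ (2 * D)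
      - ((k : ℝ) + j) ^ (2 * D + 1)) ≠ 0 by
    rwa [autoSum_sub, hP, sub_zero] at h
  rw [autoSum, Finset.sum_eq_single 0, Finset.sum_eq_single ((k : ℤ) + 1)]
  · have h1 : a ((k : ℤ) + 1) ≠ 0 := by
      convert haL using 2
      push_cast; ring
    have h2 : (k : ℝ) + ((0 - ((k : ℤ) + 1) : ℤ) : ℝ) = -1 := by push_cast; ring
    rw [h2, pow_succ, Even.neg_one_pow (even_two_mul D)]
    norm_num
    exact ⟨ha0, h1⟩
  · intro l hl hlk
    rw [Finset.mem_Ico] at hl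
    have : (0 : ℝ) ≤ (k : ℝ) + ((0 - l : ℤ) : ℝ) := by
      have : (0 : ℤ) ≤ k + (0 - l) := by omega
      exact_mod_cast this
    rw [abs_of_nonneg this, pow_succ]
    ring
  · intro h
    exact absurd (Finset.mem_Ico.2 ⟨by omega, by push_cast; omega⟩) h
  · intro i hi hi0
    refine Finset.sum_eq_zero fun l hl => ?_
    rw [Finset.mem_Ico] at hi hl
    have : (0 : ℝ) ≤ (k : ℝ) + ((i - l : ℤ) : ℝ) := by
      have : (0 : ℤ) ≤ k + (i - l) := by omega
      exact_mod_cast this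
    rw [abs_of_nonneg this, pow_succ]
    ring
  · intro h
    exact absurd (Finset.mem_Ico.2 ⟨le_rfl, by omega⟩) h

set_option maxHeartbeats 1000000 in
theorem exists_autoSum_ne_zero_of_ne_one
    (hmom : ∀ k : ℕ, k < M → ∑ j ∈ Finset.Ico (0 : ℤ) L, a j * (j : ℝ) ^ k = 0)

        (hmomM : ∑ j ∈ Finset.Ico (0 : ℤ) L, a j * (j : ℝ) ^ M ≠ 0)
    (hp : ∀ i : ℕ, s + (2 * D : ℕ) ≠ i) :
    ∃ k : ℕ, autoSum a L (fun j => |(k : ℝ) + j| ^ s * ((k : ℝ) + j) ^ (2 * D)) ≠ 0 := by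
  by_contra! hz
  set p : ℝ := s + (2 * D : ℕ) with hpdef
  obtain ⟨c, hc, ho⟩ := exists_rpow_expansion_one p (2 * M)
  have hc0 : c (2 * M) ≠ 0 := by
    rw [hc]
    exact mul_ne_zero (by positivity) (descPochhammer_eval_ne_zero hp)
  set Q := autoSum a L (fun j => (j : ℝ) ^ (2 * M)) with hQ
  have hQ0 : Q ≠ 0 := autoSum_pow_ne_zero hmom hmomM
  have hy : Tendsto (fun k : ℕ => ((k : ℝ))⁻¹) atTop (nhds 0) :=
    tendsto_inv_atTop_zero.comp tendsto_natCast_atTop_atTop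
  set S := ∑ k ∈ Finset.Ico (0 : ℤ) L, ∑ l ∈ Finset.Ico (0 : ℤ) L, |a k * a l| with hS
  have hS0 : 0 ≤ S := Finset.sum_nonneg fun _ _ => Finset.sum_nonneg fun _ _ => abs_nonneg _
  set e : ℝ := |c (2 * M) * Q| / (2 * ((S + 1) * ((L : ℝ) + 1) ^ (2 * M))) with he
  have he0 : 0 < e := by
    have := abs_pos.2 (mul_ne_zero hc0 hQ0)
    positivity
  obtain ⟨η, hη, hb⟩ := Metric.eventually_nhds_iff.1 (ho.def he0)
  have hyL : Tendsto (fun k : ℕ => (L : ℝ) * ((k : ℝ))⁻¹) atTop (nhds 0) := by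
    simpa using hy.const_mul (L : ℝ)
  obtain ⟨k, hkL, hkη⟩ := ((eventually_gt_atTop L).and (hyL.eventually (gt_mem_nhds hη))).exists
  have hk0 : (0 : ℝ) < k := by exact_mod_cast (Nat.zero_le L).trans_lt hkL
  set y : ℝ := (k : ℝ)⁻¹ with hydef
  have hy0 : 0 < y := inv_pos.2 hk0
  have hg : autoSum a L (fun j => (1 + j * y) ^ p) = 0 := by
    have h1 := hz k
    have h2 : autoSum a L (fun j => |(k : ℝ) + j| ^ s * ((k : ℝ) + j) ^ (2 * D))
        = autoSum a L (fun j => (k : ℝ) ^ p * (1 + j * y) ^ p) := by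
      rw [autoSum, autoSum]
      refine Finset.sum_congr rfl fun i hi => Finset.sum_congr rfl fun l hl => ?_
      congr 1
      rw [Finset.mem_Ico] at hi hl
      have h3 : (0 : ℝ) < (k : ℝ) + ((i - l : ℤ) : ℝ) := by
        have : (0 : ℤ) < k + (i - l) := by omega
        exact_mod_cast this
      have h4 : (k : ℝ) * (1 + ((i - l : ℤ) : ℝ) * y) = (k : ℝ) + ((i - l : ℤ) : ℝ) := by
        rw [hydef]; field_simp
      have h5 : 0 ≤ 1 + ((i - l : ℤ) : ℝ) * y := by
        have : 0 < (k : ℝ) * (1 + ((i - l : ℤ) : ℝ) * y) := h4 ▸ h3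
        exact (pos_of_mul_pos_right this hk0.le).le
      rw [← Real.mul_rpow hk0.le h5, h4, abs_of_pos h3, hpdef, Real.rpow_add h3,
        Real.rpow_natCast]
    rw [h2, autoSum_const_mul] at h1
    exact (mul_eq_zero.1 h1).resolve_left (Real.rpow_pos_of_pos hk0 p).ne'
  have hT : autoSum a L (fun j => ∑ i ∈ Finset.range (2 * M + 1), c i * (j * y) ^ i)
      = c (2 * M) * y ^ (2 * M) * Q := by
    rw [autoSum_finset_sum, Finset.sum_range_succ, Finset.sum_eq_zero, zero_add]
    · simp_rw [mul_pow, mul_comm _ (y ^ (2 * M))]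
      rw [autoSum_const_mul, autoSum_const_mul, ← hQ]
      ring
    · intro i hi
      simp_rw [mul_pow, mul_comm _ (y ^ i)]
      rw [autoSum_const_mul, autoSum_const_mul, autoSum_pow_eq_zero hmom (by simpa using hi)]
      simp
  have hdiff := autoSum_sub (a := a) (L := L) (fun j => (1 + j * y) ^ p)
    (fun j => ∑ i ∈ Finset.range (2 * M + 1), c i * (j * y) ^ i)
  rw [hg, hT, zero_sub] at hdiff
  have hbd := abs_autoSum_le (a := a) (L := L) (F := fun j : ℤ => (1 + (j : ℝ) * y) ^ p
    - ∑ i ∈ Finset.range (2 * M + 1), c i * ((j : ℝ) * y) ^ i)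
    (B := e * (((L : ℝ) + 1) ^ (2 * M) * y ^ (2 * M))) (fun j hj => by
      have hjL : |(j : ℝ)| ≤ L := by exact_mod_cast hj
      have hjy : |(j : ℝ) * y| ≤ L * y := by
        rw [abs_mul, abs_of_pos hy0]
        exact mul_le_mul_of_nonneg_right hjL hy0.le
      have := hb (y := j * y) (by
        rw [Real.dist_eq, sub_zero]
        exact hjy.trans_lt hkη)
      refine this.trans ?_
      rw [Real.norm_eq_abs, abs_pow, ← mul_pow]
      gcongr
      refine hjy.trans ?_
      gcongr
      linarith)
  rw [hdiff, abs_neg, ← hS] at hbd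
  have hyM : 0 < y ^ (2 * M) := by positivity
  have h6 : |c (2 * M) * Q| * y ^ (2 * M) ≤ S * (e * ((L : ℝ) + 1) ^ (2 * M)) * y ^ (2 * M) := by
    calc |c (2 * M) * Q| * y ^ (2 * M) = |c (2 * M) * y ^ (2 * M) * Q| := by
          rw [mul_right_comm, abs_mul _ (y ^ _), abs_of_pos hyM]
      _ ≤ _ := hbd
      _ = _ := by ring
  have h7 := le_of_mul_le_mul_right h6 hyM
  have hL1 : (0 : ℝ) < ((L : ℝ) + 1) ^ (2 * M) := by positivity
  have h8 : e * ((L : ℝ) + 1) ^ (2 * M) = |c (2 * M) * Q| / (2 * (S + 1)) := by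
    rw [he]; field_simp
  rw [h8] at h7
  have h9 := abs_pos.2 (mul_ne_zero hc0 hQ0)
  have h10 : S * (|c (2 * M) * Q| / (2 * (S + 1))) < |c (2 * M) * Q| := by
    rw [← mul_div_assoc, div_lt_iff₀ (by positivity)]
    nlinarith
  linarith

/-- The limiting covariance kernel does not vanish identically. -/
theorem exists_autoSum_abs_rpow_mul_pow_ne_zero
    (hmom : ∀ k : ℕ, k < M → ∑ j ∈ Finset.Ico (0 : ℤ) L, a j * (j : ℝ) ^ k = 0)
    (hs0 : 0 < s) (hs2 : s < 2) (hL : 1 ≤ L)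
    (hM : 1 ≤ M) (ha0 : a 0 ≠ 0) (haL : a ((L : ℤ) - 1) ≠ 0) (hMD : D < M)
    (hmomM : ∑ j ∈ Finset.Ico (0 : ℤ) L, a j * (j : ℝ) ^ M ≠ 0) :
    ∃ k : ℕ, autoSum a L (fun j => |(k : ℝ) + j| ^ s * ((k : ℝ) + j) ^ (2 * D)) ≠ 0 := by
  by_cases h1 : s = 1
  · have hL2 : 2 ≤ L := by
      by_contra h
      obtain rfl : L = 1 := by omega
      have := hmom 0 hM
      simp [Finset.sum_eq_single (0 : ℤ), show Finset.Ico (0 : ℤ) 1 = {0} from rfl] at this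
      exact ha0 this
    simpa [h1] using exists_autoSum_ne_zero_of_one hmom hL2 ha0 haL hMD
  · refine exists_autoSum_ne_zero_of_ne_one hmom hmomM fun i hi => h1 ?_
    have h2 : s = ((i - 2 * D : ℤ) : ℝ) := by push_cast at hi ⊢; linarith
    rw [h2] at hs0 hs2 ⊢
    have h3 : (0 : ℤ) < i - 2 * D := by exact_mod_cast hs0
    have h4 : (i - 2 * D : ℤ) < 2 := by exact_mod_cast hs2
    rw [show (i - 2 * D : ℤ) = 1 by omega]
    simp

end nonvanishing

/-- The covariances of the increments, rescaled, converge as the mesh tends to zero. -/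
theorem exists_tendsto_autoSum_div {a : ℤ → ℝ} {L M m : ℕ} {f r : ℝ → ℝ} {c K s : ℝ}
    (hmom : ∀ k : ℕ, k < M → ∑ j ∈ Finset.Ico (0 : ℤ) L, a j * (j : ℝ) ^ k = 0)
    (hm : m < 2 * M) (hs : 0 < s) (hfm : ContDiff ℝ m f)
    (hf : ∀ h : ℝ, iteratedDeriv m f h = c + K * |h| ^ s + r h)
    (hr : r =o[nhds (0 : ℝ)] fun h => |h| ^ s) (hK : K ≠ 0)
    {δ : ℕ → ℝ} (hδ : Tendsto δ atTop (nhds 0)) (hδ0 : ∀ᶠ n in atTop, 0 < δ n) :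
    ∃ K' : ℝ, K' ≠ 0 ∧ ∀ k : ℕ,
      Tendsto (fun n => autoSum a L (fun j => f (((k : ℝ) + j) * δ n)) / δ n ^ (m + s)) atTop
        (nhds (K' * autoSum a L (fun j => |(k : ℝ) + j| ^ s * ((k : ℝ) + j) ^ m))) := by
  obtain ⟨P, K', hP, hK', ho⟩ := exists_expansion hs m f c K hfm
    (hr.congr_left fun h => by rw [hf]; ring) hK
  refine ⟨K', hK', fun k => ?_⟩
  set R : ℝ → ℝ := fun h => f h - P.eval h - K' * (|h| ^ s * h ^ m) with hR
  have hrem : ∀ x : ℝ, Tendsto (fun n => R (x * δ n) / δ n ^ (m + s)) atTop (nhds 0) := by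
    intro x
    have hx : Tendsto (fun n => x * δ n) atTop (nhds 0) := by simpa using hδ.const_mul x
    refine Asymptotics.IsLittleO.tendsto_div_nhds_zero ((ho.comp_tendsto hx).trans_isBigO ?_)
    refine Asymptotics.IsBigO.of_bound (|x| ^ (s + m)) (hδ0.mono fun n hn => ?_)
    rw [Function.comp_apply, Real.norm_eq_abs, Real.norm_eq_abs, abs_mul, abs_of_pos hn,
      Real.mul_rpow (abs_nonneg x) hn.le, add_comm (m : ℝ), abs_mul,
      abs_of_nonneg (Real.rpow_nonneg (abs_nonneg x) _)]
  have hlim : Tendsto (fun n => autoSum a L (fun j => R (((k : ℝ) + j) * δ n) / δ n ^ (m + s)))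
      atTop (nhds 0) := by
    have : Tendsto (fun n => autoSum a L (fun j => R (((k : ℝ) + j) * δ n) / δ n ^ (m + s)))
        atTop (nhds (∑ i ∈ Finset.Ico (0 : ℤ) L, ∑ l ∈ Finset.Ico (0 : ℤ) L, a i * a l * 0)) :=
      tendsto_finsetSum _ fun i _ => tendsto_finsetSum _ fun l _ =>
        (hrem _).const_mul (a i * a l)
    simpa using this
  have hlim' := hlim.add_const
    (K' * autoSum a L (fun j => |(k : ℝ) + j| ^ s * ((k : ℝ) + j) ^ m))
  rw [zero_add] at hlim'
  refine hlim'.congr' (hδ0.mono fun n hn => ?_)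
  have hw : δ n ^ ((m : ℝ) + s) ≠ 0 := (Real.rpow_pos_of_pos hn _).ne'
  have hpoly : autoSum a L (fun j => P.eval (((k : ℝ) + j) * δ n)) = 0 := by
    simp_rw [add_mul]
    exact autoSum_polynomial_affine_eq_zero hmom P (hP.trans_lt hm) _ _
  have hker : autoSum a L (fun j => K' * (|((k : ℝ) + j) * δ n| ^ s * (((k : ℝ) + j) * δ n) ^ m))
      = K' * δ n ^ ((m : ℝ) + s)
        * autoSum a L (fun j => |(k : ℝ) + j| ^ s * ((k : ℝ) + j) ^ m) := by
    rw [← autoSum_const_mul]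
    congr 1
    funext j
    rw [abs_mul, abs_of_pos hn, Real.mul_rpow (abs_nonneg _) hn.le, mul_pow, Real.rpow_add hn,
      Real.rpow_natCast]
    ring
  simp_rw [div_eq_inv_mul]
  rw [autoSum_const_mul, hR, autoSum_sub, autoSum_sub, hpoly, hker]
  rw [sub_zero, mul_comm K', mul_assoc, mul_sub, inv_mul_cancel_left₀ hw, sub_add_cancel]

theorem isLittleO_sum_range_rpow_sqrt {β : ℝ} (hβ : β < -(1 / 2)) :
    (fun n : ℕ => ∑ k ∈ Finset.range n, (k : ℝ) ^ β) =o[atTop] fun n : ℕ => √(n : ℝ) := by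
  have hsum : ∀ n : ℕ, ∑ k ∈ Finset.range n, (√((k + 1 : ℕ) : ℝ) - √(k : ℝ)) = √(n : ℝ) := by
    intro n
    rw [Finset.sum_range_sub (fun k : ℕ => √(k : ℝ))]
    simp
  have hO : (fun k : ℕ => (k : ℝ) ^ (-(1 / 2) : ℝ)) =O[atTop]
      fun k : ℕ => √((k + 1 : ℕ) : ℝ) - √(k : ℝ) := by
    refine Asymptotics.IsBigO.of_bound 4 ((eventually_ge_atTop 1).mono fun k hk => ?_)
    have hk1 : (1 : ℝ) ≤ k := by exact_mod_cast hk
    have hk0 : 0 < √(k : ℝ) := Real.sqrt_pos.2 (by linarith)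
    have h1 : √((k + 1 : ℕ) : ℝ) ^ 2 = k + 1 := by
      rw [Real.sq_sqrt (by positivity)]; push_cast; ring
    have h2 : √(k : ℝ) ^ 2 = k := Real.sq_sqrt (by linarith)
    have h3 : √(k : ℝ) ≤ √((k + 1 : ℕ) : ℝ) := Real.sqrt_le_sqrt (by push_cast; linarith)
    have h4 : √((k + 1 : ℕ) : ℝ) ≤ 3 * √(k : ℝ) := by nlinarith
    rw [Real.norm_of_nonneg (by positivity), Real.norm_of_nonneg (by linarith),
      Real.rpow_neg (by positivity), ← Real.sqrt_eq_rpow, inv_le_iff_one_le_mul₀ hk0]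
    nlinarith
  have ho : (fun k : ℕ => (k : ℝ) ^ β) =o[atTop] fun k : ℕ => (k : ℝ) ^ (-(1 / 2) : ℝ) := by
    refine (Asymptotics.isLittleO_iff_tendsto' ((eventually_ge_atTop 1).mono fun k hk h => ?_)).2 ?_
    · have hk0 : (0 : ℝ) < k := by exact_mod_cast hk
      exact absurd h (Real.rpow_pos_of_pos hk0 _).ne'
    · refine ((tendsto_rpow_neg_atTop (by linarith : 0 < -(1 / 2) - β)).comp
        tendsto_natCast_atTop_atTop).congr' ((eventually_ge_atTop 1).mono fun k hk => ?_)
      have hk0 : (0 : ℝ) < k := by exact_mod_cast hk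
      change (k : ℝ) ^ (-(-(1 / 2) - β)) = (k : ℝ) ^ β / (k : ℝ) ^ (-(1 / 2) : ℝ)
      rw [← Real.rpow_sub hk0]
      congr 1
      ring
  have := (ho.trans_isBigO hO).sum_range (fun k => sub_nonneg.2
    (Real.sqrt_le_sqrt (by push_cast; linarith))) (by
      simp_rw [hsum]
      exact Real.tendsto_sqrt_atTop.comp tendsto_natCast_atTop_atTop)
  simpa only [hsum] using this

theorem sum_natAbs_sub_le {N : ℕ} (i : Fin N) {f : ℕ → ℝ} (hf : ∀ k, 0 ≤ f k) :
    ∑ j : Fin N, f ((i : ℤ) - (j : ℤ)).natAbs ≤ 2 * ∑ k ∈ Finset.range N, f k := by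
  have hi := i.2
  rw [Fin.sum_univ_eq_sum_range (fun j : ℕ => f ((i : ℤ) - (j : ℤ)).natAbs),
    ← Finset.sum_fiberwise_of_maps_to (t := Finset.range N)
      (g := fun j : ℕ => ((i : ℤ) - (j : ℤ)).natAbs), Finset.mul_sum]
  · refine Finset.sum_le_sum fun k _ => ?_
    rw [Finset.sum_congr rfl fun j hj => by rw [(Finset.mem_filter.1 hj).2], Finset.sum_const,
      nsmul_eq_mul]
    refine mul_le_mul_of_nonneg_right ?_ (hf k)
    have hsub : (Finset.range N).filter (fun j : ℕ => ((i : ℤ) - (j : ℤ)).natAbs = k)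
        ⊆ {(i : ℕ) - k, (i : ℕ) + k} := by
      intro j hj
      have := (Finset.mem_filter.1 hj).2
      simp only [Finset.mem_insert, Finset.mem_singleton]
      omega
    exact_mod_cast (Finset.card_le_card hsub).trans Finset.card_le_two
  · intro j hj
    simp only [Finset.mem_range] at hj ⊢
    omega

theorem abs_mul_transpose_self_apply_le {m n : Type*} [Fintype n] (A : Matrix m n ℝ) (i j : m) :
    |(A * Aᵀ) i j| ≤ ((A * Aᵀ) i i + (A * Aᵀ) j j) / 2 := by
  simp only [Matrix.mul_apply, Matrix.transpose_apply]
  rw [← Finset.sum_add_distrib, Finset.sum_div]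
  refine (Finset.abs_sum_le_sum_abs _ _).trans (Finset.sum_le_sum fun l _ => ?_)
  rw [abs_mul]
  nlinarith [sq_nonneg (|A i l| - |A j l|), abs_mul_abs_self (A i l), abs_mul_abs_self (A j l)]

/-- Central limit theorem for the squared norm of Gaussian vectors with Toeplitz covariances
`σ n |i - i'|` that converge, after rescaling by `w n`, and decay like `|i - i'| ^ β`. -/
theorem tendsto_integral_normalized_quadVar_of_toeplitz (L : ℕ)
    (A : (n : ℕ) → Matrix (Fin (n - L + 1)) (Fin (n - L + 1)) ℝ) {σ : ℕ → ℕ → ℝ}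
    (hσ : ∀ n, ∀ i i' : Fin (n - L + 1),
      (A n * (A n)ᵀ) i i' = σ n ((i : ℤ) - (i' : ℤ)).natAbs)
    {w : ℕ → ℝ} (hw : ∀ᶠ n in atTop, 0 < w n) {κ : ℕ → ℝ}
    (hκ : ∀ k, Tendsto (fun n => σ n k / w n) atTop (nhds (κ k))) (hκ0 : ∃ k, κ k ≠ 0)
    {β B : ℝ} (hβ : β < -(1 / 2)) (hB : 0 ≤ B) (k₀ : ℕ)
    (hdecay : ∀ᶠ n in atTop, ∀ k : ℕ, k₀ ≤ k → |σ n k| ≤ B * (w n * (k : ℝ) ^ β))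
    (g : BoundedContinuousFunction ℝ ℝ) :
    Tendsto (fun n : ℕ =>
        ∫ z, g ((quadVar (n - L + 1) z - expV L A n) / Real.sqrt (varV L A n))
          ∂(gaussVec L A n))
      atTop (nhds (∫ x, g x ∂(gaussianReal 0 1))) := by
  have hle : ∀ n k, k < n - L + 1 → |σ n k| ≤ σ n 0 := by
    intro n k hk
    have h := abs_mul_transpose_self_apply_le (A n) ⟨k, hk⟩ ⟨0, by omega⟩
    simp only [hσ] at h
    simpa using h
  have hN : Tendsto (fun n : ℕ => n - L + 1) atTop atTop :=
    tendsto_atTop_mono (fun n => Nat.le_succ _) (tendsto_sub_atTop_nat L)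
  have hκle : ∀ k, |κ k| ≤ κ 0 := fun k => by
    refine le_of_tendsto_of_tendsto (hκ k).abs (hκ 0) ?_
    filter_upwards [hw, hN.eventually_gt_atTop k] with n hn hk
    rw [abs_div, abs_of_pos hn]
    exact div_le_div_of_nonneg_right (hle n k hk) hn.le
  have hκpos : 0 < κ 0 := by
    obtain ⟨k, hk⟩ := hκ0
    exact (abs_pos.2 hk).trans_le (hκle k)
  have hlow : ∀ᶠ n in atTop, κ 0 / 2 * w n < σ n 0 := by
    filter_upwards [hw, (hκ 0).eventually (lt_mem_nhds (half_lt_self hκpos))] with n hn h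
    rwa [lt_div_iff₀ hn] at h
  have hfrob : ∀ n, √((n - L + 1 : ℕ) : ℝ) * σ n 0 ≤ √(∑ i, ∑ j, (A n * (A n)ᵀ) i j ^ 2) := by
    intro n
    refine Real.le_sqrt_of_sq_le ?_
    rw [mul_pow, Real.sq_sqrt (Nat.cast_nonneg _)]
    calc ((n - L + 1 : ℕ) : ℝ) * σ n 0 ^ 2 = ∑ i, (A n * (A n)ᵀ) i i ^ 2 := by
          simp [hσ]
      _ ≤ _ := Finset.sum_le_sum fun i _ => Finset.single_le_sum
          (f := fun j => (A n * (A n)ᵀ) i j ^ 2) (fun j _ => sq_nonneg _) (Finset.mem_univ i)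
  have hNpos : ∀ n : ℕ, 0 < √((n - L + 1 : ℕ) : ℝ) := fun n => Real.sqrt_pos.2 (by positivity)
  refine tendsto_integral_normalized_quadVar L A
    (fun n => (2 * k₀ + 4 * B / κ 0 * ∑ k ∈ Finset.range (n - L + 1), (k : ℝ) ^ β)
      / √((n - L + 1 : ℕ) : ℝ)) ?_ ?_ ?_ g
  · have h1 := ((isLittleO_sum_range_rpow_sqrt hβ).tendsto_div_nhds_zero.comp hN).const_mul
      (4 * B / κ 0)
    have h2 := ((Real.tendsto_sqrt_atTop.comp tendsto_natCast_atTop_atTop).comp hN).const_div_atTop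
      (2 * k₀ : ℝ)
    have h3 := h2.add h1
    rw [mul_zero, add_zero] at h3
    refine h3.congr fun n => ?_
    simp only [Function.comp_apply]
    rw [add_div, mul_div_assoc (4 * B / κ 0)]
  · filter_upwards [hw, hlow] with n hn h
    have h1 : 0 < σ n 0 := (by positivity : (0 : ℝ) < κ 0 / 2 * w n).trans h
    exact Real.sqrt_pos.1 ((mul_pos (hNpos n) h1).trans_le (hfrob n))
  · filter_upwards [hw, hlow, hdecay] with n hn h hd i
    have h0 : 0 < σ n 0 := (by positivity : (0 : ℝ) < κ 0 / 2 * w n).trans h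
    set S := ∑ k ∈ Finset.range (n - L + 1), (k : ℝ) ^ β with hS
    have hS0 : 0 ≤ S := Finset.sum_nonneg fun k _ => Real.rpow_nonneg (Nat.cast_nonneg k) _
    have hterm : ∀ k ∈ Finset.range (n - L + 1),
        |σ n k| ≤ (if k < k₀ then σ n 0 else 0) + B * w n * (k : ℝ) ^ β := by
      intro k hk
      have hkβ : 0 ≤ B * w n * (k : ℝ) ^ β :=
        mul_nonneg (mul_nonneg hB hn.le) (Real.rpow_nonneg (Nat.cast_nonneg k) _)
      split_ifs with hkk
      · exact (hle n k (Finset.mem_range.1 hk)).trans (le_add_of_nonneg_right hkβ)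
      · rw [zero_add, mul_assoc]
        exact hd k (not_lt.1 hkk)
    have hcard : ∑ k ∈ Finset.range (n - L + 1), (if k < k₀ then σ n 0 else 0) ≤ k₀ * σ n 0 := by
      rw [← Finset.sum_filter, Finset.sum_const, nsmul_eq_mul]
      refine mul_le_mul_of_nonneg_right ?_ h0.le
      have : (Finset.range (n - L + 1)).filter (· < k₀) ⊆ Finset.range k₀ := fun k hk =>
        Finset.mem_range.2 (Finset.mem_filter.1 hk).2
      exact_mod_cast (Finset.card_le_card this).trans (Finset.card_range k₀).le
    calc ∑ j, |(A n * (A n)ᵀ) i j| = ∑ j : Fin (n - L + 1), |σ n ((i : ℤ) - (j : ℤ)).natAbs| :=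
          Finset.sum_congr rfl fun j _ => by rw [hσ]
      _ ≤ 2 * ∑ k ∈ Finset.range (n - L + 1), |σ n k| :=
          sum_natAbs_sub_le i (f := fun k => |σ n k|) fun k => abs_nonneg _
      _ ≤ 2 * (k₀ * σ n 0 + B * w n * S) := by
          refine mul_le_mul_of_nonneg_left ((Finset.sum_le_sum hterm).trans ?_) zero_le_two
          rw [Finset.sum_add_distrib, ← Finset.mul_sum]
          gcongr
      _ ≤ (2 * k₀ + 4 * B / κ 0 * S) * σ n 0 := by
          have h5 : B * S * w n ≤ B * S * (2 / κ 0 * σ n 0) := by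
            refine mul_le_mul_of_nonneg_left ?_ (mul_nonneg hB hS0)
            rw [div_mul_eq_mul_div, le_div_iff₀ hκpos]
            linarith
          have h6 : 4 * B / κ 0 * S * σ n 0 = 2 * (B * S * (2 / κ 0 * σ n 0)) := by ring
          rw [add_mul, h6]
          linarith
      _ = (2 * k₀ + 4 * B / κ 0 * S) / √((n - L + 1 : ℕ) : ℝ)
          * (√((n - L + 1 : ℕ) : ℝ) * σ n 0) := by
          have := (hNpos n).ne'
          field_simp
      _ ≤ _ := by
          refine mul_le_mul_of_nonneg_left (hfrob n) ?_
          have : 0 ≤ 4 * B / κ 0 * S := by positivity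
          positivity

/-- under (H0)–(H2), `δ_n = n^{−α}`, a variation sequence `a` of length `L`
and order `M > D + s/2 + 1/4`, and `Z^{(n)}` a centered Gaussian vector in `ℝ^{n'}`
(`n' = n−L+1`) with covariance `Σ_n(i,i') = −Σ_j (a^{2*})_j V((i−i'+j)δ_n)`, the
normalized quadratic `a`-variation `(V_{a,n} − E[V_{a,n}])/√Var(V_{a,n})` converges in
distribution to `N(0,1)`. -/
theorem stmt_9 (V r : ℝ → ℝ) (D : ℕ) (C s α : ℝ)
    (hC : 0 < C) (hs0 : 0 < s) (hs2 : s < 2) (hα0 : 0 < α) (hα1 : α ≤ 1)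
    -- (H0)
    (hEven : ∀ h : ℝ, V (-h) = V h) (hSmooth : ContDiffOn ℝ (⊤ : ℕ∞) V (Set.Ioi 0))
    -- (H1)
    (hV2D : ContDiff ℝ ((2 * D : ℕ) : ℕ∞) V)
    (hExp : ∀ h : ℝ, iteratedDeriv (2 * D) V h
      = iteratedDeriv (2 * D) V 0 + C * (-1 : ℝ) ^ D * |h| ^ s + r h)
    (hro : r =o[nhds (0:ℝ)] fun h => |h| ^ s)
    -- (H2), with d = 2 if s < 3/2 and d = 3 otherwise
    (hrd : ContDiffOn ℝ ((if s < 3/2 then 2 else 3 : ℕ) : ℕ∞) r {(0:ℝ)}ᶜ)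
    (hH2 : ∃ β K : ℝ, s - (if s < 3/2 then 2 else 3 : ℕ) < β ∧ β < -(1/2) ∧ 0 < K ∧
      (∀ h : ℝ, h ≠ 0 → |iteratedDeriv (if s < 3/2 then 2 else 3 : ℕ) r h| ≤ K * |h| ^ β) ∧
      (∀ h : ℝ, 1 < |h| → |r h| ≤ K * |h| ^ s))
    -- variation sequence of length L and order M
    (a : ℤ → ℝ) (L M : ℕ) (hL : 1 ≤ L) (hM : 1 ≤ M)
    (hsupp : ∀ j : ℤ, a j ≠ 0 → 0 ≤ j ∧ j ≤ (L : ℤ) - 1)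
    (ha0 : a 0 ≠ 0) (haL : a ((L : ℤ) - 1) ≠ 0)
    (hmom : ∀ k : ℕ, k < M → ∑ᶠ j : ℤ, a j * (j : ℝ) ^ k = 0)
    (hmomM : ∑ᶠ j : ℤ, a j * (j : ℝ) ^ M ≠ 0)
    (hMD : (D : ℝ) + s / 2 + 1 / 4 < M)
    -- the Gaussian vector Z^{(n)}, realized as A_n G_n with A_n A_nᵀ = Σ_n
    (A : (n : ℕ) → Matrix (Fin (n - L + 1)) (Fin (n - L + 1)) ℝ)
    (hA : ∀ n : ℕ, ∀ i i' : Fin (n - L + 1),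
      (A n * (A n)ᵀ) i i'
        = -∑ᶠ j : ℤ, seqConv a a j * V (((i : ℤ) - (i' : ℤ) + j) * (n : ℝ) ^ (-α))) :
    -- conclusion: convergence in distribution to N(0,1)
    ∀ g : BoundedContinuousFunction ℝ ℝ,
      Tendsto (fun n : ℕ =>
          ∫ z, g ((quadVar (n - L + 1) z - expV L A n) / Real.sqrt (varV L A n))
            ∂(gaussVec L A n))
        atTop (nhds (∫ x, g x ∂(gaussianReal 0 1))) := by
  have hmom' : ∀ k : ℕ, k < M → ∑ j ∈ Finset.Ico (0 : ℤ) L, a j * (j : ℝ) ^ k = 0 :=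
    fun k hk => by rw [← finsum_mul_eq_sum hsupp (fun j => (j : ℝ) ^ k), hmom k hk]
  have hmomM' : ∑ j ∈ Finset.Ico (0 : ℤ) L, a j * (j : ℝ) ^ M ≠ 0 := by
    rwa [← finsum_mul_eq_sum hsupp (fun j => (j : ℝ) ^ M)]
  obtain ⟨β, K, hβ, hβ', -, hK, -⟩ := hH2
  have hd : 1 ≤ (if s < 3/2 then 2 else 3 : ℕ) := by split_ifs <;> norm_num
  have hDM : D < M := by
    have : (D : ℝ) < M := by linarith
    exact_mod_cast this
  have hdM : 2 * D + (if s < 3/2 then 2 else 3 : ℕ) ≤ 2 * M := by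
    split_ifs with h
    · omega
    · have : ((D + 1 : ℕ) : ℝ) < M := by push_cast; linarith
      have : D + 1 < M := by exact_mod_cast this
      omega
  generalize (if s < 3/2 then 2 else 3 : ℕ) = d at hrd hβ hK hd hdM
  have hC' : C * (-1 : ℝ) ^ D ≠ 0 := mul_ne_zero hC.ne' (pow_ne_zero _ (by norm_num))
  have hδ : Tendsto (fun n : ℕ => (n : ℝ) ^ (-α)) atTop (nhds 0) :=
    (tendsto_rpow_neg_atTop hα0).comp tendsto_natCast_atTop_atTop
  have hδ0 : ∀ᶠ n : ℕ in atTop, 0 < (n : ℝ) ^ (-α) := by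
    filter_upwards [eventually_gt_atTop 0] with n hn
    exact Real.rpow_pos_of_pos (by exact_mod_cast hn) _
  obtain ⟨B, hB0, hB⟩ := exists_abs_autoSum_le_rpow hmom' hL hd hdM hSmooth hExp
    (by exact_mod_cast hrd) hβ (by linarith) hK
  obtain ⟨K', hK', hlim⟩ := exists_tendsto_autoSum_div hmom' (m := 2 * D) (by omega) hs0
    (by exact_mod_cast hV2D) hExp hro hC' hδ hδ0
  obtain ⟨k, hk⟩ := exists_autoSum_abs_rpow_mul_pow_ne_zero hmom' hs0 hs2 hL hM ha0 haL hDM hmomM'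
  refine tendsto_integral_normalized_quadVar_of_toeplitz L A
    (σ := fun n k => -autoSum a L (fun j => V (((k : ℝ) + j) * (n : ℝ) ^ (-α))))
    (w := fun n => ((n : ℝ) ^ (-α)) ^ (((2 * D : ℕ) : ℝ) + s)) ?_
    (hδ0.mono fun n hn => Real.rpow_pos_of_pos hn _)
    (fun k => by simpa only [neg_div] using (hlim k).neg)
    ⟨k, neg_ne_zero.2 (mul_ne_zero hK' hk)⟩ hβ' hB0 (2 * L) ?_
  · have hle : ∀ n, ∀ i i' : Fin (n - L + 1), i' ≤ i → (A n * (A n)ᵀ) i i'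
        = -autoSum a L (fun j => V (((((i : ℤ) - (i' : ℤ)).natAbs : ℝ) + j)
          * (n : ℝ) ^ (-α))) := by
      intro n i i' h
      have hcast : ((((i : ℤ) - (i' : ℤ)).natAbs : ℕ) : ℝ) = ((i : ℤ) : ℝ) - ((i' : ℤ) : ℝ) := by
        have : ((((i : ℤ) - (i' : ℤ)).natAbs : ℕ) : ℤ) = (i : ℤ) - (i' : ℤ) := by omega
        rw [← Int.cast_natCast, this, Int.cast_sub]
      rw [hA, finsum_seqConv_mul hsupp
        (fun j : ℤ => V ((((i : ℤ) : ℝ) - ((i' : ℤ) : ℝ) + j) * (n : ℝ) ^ (-α))), hcast]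
    intro n i i'
    rcases le_total i' i with h | h
    · exact hle n i i' h
    · rw [← Int.natAbs_neg, neg_sub, ← hle n i' i h, ← Matrix.transpose_apply (A n * (A n)ᵀ),
        Matrix.transpose_mul, Matrix.transpose_transpose]
  · filter_upwards [hδ0, eventually_ge_atTop 1] with n hn hn1 k hk
    rw [abs_neg]
    exact hB _ hn (Real.rpow_le_one_of_one_le_of_nonpos (by exact_mod_cast hn1) (by linarith)) k hk
end

section
/- Assume (H0), (H1), (H2) hold for V with parameters D, C, s, and (H3): r(h) = o(|h|^{s+1/(2α)}) as h → 0, where δ_n = n^{−α} with 0 < α ≤ 1. Let a be a variation sequence of length L and order M with M > D + s/2 + 1/4; set n' = n − L + 1. For each n, assume the matrix Σ_n(i,i') = −Σ_j (a^{2*})_j V((i−i'+j)δ_n) is positive semidefinite, let Z^{(n)} be a centered Gaussian vector with covariance Σ_n, V_{a,n} = Σ_{i=1}^{n'} (Z^{(n)}_i)², and define the estimator C_{a,n} = V_{a,n} / ( n (−1)^D δ_n^{2D+s} R(0,1,2D,|·|^s,a^{2*}) ). Then (C_{a,n} − C) / √(Var(C_{a,n})) converges in distribution to N(0,1) as n →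 ∞, and n·Var(C_{a,n}) converges to 2 C² Σ_{i∈ℤ} R(i,1,2D,|·|^s,a^{2*})² / R(0,1,2D,|·|^s,a^{2*})², a finite positive constant. -/
open Filter MeasureTheory ProbabilityTheory Matrix

/-- `R(i,δ,q,f,c) = −Σ_j c_j j^q ∫_0^1 ((1−η)^{q−1}/(q−1)!) f((i+jη)δ) dη` for `q ≥ 1`,
and `R(i,δ,0,f,c) = −Σ_j c_j f((i+j)δ)`. -/
noncomputable def Rq (i : ℤ) (δ : ℝ) (q : ℕ) (f : ℝ → ℝ) (c : ℤ → ℝ) : ℝ :=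
  if q = 0 then -∑ᶠ j : ℤ, c j * f ((i + j) * δ)
  else -∑ᶠ j : ℤ, c j * (j : ℝ) ^ q *
    ∫ η in (0:ℝ)..1, ((1 - η) ^ (q - 1) / (Nat.factorial (q - 1) : ℝ)) * f ((i + j * η) * δ)

/-- The normalizing denominator `n (−1)^D δ_n^{2D+s} R(0,1,2D,|·|^s,a^{2*})` in the
definition of the estimator `C_{a,n}`. -/
noncomputable def denom (a : ℤ → ℝ) (D : ℕ) (s α : ℝ) (n : ℕ) : ℝ :=
  (n : ℝ) * (-1 : ℝ) ^ D * ((n : ℝ) ^ (-α)) ^ (2 * (D : ℝ) + s)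
    * Rq 0 1 (2 * D) (fun x => |x| ^ s) (seqConv a a)

theorem integral_pow_four_gaussianReal : ∫ x, x ^ 4 ∂(gaussianReal 0 1) = 3 := by
  have h := iteratedDeriv_mgf_zero (X := id) (μ := gaussianReal 0 1) (by simp) 4
  have hm : mgf id (gaussianReal 0 1) = fun t => Real.exp (t ^ 2 / 2) := by
    funext t
    rw [mgf_gaussianReal (by simp : (gaussianReal 0 1).map id = gaussianReal 0 1)]
    simp
  have key : ∀ p q : ℝ → ℝ, (∀ x, HasDerivAt p (q x) x) →
      deriv (fun t => p t * Real.exp (t ^ 2 / 2)) =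
        fun t => (q t + t * p t) * Real.exp (t ^ 2 / 2) := by
    intro p q hp
    funext x
    have he : HasDerivAt (fun t : ℝ => Real.exp (t ^ 2 / 2)) (Real.exp (x ^ 2 / 2) * x) x := by
      have := ((hasDerivAt_pow 2 x).div_const 2).exp
      convert this using 1
      simp
    rw [((hp x).fun_mul he).deriv]
    ring
  rw [hm] at h
  have e0 : (fun t : ℝ => Real.exp (t ^ 2 / 2)) = fun t => 1 * Real.exp (t ^ 2 / 2) := by simp
  have h1 := key (fun _ => 1) (fun _ => 0) (fun x => hasDerivAt_const x 1)
  have h2 := key (fun t => t) (fun _ => 1) (fun x => hasDerivAt_id x)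
  have h3 := key (fun t => 1 + t * t) (fun t => 2 * t) (fun x => by
    refine (((hasDerivAt_id' x).fun_mul (hasDerivAt_id' x)).const_add 1).congr_deriv ?_
    ring)
  have h4 := key (fun t => 2 * t + t * (1 + t * t)) (fun t => 3 + 3 * t * t) (fun x => by
    refine (((hasDerivAt_id' x).const_mul 2).fun_add ((hasDerivAt_id' x).fun_mul
      (((hasDerivAt_id' x).fun_mul (hasDerivAt_id' x)).const_add 1))).congr_deriv ?_
    ring)
  rw [e0, iteratedDeriv_succ', iteratedDeriv_succ', iteratedDeriv_succ', iteratedDeriv_succ',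
    iteratedDeriv_zero, h1] at h
  simp only [mul_one, zero_add] at h
  rw [h2, h3, h4] at h
  simp at h
  linarith [h]

theorem integrable_pow_gaussianReal (k : ℕ) :
    Integrable (fun x : ℝ => x ^ k) (gaussianReal 0 1) := by
  have := (memLp_id_gaussianReal' (μ := 0) (v := 1) (k : ENNReal) (by simp)).integrable_norm_pow'
  refine this.mono' (by fun_prop) (ae_of_all _ fun x => by simp)

/-- The law of the quadratic form `‖A G‖²` is that of `∑ λ_i G_i²`, with `λ` the eigenvalues of
`A Aᵀ`. -/
theorem map_quadVar_mulVec (m : ℕ) (A : Matrix (Fin m) (Fin m) ℝ)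
    (hS : (A * Aᵀ).IsHermitian) :
    Measure.map (quadVar m) (Measure.map A.mulVec (Measure.pi fun _ => gaussianReal 0 1)) =
      Measure.map (fun x => ∑ i, hS.eigenvalues i * x i ^ 2)
        (Measure.pi fun _ => gaussianReal 0 1) := by
  have hQ : (Aᵀ * A).IsHermitian := by
    simpa using Matrix.isHermitian_conjTranspose_mul_self A
  have heig : hS.eigenvalues = hQ.eigenvalues :=
    (hS.eigenvalues_eq_eigenvalues_iff hQ).2 (Matrix.charpoly_mul_comm _ _)
  have hmv : Measurable A.mulVec := (Continuous.matrix_mulVec continuous_const continuous_id).measurable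
  have hq : Measurable (quadVar m) := by unfold quadVar; fun_prop
  let q : EuclideanSpace ℝ (Fin m) → ℝ := fun v => quadVar m (A.mulVec v.ofLp)
  have hqm : Measurable q := hq.comp (hmv.comp (by fun_prop))
  have e1 := stdGaussian_eq_map_pi_orthonormalBasis hQ.eigenvectorBasis
  rw [← map_pi_eq_stdGaussian] at e1
  have e2 := congrArg (Measure.map q) e1
  rw [Measure.map_map hqm (by fun_prop), Measure.map_map hqm (by fun_prop)] at e2
  rw [Measure.map_map hq hmv]
  refine Eq.trans e2 ?_
  congr 1
  funext x
  have hquad : ∀ v : Fin m → ℝ, quadVar m (A.mulVec v) = v ⬝ᵥ ((Aᵀ * A) *ᵥ v) := by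
    intro v
    rw [← Matrix.mulVec_mulVec, Matrix.dotProduct_mulVec, Matrix.vecMul_transpose]
    simp [quadVar, dotProduct, sq]
  simp only [Function.comp, q, hquad]
  set b := hQ.eigenvectorBasis with hb
  have hv : (∑ i, x i • b i).ofLp = ∑ i, x i • (b i).ofLp := by simp
  have hQv : (Aᵀ * A) *ᵥ (∑ i, x i • b i).ofLp
      = (∑ i, (x i * hQ.eigenvalues i) • b i).ofLp := by
    rw [hv, Matrix.mulVec_sum]
    simp only [Matrix.mulVec_smul, hb, hQ.mulVec_eigenvectorBasis]
    simp [mul_smul]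
  rw [hQv, heig]
  have hin : ∀ u v : EuclideanSpace ℝ (Fin m), u.ofLp ⬝ᵥ v.ofLp = inner ℝ u v := by
    intro u v
    rw [EuclideanSpace.inner_eq_star_dotProduct]
    simp [dotProduct_comm]
  rw [hin, b.orthonormal.inner_sum]
  refine Finset.sum_congr rfl fun i _ => ?_
  simp; ring

theorem sum_sq_eigenvalues (m : ℕ) (S : Matrix (Fin m) (Fin m) ℝ) (hS : S.IsHermitian) :
    ∑ i, hS.eigenvalues i ^ 2 = ∑ i, ∑ j, S i j ^ 2 := by
  have h1 : (S * S).trace = ∑ i, ∑ j, S i j ^ 2 := by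
    simp only [Matrix.trace, Matrix.diag, Matrix.mul_apply]
    refine Finset.sum_congr rfl fun i _ => Finset.sum_congr rfl fun j _ => ?_
    have := hS.apply i j
    simp at this
    rw [sq, this]
  rw [← h1]
  have h2 := hS.spectral_theorem
  rw [Unitary.conjStarAlgAut_apply] at h2
  set U := (hS.eigenvectorUnitary : Matrix (Fin m) (Fin m) ℝ) with hU
  have hUU : star U * U = 1 := Unitary.coe_star_mul_self hS.eigenvectorUnitary
  set Λ : Matrix (Fin m) (Fin m) ℝ := diagonal (RCLike.ofReal ∘ hS.eigenvalues) with hΛ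
  have h3 : S * S = U * (Λ * Λ) * star U := by
    calc S * S = (U * Λ * star U) * (U * Λ * star U) := by rw [← h2]
      _ = U * Λ * (star U * U) * Λ * star U := by simp only [Matrix.mul_assoc]
      _ = _ := by rw [hUU]; simp only [Matrix.mul_assoc, Matrix.mul_one]
  rw [h3, Matrix.trace_mul_comm, ← Matrix.mul_assoc, hUU, Matrix.one_mul]
  simp [hΛ, Matrix.diagonal_mul_diagonal, Matrix.trace_diagonal, sq]

theorem abs_eigenvalues_le (m : ℕ) (S : Matrix (Fin m) (Fin m) ℝ) (hS : S.IsHermitian) (B : ℝ)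
    (hB : ∀ i, ∑ j, |S i j| ≤ B) (i : Fin m) : |hS.eigenvalues i| ≤ B := by
  have h : Module.End.HasEigenvalue (Matrix.toLin' S) (hS.eigenvalues i) := by
    refine Module.End.hasEigenvalue_of_hasEigenvector (x := (hS.eigenvectorBasis i).ofLp) ⟨?_, ?_⟩
    · rw [Module.End.mem_eigenspace_iff, Matrix.toLin'_apply, hS.mulVec_eigenvectorBasis]
    · intro h0
      have : hS.eigenvectorBasis i = 0 := by
        ext j; simpa using congrFun h0 j
      exact hS.eigenvectorBasis.orthonormal.ne_zero i this
  obtain ⟨k, hk⟩ := eigenvalue_mem_ball h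
  rw [Metric.mem_closedBall, Real.dist_eq] at hk
  have h1 : ∑ j, |S k j| = |S k k| + ∑ j ∈ Finset.univ.erase k, |S k j| :=
    (Finset.add_sum_erase _ _ (Finset.mem_univ k)).symm
  have h2 := hB k
  have h3 := abs_sub_abs_le_abs_sub (hS.eigenvalues i) (S k k)
  simp only [Real.norm_eq_abs] at hk
  linarith

theorem norm_prod_sub_prod_le_sum {ι : Type*} (s : Finset ι) (f g : ι → ℂ)
    (hf : ∀ i, ‖f i‖ ≤ 1) (hg : ∀ i, ‖g i‖ ≤ 1) :
    ‖∏ i ∈ s, f i - ∏ i ∈ s, g i‖ ≤ ∑ i ∈ s, ‖f i - g i‖ := by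
  classical
  induction s using Finset.induction_on with
  | empty => simp
  | insert i s hi ih =>
    rw [Finset.prod_insert hi, Finset.prod_insert hi, Finset.sum_insert hi]
    have h1 : f i * ∏ j ∈ s, f j - g i * ∏ j ∈ s, g j
        = (f i - g i) * ∏ j ∈ s, f j + g i * (∏ j ∈ s, f j - ∏ j ∈ s, g j) := by ring
    have h2 : ‖∏ j ∈ s, f j‖ ≤ 1 := by
      rw [norm_prod]
      exact Finset.prod_le_one (fun _ _ => norm_nonneg _) fun j _ => hf j
    rw [h1]
    refine (norm_add_le _ _).trans (add_le_add ?_ ?_)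
    · rw [norm_mul]
      exact mul_le_of_le_one_right (norm_nonneg _) h2
    · rw [norm_mul]
      exact (mul_le_of_le_one_left (norm_nonneg _) (hg i)).trans ih

/-- The centered and normalized chi-square variable as a function of a standard Gaussian. -/
noncomputable def chiSq (x : ℝ) : ℝ := (x ^ 2 - 1) / √2

@[fun_prop]
theorem measurable_chiSq : Measurable chiSq := by unfold chiSq; fun_prop

theorem integral_chiSq : ∫ x, chiSq x ∂(gaussianReal 0 1) = 0 := by
  unfold chiSq
  rw [integral_div, integral_sub (integrable_pow_gaussianReal 2) (integrable_const _),
    integral_sq_gaussianReal]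
  simp

theorem chiSq_sq (x : ℝ) : chiSq x ^ 2 = (x ^ 4 - 2 * x ^ 2 + 1) / 2 := by
  unfold chiSq
  rw [div_pow, Real.sq_sqrt (by norm_num)]
  ring

theorem integrable_chiSq_sq : Integrable (fun x => chiSq x ^ 2) (gaussianReal 0 1) := by
  simp only [chiSq_sq]
  exact (((integrable_pow_gaussianReal 4).sub ((integrable_pow_gaussianReal 2).const_mul 2)).add
    (integrable_const _)).div_const 2

theorem integral_chiSq_sq : ∫ x, chiSq x ^ 2 ∂(gaussianReal 0 1) = 1 := by
  simp only [chiSq_sq]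
  have h1 : Integrable (fun x : ℝ => x ^ 4 - 2 * x ^ 2) (gaussianReal 0 1) :=
    (integrable_pow_gaussianReal 4).sub ((integrable_pow_gaussianReal 2).const_mul 2)
  rw [integral_div, integral_add h1 (integrable_const _),
    integral_sub (integrable_pow_gaussianReal 4) ((integrable_pow_gaussianReal 2).const_mul 2),
    integral_const_mul, integral_sq_gaussianReal, integral_pow_four_gaussianReal]
  norm_num

theorem memLp_chiSq : MemLp chiSq 2 (gaussianReal 0 1) :=
  (memLp_two_iff_integrable_sq (by fun_prop)).2 integrable_chiSq_sq

theorem isLittleO_charFun_chiSq_sub :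
    (fun t : ℝ => charFun ((gaussianReal 0 1).map chiSq) t - charFun (gaussianReal 0 1) t)
      =o[nhds 0] fun t => t ^ 2 := by
  have h1 := taylor_charFun_two (P := gaussianReal 0 1) (X := chiSq) (by fun_prop)
    integral_chiSq (by simpa using integral_chiSq_sq)
  have h2 := taylor_charFun_two (P := gaussianReal 0 1) (X := id) (by fun_prop)
    (by simp) (by simpa using integral_sq_gaussianReal)
  rw [Measure.map_id] at h2
  refine (h1.sub h2).congr_left fun t => ?_
  ring

theorem tendsto_integral_weighted_chiSq (m : ℕ → ℕ) (v : (n : ℕ) → Fin (m n) → ℝ) (c : ℕ → ℝ)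
    (hsum : ∀ᶠ n in atTop, ∑ i, v n i ^ 2 = 1)
    (hmax : ∀ ε > 0, ∀ᶠ n in atTop, ∀ i, |v n i| ≤ ε)
    (hc : Tendsto c atTop (nhds 0)) (g : BoundedContinuousFunction ℝ ℝ) :
    Tendsto (fun n => ∫ x, g (∑ i, v n i * chiSq (x i) + c n)
      ∂(Measure.pi fun _ : Fin (m n) => gaussianReal 0 1)) atTop
      (nhds (∫ x, g x ∂(gaussianReal 0 1))) := by
  let T : (n : ℕ) → (Fin (m n) → ℝ) → ℝ := fun n x => ∑ i, v n i * chiSq (x i) + c n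
  have hT : ∀ n, Measurable (T n) := fun n => by
    have : ∀ i, Measurable fun x : Fin (m n) → ℝ => chiSq (x i) :=
      fun i => measurable_chiSq.comp (measurable_pi_apply i)
    fun_prop
  let μ : ℕ → ProbabilityMeasure ℝ := fun n =>
    ⟨(Measure.pi fun _ : Fin (m n) => gaussianReal 0 1).map (T n),
      Measure.isProbabilityMeasure_map (hT n).aemeasurable⟩
  let μ₀ : ProbabilityMeasure ℝ := ⟨gaussianReal 0 1, inferInstance⟩
  suffices h : Tendsto μ atTop (nhds μ₀) by
    rw [ProbabilityMeasure.tendsto_iff_forall_integral_tendsto] at h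
    refine (h g).congr fun n => ?_
    simp only [μ, ProbabilityMeasure.coe_mk]
    rw [integral_map (hT n).aemeasurable (by fun_prop)]
  rw [ProbabilityMeasure.tendsto_iff_tendsto_charFun]
  intro t
  set ψ : ℝ → ℂ := charFun ((gaussianReal 0 1).map chiSq) with hψ
  set φ : ℝ → ℂ := charFun (gaussianReal 0 1) with hφ
  have hφe : ∀ u : ℝ, φ u = Complex.exp (-(u ^ 2 / 2 : ℝ)) := by
    intro u
    rw [hφ, charFun_gaussianReal]
    congr 1
    push_cast
    simp
  have hchar : ∀ n, charFun (μ n : Measure ℝ) t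
      = Complex.exp (t * c n * Complex.I) * ∏ i, ψ (v n i * t) := by
    intro n
    simp only [μ, ProbabilityMeasure.coe_mk]
    rw [charFun_apply_real, integral_map (hT n).aemeasurable (by fun_prop)]
    have e : ∀ x : Fin (m n) → ℝ, Complex.exp (t * (T n x : ℝ) * Complex.I)
        = Complex.exp (t * c n * Complex.I) *
          ∏ i, Complex.exp (((v n i * t : ℝ) : ℂ) * (chiSq (x i) : ℝ) * Complex.I) := by
      intro x
      rw [← Complex.exp_sum, ← Complex.exp_add]
      congr 1
      simp only [T]
      push_cast
      rw [mul_add, add_mul, Finset.mul_sum, Finset.sum_mul, add_comm]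
      congr 1
      exact Finset.sum_congr rfl fun i _ => by ring
    simp only [e]
    rw [integral_const_mul, integral_fintype_prod_eq_prod
      (f := fun i (y : ℝ) => Complex.exp (((v n i * t : ℝ) : ℂ) * (chiSq y : ℝ) * Complex.I))]
    congr 1
    refine Finset.prod_congr rfl fun i _ => ?_
    rw [hψ, charFun_apply_real, integral_map measurable_chiSq.aemeasurable (by fun_prop)]
  have hmain : Tendsto (fun n => ∏ i, ψ (v n i * t)) atTop (nhds (φ t)) := by
    rw [tendsto_iff_norm_sub_tendsto_zero, Metric.tendsto_atTop']
    intro ε hε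
    have hη : 0 < ε / (2 * (t ^ 2 + 1)) := by positivity
    have ho := isLittleO_charFun_chiSq_sub.def hη
    rw [Metric.eventually_nhds_iff] at ho
    obtain ⟨ρ, hρ, ho⟩ := ho
    have hρ' : 0 < ρ / (2 * (|t| + 1)) := by positivity
    obtain ⟨N, hN⟩ := eventually_atTop.1 (hsum.and (hmax _ hρ'))
    refine ⟨N, fun n hn => ?_⟩
    obtain ⟨hs, hm⟩ := hN n hn.le
    have hprod : φ t = ∏ i, φ (v n i * t) := by
      simp only [hφe]
      rw [← Complex.exp_sum, ← Complex.ofReal_neg]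
      congr 1
      simp only [← Complex.ofReal_neg, ← Complex.ofReal_sum]
      congr 1
      rw [Finset.sum_neg_distrib, ← Finset.sum_div]
      simp only [mul_pow]
      rw [← Finset.sum_mul, hs, one_mul]
    have hb : ‖∏ i, ψ (v n i * t) - φ t‖ ≤ ε / 2 := by
      have : IsProbabilityMeasure ((gaussianReal 0 1).map chiSq) :=
        Measure.isProbabilityMeasure_map (by fun_prop)
      rw [hprod]
      refine (norm_prod_sub_prod_le_sum _ _ _ (fun i => norm_charFun_le_one _)
        (fun i => norm_charFun_le_one _)).trans ?_
      have h1 : ∀ i, ‖ψ (v n i * t) - φ (v n i * t)‖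
          ≤ ε / (2 * (t ^ 2 + 1)) * (v n i ^ 2 * t ^ 2) := by
        intro i
        have := @ho (v n i * t) (by
          rw [dist_zero_right, Real.norm_eq_abs, abs_mul]
          calc |v n i| * |t| ≤ ρ / (2 * (|t| + 1)) * (|t| + 1) := by
                gcongr
                · exact hm i
                · linarith
            _ = ρ / 2 := by field_simp
            _ < ρ := by linarith)
        rwa [Real.norm_of_nonneg (sq_nonneg _), mul_pow] at this
      refine (Finset.sum_le_sum fun i _ => h1 i).trans ?_
      rw [← Finset.mul_sum, ← Finset.sum_mul, hs, one_mul]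
      rw [div_mul_eq_mul_div, div_le_div_iff₀ (by positivity) (by norm_num)]
      nlinarith [sq_nonneg t]
    rw [dist_zero_right, norm_norm]
    linarith
  simp only [hchar]
  have hexp : Tendsto (fun n => Complex.exp (t * c n * Complex.I)) atTop (nhds 1) := by
    have h0 : Continuous fun y : ℝ => Complex.exp (t * y * Complex.I) := by fun_prop
    have := (h0.tendsto 0).comp hc
    simpa [Function.comp_def] using this
  have := hexp.mul hmain
  rwa [one_mul] at this

theorem integral_gaussVec (L : ℕ) (A : (n : ℕ) → Matrix (Fin (n - L + 1)) (Fin (n - L + 1)) ℝ)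
    (n : ℕ) (hS : (A n * (A n)ᵀ).IsHermitian) (F : ℝ → ℝ) (hF : Measurable F) :
    ∫ z, F (quadVar (n - L + 1) z) ∂(gaussVec L A n) =
      ∫ x, F (∑ i, √2 * hS.eigenvalues i * chiSq (x i) + ∑ i, hS.eigenvalues i)
        ∂(Measure.pi fun _ => gaussianReal 0 1) := by
  have hq : Measurable (quadVar (n - L + 1)) := by unfold quadVar; fun_prop
  have h : Measurable fun x : Fin (n - L + 1) → ℝ => ∑ i, hS.eigenvalues i * x i ^ 2 := by fun_prop
  rw [← integral_map (f := F) hq.aemeasurable hF.aestronglyMeasurable, gaussVec,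
    map_quadVar_mulVec _ _ hS, integral_map h.aemeasurable hF.aestronglyMeasurable]
  refine integral_congr_ae (ae_of_all _ fun x => ?_)
  simp only
  congr 1
  rw [← Finset.sum_add_distrib]
  refine Finset.sum_congr rfl fun i _ => ?_
  have h2 : √2 ≠ 0 := by positivity
  unfold chiSq
  field_simp
  ring

theorem memLp_eval_chiSq {m : ℕ} (i : Fin m) :
    MemLp (fun x : Fin m → ℝ => chiSq (x i)) 2 (Measure.pi fun _ => gaussianReal 0 1) :=
  memLp_chiSq.comp_measurePreserving (measurePreserving_eval (fun _ : Fin m => gaussianReal 0 1) i)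

theorem expV_eq_sum_eigenvalues (L : ℕ)
    (A : (n : ℕ) → Matrix (Fin (n - L + 1)) (Fin (n - L + 1)) ℝ)
    (n : ℕ) (hS : (A n * (A n)ᵀ).IsHermitian) : expV L A n = ∑ i, hS.eigenvalues i := by
  have hint : ∀ i, Integrable (fun x : Fin (n - L + 1) → ℝ => √2 * hS.eigenvalues i * chiSq (x i))
      (Measure.pi fun _ => gaussianReal 0 1) :=
    fun i => ((memLp_eval_chiSq i).integrable (by norm_num)).const_mul _
  have h0 : ∀ i : Fin (n - L + 1),
      ∫ x : Fin (n - L + 1) → ℝ, chiSq (x i) ∂(Measure.pi fun _ => gaussianReal 0 1) = 0 := by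
    intro i
    have h := measurePreserving_eval (fun _ : Fin (n - L + 1) => gaussianReal 0 1) i
    have h' := integral_map (μ := Measure.pi fun _ : Fin (n - L + 1) => gaussianReal 0 1)
      (f := chiSq) h.measurable.aemeasurable (by fun_prop)
    rw [h.map_eq, integral_chiSq] at h'
    exact h'.symm
  rw [expV, integral_gaussVec L A n hS (fun y => y) measurable_id,
    integral_add (integrable_finsetSum _ fun i _ => hint i) (integrable_const _),
    integral_finsetSum _ fun i _ => hint i]
  simp [integral_const_mul, h0]

theorem expV_eq_trace (L : ℕ)
    (A : (n : ℕ) → Matrix (Fin (n - L + 1)) (Fin (n - L + 1)) ℝ) (n : ℕ) :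
    expV L A n = (A n * (A n)ᵀ).trace := by
  have hS : (A n * (A n)ᵀ).IsHermitian := by
    simpa using Matrix.isHermitian_mul_conjTranspose_self (A n)
  rw [expV_eq_sum_eigenvalues L A n hS, hS.trace_eq_sum_eigenvalues]
  simp

theorem varV_eq (L : ℕ)
    (A : (n : ℕ) → Matrix (Fin (n - L + 1)) (Fin (n - L + 1)) ℝ) (n : ℕ) :
    varV L A n = 2 * ∑ i, ∑ j, (A n * (A n)ᵀ) i j ^ 2 := by
  have hS : (A n * (A n)ᵀ).IsHermitian := by
    simpa using Matrix.isHermitian_mul_conjTranspose_self (A n)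
  rw [varV, integral_gaussVec L A n hS (fun y => (y - expV L A n) ^ 2) (by fun_prop),
    expV_eq_sum_eigenvalues L A n hS, ← sum_sq_eigenvalues _ _ hS]
  simp only [add_sub_cancel_right]
  have h := variance_sum_pi (μ := fun _ : Fin (n - L + 1) => gaussianReal 0 1)
    (X := fun i y => √2 * hS.eigenvalues i * chiSq y) (fun i => memLp_chiSq.const_mul _)
  have h1 : ∀ i, Var[fun y => √2 * hS.eigenvalues i * chiSq y; gaussianReal 0 1]
      = 2 * hS.eigenvalues i ^ 2 := by
    intro i
    rw [variance_of_integral_eq_zero (by fun_prop)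
      (by rw [integral_const_mul, integral_chiSq, mul_zero])]
    simp only [mul_pow, integral_const_mul, integral_chiSq_sq]
    rw [Real.sq_sqrt (by norm_num), mul_one]
  rw [Finset.mul_sum, ← Finset.sum_congr rfl fun i _ => h1 i, ← h, variance_of_integral_eq_zero]
  · simp
  · have : ∀ i, Measurable fun x : Fin (n - L + 1) → ℝ => chiSq (x i) :=
      fun i => measurable_chiSq.comp (measurable_pi_apply i)
    fun_prop
  · have := expV_eq_sum_eigenvalues L A n hS
    rw [expV, integral_gaussVec L A n hS (fun y => y) measurable_id, integral_add
      (integrable_finsetSum _ fun i _ => ((memLp_eval_chiSq i).integrable (by norm_num)).const_mul _)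
      (integrable_const _)] at this
    simpa using this

/-- Central limit theorem for the squared norm of a Gaussian vector, under a Lindeberg-type
condition on the row sums of its covariance matrix. -/
theorem tendsto_integral_quadVar (L : ℕ)
    (A : (n : ℕ) → Matrix (Fin (n - L + 1)) (Fin (n - L + 1)) ℝ) (d B : ℕ → ℝ) (C ℓ : ℝ)
    (hℓ : 0 < ℓ)
    (hvar : Tendsto (fun n : ℕ => (n : ℝ) * (varV L A n / d n ^ 2)) atTop (nhds ℓ))
    (hmean : Tendsto (fun n : ℕ => √n * (expV L A n / d n - C)) atTop (nhds 0))
    (hrow : ∀ᶠ n : ℕ in atTop, ∀ i, ∑ j, |(A n * (A n)ᵀ) i j| ≤ B n)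
    (hB : Tendsto (fun n : ℕ => √n * (B n / |d n|)) atTop (nhds 0))
    (g : BoundedContinuousFunction ℝ ℝ) :
    Tendsto (fun n : ℕ => ∫ z, g ((quadVar (n - L + 1) z / d n - C) / √(varV L A n / d n ^ 2))
        ∂(gaussVec L A n)) atTop (nhds (∫ x, g x ∂(gaussianReal 0 1))) := by
  have hS : ∀ n, (A n * (A n)ᵀ).IsHermitian := fun n => by
    simpa using Matrix.isHermitian_mul_conjTranspose_self (A n)
  let q : ℕ → ℝ := fun n => √(varV L A n / d n ^ 2)
  have hq : Tendsto (fun n : ℕ => √n * q n) atTop (nhds √ℓ) := by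
    refine ((Real.continuous_sqrt.tendsto ℓ).comp hvar).congr fun n => ?_
    simp only [Function.comp, q]
    rw [Real.sqrt_mul (Nat.cast_nonneg n)]
  have hpos : ∀ᶠ n : ℕ in atTop, 0 < (n : ℝ) * (varV L A n / d n ^ 2) :=
    hvar.eventually (lt_mem_nhds hℓ)
  have hsl : √ℓ ≠ 0 := by positivity
  refine (tendsto_integral_weighted_chiSq (fun n => n - L + 1)
    (fun n i => √2 * (hS n).eigenvalues i / (d n * q n))
    (fun n => (expV L A n / d n - C) / q n) ?_ ?_ ?_ g).congr' ?_
  · filter_upwards [hpos] with n hn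
    have hv : 0 < varV L A n / d n ^ 2 := pos_of_mul_pos_right hn (Nat.cast_nonneg n)
    have hd : d n ≠ 0 := by
      intro h; simp [h] at hv
    have hV : varV L A n ≠ 0 := by
      intro h; simp [h] at hv
    simp only [div_pow, mul_pow, q]
    rw [Real.sq_sqrt hv.le, Real.sq_sqrt (by norm_num), ← Finset.sum_div, ← Finset.mul_sum,
      sum_sq_eigenvalues, ← varV_eq]
    field_simp
  · intro ε hε
    have h1 : Tendsto (fun n : ℕ => √2 * (√n * (B n / |d n|)) / (√n * q n)) atTop (nhds 0) := by
      have := (hB.const_mul √2).div hq hsl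
      rwa [mul_zero, zero_div] at this
    filter_upwards [hpos, hrow, h1.eventually (ge_mem_nhds hε)] with n hn hr hb i
    have hv : 0 < varV L A n / d n ^ 2 := pos_of_mul_pos_right hn (Nat.cast_nonneg n)
    have hn0 : 0 < (n : ℝ) := pos_of_mul_pos_left hn hv.le
    have hd : d n ≠ 0 := by
      intro h; simp [h] at hv
    have hqp : 0 < q n := Real.sqrt_pos.2 hv
    have hs : √(n : ℝ) ≠ 0 := by positivity
    refine le_trans ?_ hb
    have := abs_eigenvalues_le _ _ (hS n) (B n) hr i
    rw [abs_div, abs_mul, abs_mul, abs_of_pos hqp, abs_of_nonneg (Real.sqrt_nonneg 2)]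
    have hd' : 0 < |d n| := abs_pos.2 hd
    calc √2 * |(hS n).eigenvalues i| / (|d n| * q n) ≤ √2 * B n / (|d n| * q n) := by gcongr
      _ = _ := by field_simp
  · have h1 := hmean.div hq hsl
    rw [zero_div] at h1
    refine h1.congr' ?_
    filter_upwards [eventually_gt_atTop 0] with n hn
    have hn0 : 0 < (n : ℝ) := by exact_mod_cast hn
    have hs : √(n : ℝ) ≠ 0 := by positivity
    simp only [Pi.div_apply]
    rw [mul_div_mul_left _ _ hs]
  · filter_upwards with n
    rw [integral_gaussVec L A n (hS n)
      (fun y => g ((y / d n - C) / √(varV L A n / d n ^ 2))) (by fun_prop)]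
    refine integral_congr_ae (ae_of_all _ fun x => ?_)
    simp only
    congr 1
    rw [expV_eq_sum_eigenvalues L A n (hS n)]
    simp only [q]
    rw [add_div, add_sub_assoc, add_div]
    congr 1
    simp only [Finset.sum_div]
    refine Finset.sum_congr rfl fun i _ => ?_
    rw [div_div, div_mul_eq_mul_div]

theorem taylor_remainder_bound (p : ℕ) (g : ℕ → ℝ → ℝ) (x h B : ℝ)
    (hg : ∀ m < p, ∀ y ∈ Set.uIcc x (x + h), HasDerivAt (g m) (g (m + 1) y) y)
    (hB : ∀ y ∈ Set.uIcc x (x + h), |g p y| ≤ B) :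
    |g 0 (x + h) - ∑ m ∈ Finset.range p, g m x * h ^ m / m.factorial| ≤ B * |h| ^ p := by
  induction p generalizing g h with
  | zero => simpa using hB (x + h) Set.right_mem_uIcc
  | succ p ih =>
    have hB0 : 0 ≤ B := (abs_nonneg _).trans (hB _ Set.right_mem_uIcc)
    let φ : ℝ → ℝ := fun t =>
      g 0 (x + t) - ∑ m ∈ Finset.range (p + 1), g m x * t ^ m / m.factorial
    let φ' : ℝ → ℝ := fun t =>
      g 1 (x + t) - ∑ m ∈ Finset.range p, g (m + 1) x * t ^ m / m.factorial
    have hmem : ∀ t ∈ Set.uIcc 0 h, x + t ∈ Set.uIcc x (x + h) := by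
      intro t ht
      rw [Set.mem_uIcc] at ht ⊢
      rcases ht with ht | ht
      · left; constructor <;> linarith
      · right; constructor <;> linarith
    have hsub : ∀ t ∈ Set.uIcc 0 h, Set.uIcc x (x + t) ⊆ Set.uIcc x (x + h) := fun t ht =>
      Set.uIcc_subset_uIcc Set.left_mem_uIcc (hmem t ht)
    have hφ : ∀ t ∈ Set.uIcc 0 h, HasDerivAt φ (φ' t) t := by
      intro t ht
      have h1 : HasDerivAt (fun t => g 0 (x + t)) (g 1 (x + t)) t :=
        (hg 0 (Nat.succ_pos p) _ (hmem t ht)).comp_const_add x t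
      refine h1.fun_sub ?_
      have h2 : ∀ m ∈ Finset.range (p + 1), HasDerivAt
          (fun t : ℝ => g m x * t ^ m / m.factorial)
          (g m x * (m * t ^ (m - 1)) / m.factorial) t := fun m _ =>
        ((hasDerivAt_pow m t).const_mul _).div_const _
      refine (HasDerivAt.fun_sum h2).congr_deriv ?_
      rw [Finset.sum_range_succ']
      simp only [Nat.cast_zero, zero_mul, mul_zero, zero_div, add_zero]
      refine Finset.sum_congr rfl fun m _ => ?_
      rw [Nat.factorial_succ]
      push_cast
      have : (m.factorial : ℝ) ≠ 0 := by positivity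
      have : (m : ℝ) + 1 ≠ 0 := by positivity
      field_simp
    have hbd : ∀ t ∈ Set.uIcc 0 h, ‖φ' t‖ ≤ B * |h| ^ p := by
      intro t ht
      have := ih (fun m => g (m + 1)) t
        (fun m hm y hy => hg (m + 1) (by omega) y (hsub t ht hy)) (fun y hy => hB y (hsub t ht hy))
      refine this.trans ?_
      have ht' : |t| ≤ |h| := by
        simpa using Set.abs_sub_left_of_mem_uIcc ht
      gcongr
    have hmv := (convex_uIcc (0 : ℝ) h).norm_image_sub_le_of_norm_hasDerivWithin_le
      (fun t ht => (hφ t ht).hasDerivWithinAt) hbd Set.left_mem_uIcc Set.right_mem_uIcc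
    have h0 : φ 0 = 0 := by
      simp only [φ]
      rw [Finset.sum_range_succ']
      simp
    rw [h0, sub_zero, sub_zero, Real.norm_eq_abs, Real.norm_eq_abs] at hmv
    rw [pow_succ, ← mul_assoc]
    exact hmv

theorem finite_difference_bound (T : Finset ℤ) (c : ℤ → ℝ) (L p : ℕ)
    (hT : ∀ j ∈ T, |j| ≤ L) (hc : ∀ k < p, ∑ j ∈ T, c j * (j : ℝ) ^ k = 0)
    (g : ℕ → ℝ → ℝ) (x δ B : ℝ) (hδ : 0 ≤ δ)
    (hg : ∀ m < p, ∀ y, |y - x| ≤ L * δ → HasDerivAt (g m) (g (m + 1) y) y)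
    (hB : ∀ y, |y - x| ≤ L * δ → |g p y| ≤ B) :
    |∑ j ∈ T, c j * g 0 (x + j * δ)| ≤ (∑ j ∈ T, |c j| * |(j : ℝ)| ^ p) * (B * δ ^ p) := by
  have hmem : ∀ j ∈ T, ∀ y ∈ Set.uIcc x (x + j * δ), |y - x| ≤ L * δ := by
    intro j hj y hy
    have h1 := Set.abs_sub_left_of_mem_uIcc hy
    rw [add_sub_cancel_left, abs_mul, abs_of_nonneg hδ] at h1
    have h2 : |(j : ℝ)| ≤ L := by exact_mod_cast hT j hj
    exact h1.trans (by gcongr)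
  have hpoly : ∑ j ∈ T, c j * ∑ m ∈ Finset.range p, g m x * (j * δ) ^ m / m.factorial = 0 := by
    simp only [Finset.mul_sum]
    rw [Finset.sum_comm]
    refine Finset.sum_eq_zero fun m hm => ?_
    have : ∀ j ∈ T, c j * (g m x * (j * δ) ^ m / m.factorial)
        = (g m x * δ ^ m / m.factorial) * (c j * (j : ℝ) ^ m) := fun j _ => by
      rw [mul_pow]; ring
    rw [Finset.sum_congr rfl this, ← Finset.mul_sum, hc m (Finset.mem_range.1 hm), mul_zero]
  have hsplit : ∑ j ∈ T, c j * g 0 (x + j * δ) = ∑ j ∈ T, c j * (g 0 (x + j * δ)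
      - ∑ m ∈ Finset.range p, g m x * (j * δ) ^ m / m.factorial) := by
    simp only [mul_sub, Finset.sum_sub_distrib]
    rw [hpoly, sub_zero]
  rw [hsplit, Finset.sum_mul]
  refine (Finset.abs_sum_le_sum_abs _ _).trans (Finset.sum_le_sum fun j hj => ?_)
  rw [abs_mul, mul_assoc]
  refine mul_le_mul_of_nonneg_left ?_ (abs_nonneg _)
  refine (taylor_remainder_bound p g x (j * δ) B (fun m hm y hy => hg m hm y (hmem j hj y hy))
    (fun y hy => hB y (hmem j hj y hy))).trans_eq ?_
  rw [abs_mul, abs_of_nonneg hδ, mul_pow]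
  ring

theorem taylor_integral_remainder_chain (q : ℕ) (g : ℕ → ℝ → ℝ) (x h : ℝ)
    (hg : ∀ m < q + 1, ∀ y, HasDerivAt (g m) (g (m + 1) y) y) (hq : Continuous (g (q + 1))) :
    g 0 (x + h) = ∑ m ∈ Finset.range (q + 1), g m x * h ^ m / m.factorial +
      h ^ (q + 1) * ∫ η in (0:ℝ)..1, ((1 - η) ^ q / (q.factorial : ℝ)) * g (q + 1) (x + h * η) := by
  have hcomp : ∀ m < q + 1, ∀ η : ℝ,
      HasDerivAt (fun η => g m (x + h * η)) (g (m + 1) (x + h * η) * h) η := by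
    intro m hm η
    have h1 : HasDerivAt (fun η : ℝ => x + h * η) h η := by
      simpa using ((hasDerivAt_id' η).const_mul h).const_add x
    exact (hg m hm (x + h * η)).comp η h1
  have hcont : Continuous fun η : ℝ => g (q + 1) (x + h * η) := by fun_prop
  induction q with
  | zero =>
    have h1 := intervalIntegral.integral_eq_sub_of_hasDerivAt (a := 0) (b := 1)
      (fun η _ => hcomp 0 (by omega) η) ((hcont.mul_const h).intervalIntegrable _ _)
    rw [intervalIntegral.integral_mul_const] at h1
    simp only [zero_add, mul_one, mul_zero, add_zero] at h1
    simp only [zero_add, Finset.range_one, Finset.sum_singleton, pow_zero, Nat.factorial_zero,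
      Nat.cast_one, mul_one, div_one, pow_one, one_mul]
    linarith
  | succ q ih =>
    have hc' : Continuous (g (q + 1)) :=
      continuous_iff_continuousAt.2 fun y => (hg (q + 1) (by omega) y).continuousAt
    rw [ih (fun m hm => hg m (by omega)) hc' (fun m hm => hcomp m (by omega)) (by fun_prop),
      Finset.sum_range_succ _ (q + 1), add_assoc]
    congr 1
    have hu : ∀ η ∈ Set.uIcc (0:ℝ) 1, HasDerivAt
        (fun η : ℝ => -((1 - η) ^ (q + 1) / ((q + 1).factorial : ℝ)))
        ((1 - η) ^ q / (q.factorial : ℝ)) η := by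
      intro η _
      have h1 : HasDerivAt (fun η : ℝ => 1 - η) (-1) η := by
        simpa using (hasDerivAt_id' η).const_sub 1
      refine (((h1.fun_pow (q + 1)).div_const ((q + 1).factorial : ℝ)).fun_neg).congr_deriv ?_
      rw [Nat.factorial_succ]
      have : (q.factorial : ℝ) ≠ 0 := by positivity
      have : (q : ℝ) + 1 ≠ 0 := by positivity
      push_cast
      field_simp
    have hip := intervalIntegral.integral_mul_deriv_eq_deriv_mul
      (u := fun η => g (q + 1) (x + h * η)) (u' := fun η => g (q + 1 + 1) (x + h * η) * h)
      (fun η _ => hcomp (q + 1) (by omega) η) hu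
      ((hcont.mul_const h).intervalIntegrable _ _)
      ((by fun_prop : Continuous fun η : ℝ => (1 - η) ^ q / (q.factorial : ℝ)).intervalIntegrable _ _)
    have e1 : ∫ η in (0:ℝ)..1, (1 - η) ^ q / (q.factorial : ℝ) * g (q + 1) (x + h * η)
        = ∫ η in (0:ℝ)..1, g (q + 1) (x + h * η) * ((1 - η) ^ q / (q.factorial : ℝ)) := by
      simp only [mul_comm]
    have e2 : ∫ η in (0:ℝ)..1, g (q + 1 + 1) (x + h * η) * h *
          -((1 - η) ^ (q + 1) / ((q + 1).factorial : ℝ))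
        = -(h * ∫ η in (0:ℝ)..1, (1 - η) ^ (q + 1) / ((q + 1).factorial : ℝ) *
          g (q + 1 + 1) (x + h * η)) := by
      rw [← intervalIntegral.integral_const_mul, ← intervalIntegral.integral_neg]
      congr 1
      funext η
      ring
    rw [e1, hip, e2]
    simp
    ring

theorem Rq_eq_neg_sum (T : Finset ℤ) (c : ℤ → ℝ) (q : ℕ) (hsupp : ∀ j, c j ≠ 0 → j ∈ T)
    (hc : ∀ k < q, ∑ j ∈ T, c j * (j : ℝ) ^ k = 0) (g : ℕ → ℝ → ℝ)
    (hg : ∀ m < q, ∀ y, HasDerivAt (g m) (g (m + 1) y) y) (hq : Continuous (g q)) (i : ℤ) :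
    Rq i 1 q (g q) c = -∑ j ∈ T, c j * g 0 (i + j) := by
  unfold Rq
  split_ifs with h0
  · subst h0
    rw [finsum_eq_sum_of_support_subset (s := T)]
    · simp
    · intro j hj
      exact hsupp j (left_ne_zero_of_mul hj)
  · obtain ⟨q, rfl⟩ := Nat.exists_eq_succ_of_ne_zero h0
    rw [finsum_eq_sum_of_support_subset (s := T)]
    · congr 1
      have e : ∀ j ∈ T, c j * g 0 (i + j) =
          ∑ m ∈ Finset.range (q + 1), (g m i / m.factorial) * (c j * (j : ℝ) ^ m) +
          c j * (j : ℝ) ^ (q + 1) * ∫ η in (0:ℝ)..1,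
            ((1 - η) ^ q / (q.factorial : ℝ)) * g (q + 1) (i + j * η) := by
        intro j _
        rw [taylor_integral_remainder_chain q g i j hg hq, mul_add, Finset.mul_sum]
        congr 1
        · exact Finset.sum_congr rfl fun m _ => by ring
        · ring
      rw [Finset.sum_congr rfl e, Finset.sum_add_distrib, Finset.sum_comm]
      rw [Finset.sum_eq_zero (s := Finset.range (q + 1)), zero_add]
      · simp
      · intro m hm
        rw [← Finset.mul_sum, hc m (Finset.mem_range.1 hm), mul_zero]
    · intro j hj
      exact hsupp j (left_ne_zero_of_mul (left_ne_zero_of_mul hj))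

theorem finsum_seqConv_mul_s11 (a f : ℤ → ℝ) (S : Finset ℤ) (hS : ∀ j, a j ≠ 0 → j ∈ S) :
    ∑ᶠ m, seqConv a a m * f m = ∑ p ∈ S, ∑ q ∈ S, a p * a q * f (p - q) := by
  have h1 : ∀ m, seqConv a a m = ∑ p ∈ S, a p * a (p - m) := fun m => by
    unfold seqConv
    rw [finsum_eq_sum_of_support_subset]
    exact fun p hp => hS p (left_ne_zero_of_mul hp)
  simp only [h1, Finset.sum_mul]
  have h2 : ∀ p, (∑ᶠ m, a p * a (p - m) * f m) = ∑ᶠ q, a p * a q * f (p - q) := fun p => by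
    rw [← finsum_comp_equiv (Equiv.subLeft p)]
    simp
  have hsup : ∀ p, (Function.support fun q => a p * a q * f (p - q)) ⊆ S := fun p q hq =>
    hS q (right_ne_zero_of_mul (left_ne_zero_of_mul hq))
  rw [finsum_sum_comm]
  · refine Finset.sum_congr rfl fun p _ => ?_
    rw [h2, finsum_eq_sum_of_support_subset _ (hsup p)]
  · intro p _
    refine (S.finite_toSet.image fun q => p - q).subset fun m hm => ?_
    exact ⟨p - m, hS _ (right_ne_zero_of_mul (left_ne_zero_of_mul hm)), by ring⟩

theorem seqConv_support (a : ℤ → ℝ) (L : ℕ) (hsupp : ∀ j, a j ≠ 0 → 0 ≤ j ∧ j ≤ (L : ℤ) - 1)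
    (j : ℤ) (hj : seqConv a a j ≠ 0) : j ∈ Finset.Icc (-(L : ℤ)) L := by
  obtain ⟨k, hk⟩ : ∃ k, a k * a (k - j) ≠ 0 := by
    by_contra! h
    exact hj (by simp [seqConv, h])
  have h1 := hsupp _ (left_ne_zero_of_mul hk)
  have h2 := hsupp _ (right_ne_zero_of_mul hk)
  rw [Finset.mem_Icc]
  omega

theorem finsum_seqConv_eq_sum (a f : ℤ → ℝ) (L : ℕ)
    (hsupp : ∀ j, a j ≠ 0 → 0 ≤ j ∧ j ≤ (L : ℤ) - 1) :
    ∑ᶠ m, seqConv a a m * f m = ∑ m ∈ Finset.Icc (-(L : ℤ)) L, seqConv a a m * f m :=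
  finsum_eq_sum_of_support_subset _ fun j hj =>
    seqConv_support a L hsupp j (left_ne_zero_of_mul hj)

theorem seqConv_moment (a : ℤ → ℝ) (L M : ℕ) (hsupp : ∀ j, a j ≠ 0 → 0 ≤ j ∧ j ≤ (L : ℤ) - 1)
    (hmom : ∀ k : ℕ, k < M → ∑ᶠ j : ℤ, a j * (j : ℝ) ^ k = 0) (k : ℕ) (hk : k < 2 * M) :
    ∑ j ∈ Finset.Icc (-(L : ℤ)) L, seqConv a a j * (j : ℝ) ^ k = 0 := by
  have hS : ∀ j, a j ≠ 0 → j ∈ Finset.Icc (0 : ℤ) (L - 1) := fun j hj =>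
    Finset.mem_Icc.2 (hsupp j hj)
  have hm : ∀ i < M, ∑ j ∈ Finset.Icc (0 : ℤ) (L - 1), a j * (j : ℝ) ^ i = 0 := fun i hi => by
    rw [← hmom i hi, finsum_eq_sum_of_support_subset]
    exact fun p hp => hS p (left_ne_zero_of_mul hp)
  rw [← finsum_seqConv_eq_sum a (fun j => (j : ℝ) ^ k) L hsupp, finsum_seqConv_mul_s11 a _ _ hS]
  have e : ∀ p q : ℤ, a p * a q * ((p - q : ℤ) : ℝ) ^ k = ∑ i ∈ Finset.range (k + 1),
      ((-1 : ℝ) ^ (k - i) * (k.choose i)) * ((a p * (p : ℝ) ^ i) * (a q * (q : ℝ) ^ (k - i))) := by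
    intro p q
    push_cast
    rw [sub_eq_add_neg, add_pow, Finset.mul_sum]
    refine Finset.sum_congr rfl fun i _ => ?_
    rw [neg_pow (q : ℝ)]
    ring
  simp only [e]
  have e2 : ∀ p ∈ Finset.Icc (0 : ℤ) (L - 1), ∑ q ∈ Finset.Icc (0 : ℤ) (L - 1),
      ∑ i ∈ Finset.range (k + 1),
        ((-1 : ℝ) ^ (k - i) * (k.choose i)) * ((a p * (p : ℝ) ^ i) * (a q * (q : ℝ) ^ (k - i)))
      = ∑ i ∈ Finset.range (k + 1), ((-1 : ℝ) ^ (k - i) * (k.choose i)) * ((a p * (p : ℝ) ^ i) *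
        ∑ q ∈ Finset.Icc (0 : ℤ) (L - 1), (a q * (q : ℝ) ^ (k - i))) := by
    intro p _
    rw [Finset.sum_comm]
    simp only [Finset.mul_sum]
  rw [Finset.sum_congr rfl e2, Finset.sum_comm]
  refine Finset.sum_eq_zero fun i hi => ?_
  rw [Finset.mem_range] at hi
  rw [← Finset.mul_sum, ← Finset.sum_mul]
  by_cases h : i < M
  · rw [hm i h]; ring
  · rw [hm (k - i) (by omega)]; ring

theorem seqConv_zero_pos (a : ℤ → ℝ) (L : ℕ) (hsupp : ∀ j, a j ≠ 0 → 0 ≤ j ∧ j ≤ (L : ℤ) - 1)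
    (ha0 : a 0 ≠ 0) : 0 < seqConv a a 0 := by
  have h0 := hsupp 0 ha0
  unfold seqConv
  rw [finsum_eq_sum_of_support_subset (s := Finset.Icc (0 : ℤ) (L - 1))]
  · refine Finset.sum_pos' (fun i _ => by simpa using mul_self_nonneg (a i))
      ⟨0, Finset.mem_Icc.2 h0, by simpa using mul_self_pos.2 ha0⟩
  · exact fun p hp => Finset.mem_coe.2 (Finset.mem_Icc.2 (hsupp p (left_ne_zero_of_mul hp)))

/-- The falling factorial product `γ (γ - 1) ⋯ (γ - m + 1)`. -/
noncomputable def fallingProd (γ : ℝ) (m : ℕ) : ℝ := ∏ i ∈ Finset.range m, (γ - i)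

/-- The `m`-th derivative of `|x| ^ γ`. -/
noncomputable def absRpowDeriv (γ : ℝ) (m : ℕ) (x : ℝ) : ℝ :=
  if Even m then fallingProd γ m * |x| ^ (γ - m)
  else fallingProd γ m * (|x| ^ (γ - m - 1) * x)

theorem hasDerivAt_abs_rpow_of_ne {x : ℝ} (hx : x ≠ 0) (p : ℝ) :
    HasDerivAt (fun x : ℝ => |x| ^ p) (p * |x| ^ (p - 2) * x) x := by
  have h1 := (hasDerivAt_abs hx).rpow_const (p := p) (Or.inl (abs_ne_zero.2 hx))
  refine h1.congr_deriv ?_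
  have h2 : |x| ^ (p - 1) = |x| ^ (p - 2) * |x| := by
    rw [← Real.rpow_add_one (abs_ne_zero.2 hx)]
    congr 1
    ring
  rw [h2]
  have h3 : (SignType.sign x : ℝ) * |x| = x := by rw [mul_comm, abs_mul_sign]
  linear_combination (p * |x| ^ (p - 2)) * h3

theorem hasDerivAt_abs_rpow_mul_self_of_ne {x : ℝ} (hx : x ≠ 0) (r : ℝ) :
    HasDerivAt (fun x : ℝ => |x| ^ r * x) ((r + 1) * |x| ^ r) x := by
  refine ((hasDerivAt_abs_rpow_of_ne hx r).fun_mul (hasDerivAt_id' x)).congr_deriv ?_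
  have h2 : |x| ^ r = |x| ^ (r - 2) * x ^ 2 := by
    rw [← sq_abs, ← Real.rpow_natCast, ← Real.rpow_add (abs_pos.2 hx)]
    congr 1
    push_cast
    ring
  rw [h2]
  ring

theorem hasDerivAt_abs_rpow_mul_self {r : ℝ} (hr : 0 < r) (x : ℝ) :
    HasDerivAt (fun x : ℝ => |x| ^ r * x) ((r + 1) * |x| ^ r) x := by
  rcases eq_or_ne x 0 with rfl | hx
  · rw [hasDerivAt_iff_tendsto_slope]
    simp only [abs_zero, Real.zero_rpow hr.ne', mul_zero]
    have h1 : Tendsto (fun x : ℝ => |x| ^ r) (nhdsWithin 0 {0}ᶜ) (nhds 0) := by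
      have : Continuous fun x : ℝ => |x| ^ r :=
        continuous_abs.rpow_const fun x => Or.inr hr.le
      have := (this.tendsto 0).mono_left (nhdsWithin_le_nhds (s := {0}ᶜ))
      simpa [Real.zero_rpow hr.ne'] using this
    refine h1.congr' ?_
    filter_upwards [self_mem_nhdsWithin] with y hy
    have hy : y ≠ 0 := hy
    simp [slope_def_field, hy]
  · exact hasDerivAt_abs_rpow_mul_self_of_ne hx r

theorem fallingProd_succ (γ : ℝ) (m : ℕ) : fallingProd γ (m + 1) = fallingProd γ m * (γ - m) :=
  Finset.prod_range_succ _ _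

theorem hasDerivAt_absRpowDeriv (γ : ℝ) (m : ℕ) (x : ℝ)
    (h : x ≠ 0 ∨ (Even m ∧ 1 < γ - m) ∨ (¬ Even m ∧ 0 < γ - m - 1)) :
    HasDerivAt (absRpowDeriv γ m) (absRpowDeriv γ (m + 1) x) x := by
  by_cases hm : Even m
  · have e : absRpowDeriv γ m = fun x => fallingProd γ m * |x| ^ (γ - m) := by
      funext y; simp [absRpowDeriv, hm]
    rw [e]
    have hm' : ¬ Even (m + 1) := by simp [Nat.even_add_one, hm]
    have h1 : HasDerivAt (fun x : ℝ => |x| ^ (γ - m)) ((γ - m) * |x| ^ (γ - m - 2) * x) x := by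
      rcases h with h | h | h
      · exact hasDerivAt_abs_rpow_of_ne h _
      · exact hasDerivAt_abs_rpow x h.2
      · exact absurd hm h.1
    refine (h1.const_mul _).congr_deriv ?_
    rw [absRpowDeriv, if_neg hm', fallingProd_succ]
    have : γ - (m + 1 : ℕ) - 1 = γ - m - 2 := by push_cast; ring
    rw [this]
    ring
  · have e : absRpowDeriv γ m = fun x => fallingProd γ m * (|x| ^ (γ - m - 1) * x) := by
      funext y; simp [absRpowDeriv, hm]
    rw [e]
    have hm' : Even (m + 1) := by simp [Nat.even_add_one, hm]
    have h1 : HasDerivAt (fun x : ℝ => |x| ^ (γ - m - 1) * x)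
        ((γ - m - 1 + 1) * |x| ^ (γ - m - 1)) x := by
      rcases h with h | h | h
      · exact hasDerivAt_abs_rpow_mul_self_of_ne h _
      · exact absurd h.1 hm
      · exact hasDerivAt_abs_rpow_mul_self h.2 x
    refine (h1.const_mul _).congr_deriv ?_
    rw [absRpowDeriv, if_pos hm', fallingProd_succ]
    have : γ - (m + 1 : ℕ) = γ - m - 1 := by push_cast; ring
    rw [this]
    ring

theorem abs_absRpowDeriv (γ : ℝ) (m : ℕ) {x : ℝ} (hx : x ≠ 0) :
    |absRpowDeriv γ m x| = |fallingProd γ m| * |x| ^ (γ - m) := by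
  unfold absRpowDeriv
  split_ifs
  · rw [abs_mul, abs_of_nonneg (Real.rpow_nonneg (abs_nonneg x) _)]
  · rw [abs_mul, abs_mul, abs_of_nonneg (Real.rpow_nonneg (abs_nonneg x) _),
      ← Real.rpow_add_one (abs_ne_zero.2 hx), sub_add_cancel]

theorem absRpowDeriv_zero (γ x : ℝ) : absRpowDeriv γ 0 x = |x| ^ γ := by
  simp [absRpowDeriv, fallingProd]

theorem fallingProd_pos (D : ℕ) {s : ℝ} (hs : 0 < s) :
    0 < fallingProd (2 * D + s) (2 * D) := by
  refine Finset.prod_pos fun i hi => ?_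
  have : (i : ℝ) < 2 * D := by exact_mod_cast Finset.mem_range.1 hi
  linarith

theorem absRpowDeriv_two_mul (D : ℕ) (s x : ℝ) :
    absRpowDeriv (2 * D + s) (2 * D) x = fallingProd (2 * D + s) (2 * D) * |x| ^ s := by
  rw [absRpowDeriv, if_pos (even_two_mul D)]
  push_cast
  rw [add_sub_cancel_left]

theorem hasDerivAt_absRpowDeriv_of_lt (D : ℕ) {s : ℝ} (hs : 0 < s) (m : ℕ) (hm : m < 2 * D)
    (x : ℝ) : HasDerivAt (absRpowDeriv (2 * D + s) m) (absRpowDeriv (2 * D + s) (m + 1) x) x := by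
  refine hasDerivAt_absRpowDeriv _ m x (Or.inr ?_)
  by_cases h : Even m
  · refine Or.inl ⟨h, ?_⟩
    obtain ⟨k, rfl⟩ := h
    have : (k : ℝ) + 1 ≤ D := by exact_mod_cast (by omega : k + 1 ≤ D)
    push_cast
    linarith
  · refine Or.inr ⟨h, ?_⟩
    have : (m : ℝ) + 1 ≤ 2 * D := by exact_mod_cast hm
    linarith

theorem Rq_abs_rpow_eq (a : ℤ → ℝ) (L M D : ℕ) {s : ℝ} (hs : 0 < s)
    (hsupp : ∀ j, a j ≠ 0 → 0 ≤ j ∧ j ≤ (L : ℤ) - 1)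
    (hmom : ∀ k : ℕ, k < M → ∑ᶠ j : ℤ, a j * (j : ℝ) ^ k = 0) (hDM : D < M) (i : ℤ) :
    Rq i 1 (2 * D) (fun x => |x| ^ s) (seqConv a a) =
      -(fallingProd (2 * D + s) (2 * D))⁻¹ * ∑ j ∈ Finset.Icc (-(L : ℤ)) L,
        seqConv a a j * |(i : ℝ) + j| ^ (2 * D + s) := by
  have hP := (fallingProd_pos D hs).ne'
  set P := fallingProd (2 * D + s) (2 * D) with hPdef
  have h := Rq_eq_neg_sum (Finset.Icc (-(L : ℤ)) L) (seqConv a a) (2 * D)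
    (seqConv_support a L hsupp) (fun k hk => seqConv_moment a L M hsupp hmom k (by omega))
    (fun m x => P⁻¹ * absRpowDeriv (2 * D + s) m x)
    (fun m hm y => (hasDerivAt_absRpowDeriv_of_lt D hs m hm y).const_mul _)
    (by
      simp only [absRpowDeriv_two_mul]
      have : Continuous fun x : ℝ => |x| ^ s := continuous_abs.rpow_const fun x => Or.inr hs.le
      fun_prop) i
  simp only [absRpowDeriv_two_mul, absRpowDeriv_zero, ← hPdef, inv_mul_cancel_left₀ hP] at h
  rw [h, neg_mul, Finset.mul_sum]
  congr 1
  exact Finset.sum_congr rfl fun j _ => by ring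

theorem abs_cos_sub_taylor_le (p : ℕ) (u : ℝ) :
    |Real.cos u - ∑ m ∈ Finset.range p, Real.cos (m * (Real.pi / 2)) * u ^ m / m.factorial|
      ≤ |u| ^ p := by
  have h := taylor_remainder_bound p (fun m x => Real.cos (x + m * (Real.pi / 2))) 0 u 1
    (fun m _ y _ => by
      have h1 := ((hasDerivAt_id' y).add_const (m * (Real.pi / 2))).cos
      refine h1.congr_deriv ?_
      have : y + ((m + 1 : ℕ) : ℝ) * (Real.pi / 2) = y + m * (Real.pi / 2) + Real.pi / 2 := by
        push_cast; ring
      rw [this, Real.cos_add_pi_div_two]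
      ring)
    (fun y _ => Real.abs_cos_le_one _)
  simpa using h

theorem cos_odd_mul_pi_div_two {m : ℕ} (hm : ¬ Even m) : Real.cos (m * (Real.pi / 2)) = 0 := by
  obtain ⟨k, rfl⟩ := Nat.not_even_iff_odd.1 hm
  rw [Real.cos_eq_zero_iff]
  exact ⟨k, by push_cast; ring⟩

/-- The Taylor polynomial of the cosine of degree `2 D` at the origin. -/
noncomputable def cosTaylor (D : ℕ) (u : ℝ) : ℝ :=
  ∑ m ∈ Finset.range (2 * D + 1), Real.cos (m * (Real.pi / 2)) * u ^ m / m.factorial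

theorem abs_cos_sub_cosTaylor_le_small (D : ℕ) (u : ℝ) :
    |Real.cos u - cosTaylor D u| ≤ |u| ^ (2 * D + 2) := by
  have h := abs_cos_sub_taylor_le (2 * D + 2) u
  rw [Finset.sum_range_succ, cos_odd_mul_pi_div_two (by simp)] at h
  simpa [cosTaylor] using h

theorem abs_cos_sub_cosTaylor_le_large (D : ℕ) (u : ℝ) :
    |Real.cos u - cosTaylor D u| ≤ 2 * |u| ^ (2 * D) := by
  have h := abs_cos_sub_taylor_le (2 * D) u
  rw [cosTaylor, Finset.sum_range_succ, ← sub_sub]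
  refine (abs_sub _ _).trans ?_
  have h2 : |Real.cos ((2 * D : ℕ) * (Real.pi / 2)) * u ^ (2 * D) / (2 * D).factorial|
      ≤ |u| ^ (2 * D) := by
    rw [abs_div, abs_mul, abs_pow, Nat.abs_cast]
    refine (div_le_self (by positivity) (by exact_mod_cast Nat.factorial_pos _)).trans ?_
    exact mul_le_of_le_one_left (by positivity) (Real.abs_cos_le_one _)
  linarith

theorem continuous_cosTaylor (D : ℕ) : Continuous (cosTaylor D) := by
  unfold cosTaylor
  fun_prop

theorem integrableOn_cos_sub_cosTaylor (D : ℕ) {s : ℝ} (hs0 : 0 < s) (hs2 : s < 2) :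
    IntegrableOn (fun u => (Real.cos u - cosTaylor D u) * u ^ (-1 - (2 * D + s)))
      (Set.Ioi 0) := by
  have hmeas : Measurable fun u => (Real.cos u - cosTaylor D u) * u ^ (-1 - (2 * D + s)) := by
    have := (continuous_cosTaylor D).measurable
    fun_prop
  rw [← Set.Ioc_union_Ioi_eq_Ioi zero_le_one, integrableOn_union]
  constructor
  · have h1 : IntegrableOn (fun u : ℝ => u ^ (1 - s)) (Set.Ioc 0 1) := by
      have := intervalIntegral.intervalIntegrable_rpow' (a := 0) (b := 1)
        (by linarith : -1 < 1 - s)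
      exact (intervalIntegrable_iff_integrableOn_Ioc_of_le zero_le_one).1 this
    refine Integrable.mono' h1 hmeas.aestronglyMeasurable ?_
    filter_upwards [ae_restrict_mem measurableSet_Ioc] with u hu
    have hu0 : 0 < u := hu.1
    rw [Real.norm_eq_abs, abs_mul, abs_of_pos (Real.rpow_pos_of_pos hu0 _)]
    refine (mul_le_mul_of_nonneg_right (abs_cos_sub_cosTaylor_le_small D u)
      (Real.rpow_pos_of_pos hu0 _).le).trans_eq ?_
    rw [abs_of_pos hu0, ← Real.rpow_natCast, ← Real.rpow_add hu0]
    congr 1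
    push_cast
    ring
  · have h1 : IntegrableOn (fun u : ℝ => 2 * u ^ (-1 - s)) (Set.Ioi 1) :=
      (integrableOn_Ioi_rpow_of_lt (by linarith) zero_lt_one).const_mul 2
    refine Integrable.mono' h1 hmeas.aestronglyMeasurable ?_
    filter_upwards [ae_restrict_mem measurableSet_Ioi] with u hu
    have hu0 : 0 < u := zero_lt_one.trans hu
    rw [Real.norm_eq_abs, abs_mul, abs_of_pos (Real.rpow_pos_of_pos hu0 _)]
    refine (mul_le_mul_of_nonneg_right (abs_cos_sub_cosTaylor_le_large D u)
      (Real.rpow_pos_of_pos hu0 _).le).trans_eq ?_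
    rw [abs_of_pos hu0, ← Real.rpow_natCast, mul_assoc, ← Real.rpow_add hu0]
    congr 2
    push_cast
    ring

theorem integral_cos_int_mul (j : ℤ) :
    ∫ t in (0 : ℝ)..2 * Real.pi, Real.cos (j * t) = if j = 0 then 2 * Real.pi else 0 := by
  split_ifs with h
  · simp [h]
  · have hj : (j : ℝ) ≠ 0 := by exact_mod_cast h
    rw [intervalIntegral.integral_comp_mul_left _ hj]
    have : Real.sin (j * (2 * Real.pi)) = 0 := by
      have := Real.sin_int_mul_pi (2 * j)
      push_cast at this
      rw [← this]
      ring_nf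
    simp [this]

theorem sum_seqConv_mul_cos_nonneg (a : ℤ → ℝ) (L : ℕ)
    (hsupp : ∀ j, a j ≠ 0 → 0 ≤ j ∧ j ≤ (L : ℤ) - 1) (t : ℝ) :
    0 ≤ ∑ j ∈ Finset.Icc (-(L : ℤ)) L, seqConv a a j * Real.cos (j * t) := by
  have hS : ∀ j, a j ≠ 0 → j ∈ Finset.Icc (0 : ℤ) (L - 1) := fun j hj =>
    Finset.mem_Icc.2 (hsupp j hj)
  rw [← finsum_seqConv_eq_sum a (fun j => Real.cos (j * t)) L hsupp, finsum_seqConv_mul_s11 a _ _ hS]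
  have : ∑ p ∈ Finset.Icc (0 : ℤ) (L - 1), ∑ q ∈ Finset.Icc (0 : ℤ) (L - 1),
      a p * a q * Real.cos ((p - q : ℤ) * t)
      = (∑ p ∈ Finset.Icc (0 : ℤ) (L - 1), a p * Real.cos (p * t)) ^ 2
        + (∑ p ∈ Finset.Icc (0 : ℤ) (L - 1), a p * Real.sin (p * t)) ^ 2 := by
    rw [sq, sq, Finset.sum_mul_sum, Finset.sum_mul_sum, ← Finset.sum_add_distrib]
    refine Finset.sum_congr rfl fun p _ => ?_
    rw [← Finset.sum_add_distrib]
    refine Finset.sum_congr rfl fun q _ => ?_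
    push_cast
    rw [sub_mul, Real.cos_sub]
    ring
  rw [this]
  positivity

theorem sum_seqConv_mul_abs_rpow_ne_zero (a : ℤ → ℝ) (L M D : ℕ) {s : ℝ} (hs0 : 0 < s)
    (hs2 : s < 2) (hsupp : ∀ j, a j ≠ 0 → 0 ≤ j ∧ j ≤ (L : ℤ) - 1) (ha0 : a 0 ≠ 0)
    (hmom : ∀ k : ℕ, k < M → ∑ᶠ j : ℤ, a j * (j : ℝ) ^ k = 0) (hDM : D < M) :
    ∑ j ∈ Finset.Icc (-(L : ℤ)) L, seqConv a a j * |(j : ℝ)| ^ (2 * D + s) ≠ 0 := by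
  set γ : ℝ := 2 * D + s with hγ
  have hγ0 : 0 < γ := by positivity
  set T := Finset.Icc (-(L : ℤ)) L with hT
  set H : ℝ → ℝ := fun u => (Real.cos u - cosTaylor D u) * u ^ (-1 - γ) with hH
  have hHint : IntegrableOn H (Set.Ioi 0) := integrableOn_cos_sub_cosTaylor D hs0 hs2
  set f : ℝ → ℝ := fun t => ∑ j ∈ T, seqConv a a j * Real.cos (j * t) with hf
  have hfnn : ∀ t, 0 ≤ f t := sum_seqConv_mul_cos_nonneg a L hsupp
  have hfc : Continuous f := by
    rw [hf]
    fun_prop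
  have hf2 : ∀ t ∈ Set.Ioi (0 : ℝ), f t * t ^ (-1 - γ)
      = ∑ j ∈ T, seqConv a a j * (|(j : ℝ)| ^ (1 + γ) * H (|(j : ℝ)| * t)) := by
    intro t ht
    have ht : 0 < t := ht
    have hpoly : ∑ j ∈ T, seqConv a a j * cosTaylor D (|(j : ℝ)| * t) = 0 := by
      simp only [cosTaylor, Finset.mul_sum]
      rw [Finset.sum_comm]
      refine Finset.sum_eq_zero fun m hm => ?_
      rw [Finset.mem_range] at hm
      by_cases hev : Even m
      · have := seqConv_moment a L M hsupp hmom m (by omega)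
        have e : ∀ j ∈ T, seqConv a a j *
            (Real.cos (m * (Real.pi / 2)) * (|(j : ℝ)| * t) ^ m / m.factorial)
            = (Real.cos (m * (Real.pi / 2)) * t ^ m / m.factorial)
              * (seqConv a a j * (j : ℝ) ^ m) := fun j _ => by
          rw [mul_pow, hev.pow_abs]
          ring
        rw [Finset.sum_congr rfl e, ← Finset.mul_sum, this, mul_zero]
      · simp [cos_odd_mul_pi_div_two hev]
    have hft : f t = ∑ j ∈ T, seqConv a a j *
        (Real.cos (|(j : ℝ)| * t) - cosTaylor D (|(j : ℝ)| * t)) := by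
      simp only [mul_sub, Finset.sum_sub_distrib, hpoly, sub_zero, hf]
      refine Finset.sum_congr rfl fun j _ => ?_
      rw [← Real.cos_abs (j * t), abs_mul, abs_of_pos ht]
    rw [hft, Finset.sum_mul]
    refine Finset.sum_congr rfl fun j _ => ?_
    rw [mul_assoc]
    congr 1
    rcases eq_or_ne j 0 with rfl | hj
    · have : cosTaylor D 0 = 1 := by
        simp [cosTaylor, Finset.sum_range_succ']
      simp [this, Real.zero_rpow (by linarith : 1 + γ ≠ 0)]
    · have hj' : 0 < |(j : ℝ)| := abs_pos.2 (by exact_mod_cast hj)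
      simp only [hH]
      rw [Real.mul_rpow hj'.le ht.le]
      have : |(j : ℝ)| ^ (1 + γ) * |(j : ℝ)| ^ (-1 - γ) = 1 := by
        rw [← Real.rpow_add hj']
        simp
      linear_combination (-(Real.cos (|(j : ℝ)| * t) - cosTaylor D (|(j : ℝ)| * t))
        * t ^ (-1 - γ)) * this
  have hji : ∀ j : ℤ, IntegrableOn (fun t => |(j : ℝ)| ^ (1 + γ) * H (|(j : ℝ)| * t)) (Set.Ioi 0)
      ∧ ∫ t in Set.Ioi 0, |(j : ℝ)| ^ (1 + γ) * H (|(j : ℝ)| * t)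
        = |(j : ℝ)| ^ γ * ∫ t in Set.Ioi 0, H t := by
    intro j
    rcases eq_or_ne j 0 with rfl | hj
    · simp [Real.zero_rpow (by linarith : 1 + γ ≠ 0), Real.zero_rpow hγ0.ne']
    · have hj' : 0 < |(j : ℝ)| := abs_pos.2 (by exact_mod_cast hj)
      constructor
      · refine Integrable.const_mul ?_ _
        have := (integrableOn_Ioi_comp_mul_left_iff H 0 hj').2 (by simpa using hHint)
        exact this
      · rw [integral_const_mul, integral_comp_mul_left_Ioi H 0 hj', mul_zero, smul_eq_mul,
          ← mul_assoc, add_comm, Real.rpow_add_one hj'.ne', mul_inv_cancel_right₀ hj'.ne']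
  have hint : IntegrableOn (fun t => f t * t ^ (-1 - γ)) (Set.Ioi 0) := by
    refine (integrable_finsetSum T fun j _ => (hji j).1.const_mul (seqConv a a j)).congr ?_
    filter_upwards [ae_restrict_mem measurableSet_Ioi] with t ht
    rw [hf2 t ht]
  have hval : ∫ t in Set.Ioi 0, f t * t ^ (-1 - γ)
      = (∑ j ∈ T, seqConv a a j * |(j : ℝ)| ^ γ) * ∫ t in Set.Ioi 0, H t := by
    rw [setIntegral_congr_fun measurableSet_Ioi hf2,
      integral_finsetSum _ fun j _ => (hji j).1.const_mul (seqConv a a j), Finset.sum_mul]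
    refine Finset.sum_congr rfl fun j _ => ?_
    rw [integral_const_mul, (hji j).2, mul_assoc]
  intro hzero
  rw [hzero, zero_mul] at hval
  have hae : ∀ᵐ t ∂(volume.restrict (Set.Ioi (0 : ℝ))), f t = 0 := by
    have hnn : 0 ≤ᵐ[volume.restrict (Set.Ioi (0 : ℝ))] fun t => f t * t ^ (-1 - γ) := by
      filter_upwards [ae_restrict_mem measurableSet_Ioi] with t ht
      exact mul_nonneg (hfnn t) (Real.rpow_nonneg (le_of_lt ht) _)
    filter_upwards [(integral_eq_zero_iff_of_nonneg_ae hnn hint).1 hval,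
      ae_restrict_mem measurableSet_Ioi] with t h1 ht
    exact (mul_eq_zero.1 h1).resolve_right (Real.rpow_pos_of_pos ht _).ne'
  have hzero2 : ∫ t in (0 : ℝ)..2 * Real.pi, f t = 0 := by
    rw [intervalIntegral.integral_of_le (by positivity)]
    refine integral_eq_zero_of_ae ?_
    exact ae_restrict_of_ae_restrict_of_subset Set.Ioc_subset_Ioi_self hae
  have hpos : ∫ t in (0 : ℝ)..2 * Real.pi, f t = seqConv a a 0 * (2 * Real.pi) := by
    simp only [hf]
    rw [intervalIntegral.integral_finsetSum]
    · simp only [intervalIntegral.integral_const_mul, integral_cos_int_mul]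
      rw [Finset.sum_eq_single 0]
      · simp
      · intro j _ hj
        simp [hj]
      · intro h
        simp [hT] at h
    · intro j _
      exact Continuous.intervalIntegrable (by fun_prop) _ _
  rw [hzero2] at hpos
  have := mul_pos (seqConv_zero_pos a L hsupp ha0) (by positivity : 0 < 2 * Real.pi)
  linarith

theorem sum_mul_add_pow_eq_zero (T : Finset ℤ) (c : ℤ → ℝ) (p : ℕ)
    (hc : ∀ k < p, ∑ j ∈ T, c j * (j : ℝ) ^ k = 0) (x : ℝ) (q : ℕ) (hq : q < p) :
    ∑ j ∈ T, c j * (x + j) ^ q = 0 := by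
  have e : ∀ j ∈ T, c j * (x + j) ^ q = ∑ i ∈ Finset.range (q + 1),
      (x ^ i * (q.choose i)) * (c j * (j : ℝ) ^ (q - i)) := fun j _ => by
    rw [add_pow, Finset.mul_sum]
    exact Finset.sum_congr rfl fun i _ => by ring
  rw [Finset.sum_congr rfl e, Finset.sum_comm]
  refine Finset.sum_eq_zero fun i _ => ?_
  rw [← Finset.mul_sum, hc _ (by omega), mul_zero]

theorem abs_bounds_of_abs_sub_le {L : ℕ} {k : ℤ} (hk : 2 * (L : ℤ) + 1 ≤ |k|) {δ y : ℝ}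
    (hδ : 0 < δ) (hy : |y - k * δ| ≤ L * δ) : 0 < |(k : ℝ)| ∧ |(k : ℝ)| * δ / 2 ≤ |y| := by
  have h1 : 2 * (L : ℝ) + 1 ≤ |(k : ℝ)| := by exact_mod_cast hk
  have h2 : |(k : ℝ) * δ| - |y| ≤ |y - k * δ| := by
    rw [abs_sub_comm]
    exact abs_sub_abs_le_abs_sub _ _
  rw [abs_mul, abs_of_pos hδ] at h2
  have h3 : (0 : ℝ) ≤ L := by positivity
  refine ⟨by linarith, ?_⟩
  nlinarith

theorem exists_abs_sum_mul_abs_rpow_le (L : ℕ) (c : ℤ → ℝ) (q : ℕ)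
    (hc : ∀ k < q, ∑ j ∈ Finset.Icc (-(L : ℤ)) L, c j * (j : ℝ) ^ k = 0) (γ : ℝ) (hγ : γ ≤ q) :
    ∃ B, ∀ k : ℤ, 2 * (L : ℤ) + 1 ≤ |k| →
      |∑ j ∈ Finset.Icc (-(L : ℤ)) L, c j * |(k : ℝ) + j| ^ γ| ≤ B * |(k : ℝ)| ^ (γ - q) := by
  refine ⟨(∑ j ∈ Finset.Icc (-(L : ℤ)) L, |c j| * |(j : ℝ)| ^ q) *
    (|fallingProd γ q| * (1 / 2) ^ (γ - q)), fun k hk => ?_⟩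
  have hy : ∀ y : ℝ, |y - k| ≤ L * 1 → 0 < |(k : ℝ)| ∧ |(k : ℝ)| / 2 ≤ |y| := fun y hy => by
    simpa using abs_bounds_of_abs_sub_le hk one_pos (by simpa using hy)
  have hy0 : ∀ y : ℝ, |y - k| ≤ L * 1 → y ≠ 0 := fun y h => by
    have := hy y h
    exact abs_pos.1 (by linarith)
  have h := finite_difference_bound (Finset.Icc (-(L : ℤ)) L) c L q
    (fun j hj => abs_le.2 (Finset.mem_Icc.1 hj)) hc (absRpowDeriv γ) k 1
    (|fallingProd γ q| * (|(k : ℝ)| / 2) ^ (γ - q)) zero_le_one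
    (fun m _ y h => hasDerivAt_absRpowDeriv γ m y (Or.inl (hy0 y h)))
    (fun y h => by
      rw [abs_absRpowDeriv γ q (hy0 y h)]
      have := hy y h
      gcongr ?_ * ?_
      exact Real.rpow_le_rpow_of_nonpos (by linarith) this.2 (by linarith))
  simp only [absRpowDeriv_zero, mul_one, one_pow] at h
  refine h.trans_eq ?_
  rw [div_eq_mul_one_div, Real.mul_rpow (abs_nonneg _) (by norm_num)]
  ring

/-- Subtracting from `V` its leading terms at the origin leaves a function whose `2 D`-th
derivative is `r`. -/
theorem exists_remainder_chain (V r : ℝ → ℝ) (D d : ℕ) (C s : ℝ) (hs0 : 0 < s)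
    (hV2D : ContDiff ℝ ((2 * D : ℕ) : ℕ∞) V)
    (hExp : ∀ h : ℝ, iteratedDeriv (2 * D) V h
      = iteratedDeriv (2 * D) V 0 + C * (-1 : ℝ) ^ D * |h| ^ s + r h)
    (hrd : ContDiffOn ℝ (d : ℕ∞) r {(0 : ℝ)}ᶜ) :
    ∃ (b : ℝ) (W : ℕ → ℝ → ℝ),
      (∀ y, V y = b * y ^ (2 * D) + C * (-1 : ℝ) ^ D * (fallingProd (2 * D + s) (2 * D))⁻¹
        * |y| ^ (2 * D + s) + W 0 y) ∧
      (∀ m < 2 * D, ∀ y, HasDerivAt (W m) (W (m + 1) y) y) ∧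
      (W (2 * D) = r) ∧
      (∀ m < 2 * D + d, ∀ y, y ≠ 0 → HasDerivAt (W m) (W (m + 1) y) y) ∧
      (W (2 * D + d) = iteratedDeriv d r) := by
  have hP := (fallingProd_pos D hs0).ne'
  set P := fallingProd (2 * D + s) (2 * D) with hPdef
  set v := iteratedDeriv (2 * D) V 0 with hv
  set Q : ℕ → ℝ → ℝ := fun m x => iteratedDeriv m V x - v * (x ^ (2 * D - m) /
    (2 * D - m).factorial) - C * (-1 : ℝ) ^ D * P⁻¹ * absRpowDeriv (2 * D + s) m x with hQ
  have hQr : Q (2 * D) = r := by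
    funext y
    simp only [hQ, hExp y, absRpowDeriv_two_mul, ← hPdef]
    simp
    field_simp
    ring
  have hQd : ∀ m < 2 * D, ∀ y, HasDerivAt (Q m) (Q (m + 1) y) y := by
    intro m hm y
    have h1 : HasDerivAt (iteratedDeriv m V) (iteratedDeriv (m + 1) V y) y := by
      rw [iteratedDeriv_succ]
      exact ((hV2D.differentiable_iteratedDeriv m (by exact_mod_cast hm)) y).hasDerivAt
    have h2 : HasDerivAt (fun x : ℝ => x ^ (2 * D - m) / (2 * D - m).factorial)
        (y ^ (2 * D - (m + 1)) / (2 * D - (m + 1)).factorial) y := by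
      obtain ⟨e, he⟩ : ∃ e, 2 * D - m = e + 1 := ⟨2 * D - m - 1, by omega⟩
      have he' : 2 * D - (m + 1) = e := by omega
      rw [he, he']
      refine ((hasDerivAt_pow (e + 1) y).div_const _).congr_deriv ?_
      rw [Nat.factorial_succ]
      push_cast
      have : (e.factorial : ℝ) ≠ 0 := by positivity
      have : (e : ℝ) + 1 ≠ 0 := by positivity
      field_simp
    exact (h1.sub (h2.const_mul v)).sub
      ((hasDerivAt_absRpowDeriv_of_lt D hs0 m hm y).const_mul _)
  have hrl : ∀ l < d, ∀ y, y ≠ 0 → HasDerivAt (iteratedDeriv l r) (iteratedDeriv (l + 1) r y) y := by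
    intro l hl y hy
    have ho : IsOpen ({(0 : ℝ)}ᶜ : Set ℝ) := isOpen_compl_singleton
    have h1 := hrd.differentiableOn_iteratedDerivWithin (m := l) (by exact_mod_cast hl)
      ho.uniqueDiffOn
    have h2 := (h1 y hy).differentiableAt (ho.mem_nhds hy)
    have h3 : iteratedDerivWithin l r {(0 : ℝ)}ᶜ =ᶠ[nhds y] iteratedDeriv l r := by
      filter_upwards [ho.mem_nhds hy] with z hz
      exact iteratedDerivWithin_of_isOpen ho hz
    rw [iteratedDeriv_succ]
    exact (h3.differentiableAt_iff.1 h2).hasDerivAt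
  refine ⟨v / (2 * D).factorial, fun m => if m ≤ 2 * D then Q m else iteratedDeriv (m - 2 * D) r,
    ?_, ?_, ?_, ?_, ?_⟩
  · intro y
    simp only [Nat.zero_le, if_true, hQ, iteratedDeriv_zero, absRpowDeriv_zero]
    rw [Nat.sub_zero]
    ring
  · intro m hm y
    beta_reduce
    rw [if_pos hm.le, if_pos (Nat.succ_le_of_lt hm)]
    exact hQd m hm y
  · simp [hQr]
  · intro m hm y hy
    beta_reduce
    rcases lt_or_ge m (2 * D) with h | h
    · rw [if_pos h.le, if_pos (Nat.succ_le_of_lt h)]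
      exact hQd m h y
    · obtain ⟨l, rfl⟩ := Nat.exists_eq_add_of_le h
      have e1 : ¬ (2 * D + l + 1 ≤ 2 * D) := by omega
      have e2 : (if 2 * D + l ≤ 2 * D then Q (2 * D + l) else iteratedDeriv (2 * D + l - 2 * D) r)
          = iteratedDeriv l r := by
        rcases Nat.eq_zero_or_pos l with rfl | hl
        · simp [hQr]
        · rw [if_neg (by omega), Nat.add_sub_cancel_left]
      rw [if_neg e1, e2]
      have e3 : 2 * D + l + 1 - 2 * D = l + 1 := by omega
      rw [e3]
      exact hrl l (by omega) y hy
  · rcases Nat.eq_zero_or_pos d with rfl | hd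
    · simp [hQr]
    · simp only
      rw [if_neg (by omega), Nat.add_sub_cancel_left]

/-- Assume `W` is a chain of successive derivatives whose `p`-th member is `o(|h| ^ σ)` at the
origin. Then differences of `W 0` with step `δ` annihilating polynomials of degree less than `p`
are `o(δ ^ (p + σ))`. -/
theorem isLittleO_finite_difference (L : ℕ) (c : ℤ → ℝ) (p : ℕ)
    (hc : ∀ k < p, ∑ j ∈ Finset.Icc (-(L : ℤ)) L, c j * (j : ℝ) ^ k = 0) (W : ℕ → ℝ → ℝ)
    (hW : ∀ m < p, ∀ y, HasDerivAt (W m) (W (m + 1) y) y) (σ : ℝ) (hσ : 0 ≤ σ)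
    (ho : W p =o[nhds (0 : ℝ)] fun h => |h| ^ σ) (k : ℤ) :
    (fun δ : ℝ => ∑ j ∈ Finset.Icc (-(L : ℤ)) L, c j * W 0 ((k + j) * δ))
      =o[nhdsWithin 0 (Set.Ioi 0)] fun δ : ℝ => δ ^ (p + σ) := by
  rw [Asymptotics.isLittleO_iff]
  intro ε hε
  set S := ∑ j ∈ Finset.Icc (-(L : ℤ)) L, |c j| * |(j : ℝ)| ^ p with hS
  have hS0 : 0 ≤ S := Finset.sum_nonneg fun j _ => by positivity
  set N : ℝ := |(k : ℝ)| + L with hN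
  have hN0 : 0 ≤ N := by positivity
  set ε' := ε / (S * N ^ σ + 1) with hε'
  have hden : 0 < S * N ^ σ + 1 := by positivity
  have hε'0 : 0 < ε' := by positivity
  obtain ⟨η, hη, hη2⟩ := Metric.eventually_nhds_iff.1 (ho.def hε'0)
  have hδ : ∀ᶠ δ : ℝ in nhdsWithin 0 (Set.Ioi 0), δ < η / (N + 1) := by
    refine mem_nhdsWithin_of_mem_nhds (Iio_mem_nhds ?_)
    positivity
  filter_upwards [hδ, self_mem_nhdsWithin] with δ hδη hδ0
  have hδ0 : 0 < δ := hδ0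
  have hy : ∀ y : ℝ, |y - k * δ| ≤ L * δ → |y| ≤ N * δ := fun y hy => by
    have h1 : |y| ≤ |y - k * δ| + |k * δ| := by
      simpa using abs_add_le (y - k * δ) (k * δ)
    rw [abs_mul, abs_of_pos hδ0] at h1
    rw [hN]
    linarith
  have h := finite_difference_bound (Finset.Icc (-(L : ℤ)) L) c L p
    (fun j hj => abs_le.2 (Finset.mem_Icc.1 hj)) hc W (k * δ) δ (ε' * (N * δ) ^ σ) hδ0.le
    (fun m hm y _ => hW m hm y)
    (fun y h => by
      have h1 := hy y h
      have h2 : |y| < η := by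
        rw [lt_div_iff₀ (by positivity)] at hδη
        nlinarith
      have h3 := hη2 (y := y) (by simpa using h2)
      rw [Real.norm_eq_abs, Real.norm_eq_abs,
        abs_of_nonneg (Real.rpow_nonneg (abs_nonneg y) _)] at h3
      refine h3.trans ?_
      gcongr)
  simp only [← add_mul] at h
  rw [Real.norm_eq_abs, Real.norm_eq_abs, abs_of_pos (Real.rpow_pos_of_pos hδ0 _)]
  refine h.trans ?_
  rw [Real.mul_rpow hN0 hδ0.le, Real.rpow_add hδ0, Real.rpow_natCast]
  have h4 : S * N ^ σ * ε' ≤ ε := by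
    rw [hε', ← mul_div_assoc, div_le_iff₀ hden]
    nlinarith
  have h5 : 0 ≤ δ ^ p * δ ^ σ := by positivity
  calc S * (ε' * (N ^ σ * δ ^ σ) * δ ^ p) = (S * N ^ σ * ε') * (δ ^ p * δ ^ σ) := by ring
    _ ≤ _ := by gcongr

theorem exists_abs_finite_difference_le (L : ℕ) (c : ℤ → ℝ) (p : ℕ)
    (hc : ∀ k < p, ∑ j ∈ Finset.Icc (-(L : ℤ)) L, c j * (j : ℝ) ^ k = 0) (W : ℕ → ℝ → ℝ)
    (hW : ∀ m < p, ∀ y, y ≠ 0 → HasDerivAt (W m) (W (m + 1) y) y) (K β : ℝ) (hK : 0 ≤ K)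
    (hβ : β ≤ 0) (hWp : ∀ y, y ≠ 0 → |W p y| ≤ K * |y| ^ β) :
    ∃ B, ∀ k : ℤ, 2 * (L : ℤ) + 1 ≤ |k| → ∀ δ : ℝ, 0 < δ →
      |∑ j ∈ Finset.Icc (-(L : ℤ)) L, c j * W 0 ((k + j) * δ)|
        ≤ B * |(k : ℝ)| ^ β * δ ^ (p + β) := by
  refine ⟨(∑ j ∈ Finset.Icc (-(L : ℤ)) L, |c j| * |(j : ℝ)| ^ p) * (K * (1 / 2) ^ β),
    fun k hk δ hδ => ?_⟩
  have hy := fun y h => abs_bounds_of_abs_sub_le hk hδ (y := y) h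
  have hpos : 0 < |(k : ℝ)| := (hy (k * δ) (by simp; positivity)).1
  have hy0 : ∀ y : ℝ, |y - k * δ| ≤ L * δ → y ≠ 0 := fun y h => by
    have := (hy y h).2
    have : 0 < |(k : ℝ)| * δ / 2 := by positivity
    exact abs_pos.1 (by linarith)
  have h := finite_difference_bound (Finset.Icc (-(L : ℤ)) L) c L p
    (fun j hj => abs_le.2 (Finset.mem_Icc.1 hj)) hc W (k * δ) δ
    (K * (|(k : ℝ)| * δ / 2) ^ β) hδ.le
    (fun m hm y h => hW m hm y (hy0 y h))
    (fun y h => by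
      refine (hWp y (hy0 y h)).trans ?_
      gcongr ?_ * ?_
      exact Real.rpow_le_rpow_of_nonpos (by positivity) (hy y h).2 hβ)
  simp only [← add_mul] at h
  refine h.trans_eq ?_
  rw [div_eq_mul_one_div, Real.mul_rpow (by positivity) (by norm_num),
    Real.mul_rpow hpos.le hδ.le, Real.rpow_add hδ, Real.rpow_natCast]
  ring

/-- The rescaled covariances `-∑ c_j V ((k + j) δ) / δ ^ (2 D + s)` converge as `δ → 0+`, with a
rate at `k = 0`, and are uniformly dominated by a power of `1 + |k|` with exponent less than
`-1/2`. -/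
theorem rescaled_covariance_asymptotics (V r : ℝ → ℝ) (D d : ℕ) (C s β K σ : ℝ) (hs0 : 0 < s)
    (hV2D : ContDiff ℝ ((2 * D : ℕ) : ℕ∞) V)
    (hExp : ∀ h : ℝ, iteratedDeriv (2 * D) V h
      = iteratedDeriv (2 * D) V 0 + C * (-1 : ℝ) ^ D * |h| ^ s + r h)
    (hro : r =o[nhds (0:ℝ)] fun h => |h| ^ s)
    (hrd : ContDiffOn ℝ (d : ℕ∞) r {(0:ℝ)}ᶜ)
    (hβ1 : s - d < β) (hβ2 : β < -(1 / 2)) (hK : 0 < K)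
    (hrK : ∀ h : ℝ, h ≠ 0 → |iteratedDeriv d r h| ≤ K * |h| ^ β)
    (hσ : 0 < σ) (hH3 : r =o[nhds (0:ℝ)] fun h => |h| ^ (s + σ))
    (c : ℤ → ℝ) (L M : ℕ)
    (hc : ∀ k < 2 * M, ∑ j ∈ Finset.Icc (-(L : ℤ)) L, c j * (j : ℝ) ^ k = 0)
    (hMD : (D : ℝ) + s / 2 + 1 / 4 < M) (hdM : 2 * D + d ≤ 2 * M)
    (ρ : ℤ → ℝ) (hρ : ∀ k, ρ k = -(fallingProd (2 * D + s) (2 * D))⁻¹ *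
      ∑ j ∈ Finset.Icc (-(L : ℤ)) L, c j * |(k : ℝ) + j| ^ (2 * D + s))
    (X : ℤ → ℝ → ℝ) (hX : ∀ k δ, X k δ =
      -(∑ j ∈ Finset.Icc (-(L : ℤ)) L, c j * V ((k + j) * δ)) / δ ^ (2 * D + s)) :
    (∀ k, Tendsto (X k) (nhdsWithin 0 (Set.Ioi 0)) (nhds (C * (-1) ^ D * ρ k))) ∧
    ((fun δ => X 0 δ - C * (-1) ^ D * ρ 0) =o[nhdsWithin 0 (Set.Ioi 0)] fun δ : ℝ => δ ^ σ) ∧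
    ∃ B θ : ℝ, 1 / 2 < θ ∧ ∀ᶠ δ in nhdsWithin 0 (Set.Ioi 0), ∀ k,
      |X k δ| ≤ B * (1 + |(k : ℝ)|) ^ (-θ) := by
  set γ : ℝ := 2 * D + s with hγ
  set P := fallingProd γ (2 * D) with hP
  set T := Finset.Icc (-(L : ℤ)) L with hT
  have hDM : D < M := by
    have : (D : ℝ) < M := by linarith
    exact_mod_cast this
  obtain ⟨b, W, hVW, hW1, hWr, hW2, hWd⟩ :=
    exists_remainder_chain V r D d C s hs0 hV2D hExp hrd
  rw [← hγ, ← hP] at hVW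
  set E : ℤ → ℝ → ℝ := fun k δ => ∑ j ∈ T, c j * W 0 ((k + j) * δ) with hE
  have hXE : ∀ k, ∀ δ : ℝ, 0 < δ → X k δ = C * (-1) ^ D * ρ k - E k δ / δ ^ γ := by
    intro k δ hδ
    have hδγ : δ ^ γ ≠ 0 := (Real.rpow_pos_of_pos hδ _).ne'
    have h1 : ∑ j ∈ T, c j * V ((k + j) * δ) = b * δ ^ (2 * D) * (∑ j ∈ T, c j * (k + j) ^ (2 * D))
        + C * (-1) ^ D * P⁻¹ * δ ^ γ * (∑ j ∈ T, c j * |(k : ℝ) + j| ^ γ) + E k δ := by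
      simp only [hE, Finset.mul_sum, ← Finset.sum_add_distrib]
      refine Finset.sum_congr rfl fun j _ => ?_
      rw [hVW, mul_pow, abs_mul, abs_of_pos hδ, Real.mul_rpow (abs_nonneg _) hδ.le]
      ring
    rw [sum_mul_add_pow_eq_zero T c (2 * M) hc k (2 * D) (by omega)] at h1
    rw [hX, h1, hρ]
    field_simp
    ring
  have hEo : ∀ τ : ℝ, 0 ≤ τ → (r =o[nhds (0:ℝ)] fun h => |h| ^ (s + τ)) → ∀ k,
      (fun δ => X k δ - C * (-1) ^ D * ρ k) =o[nhdsWithin 0 (Set.Ioi 0)] fun δ : ℝ => δ ^ τ := by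
    intro τ hτ hr k
    have h1 := isLittleO_finite_difference L c (2 * D) (fun k hk => hc k (by omega)) W hW1
      (s + τ) (by linarith) (by rw [hWr]; exact hr) k
    rw [Asymptotics.isLittleO_iff] at h1 ⊢
    intro ε hε
    filter_upwards [h1 hε, self_mem_nhdsWithin] with δ h2 hδ
    have hδ : 0 < δ := hδ
    rw [hXE k δ hδ, sub_sub_cancel_left, norm_neg, norm_div,
      div_le_iff₀ (norm_pos_iff.2 (Real.rpow_pos_of_pos hδ _).ne'),
      mul_assoc, ← norm_mul, ← Real.rpow_add hδ]
    refine h2.trans_eq ?_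
    congr 3
    rw [hγ]
    push_cast
    ring
  have hlim : ∀ k, Tendsto (X k) (nhdsWithin 0 (Set.Ioi 0)) (nhds (C * (-1) ^ D * ρ k)) := by
    intro k
    have h1 := hEo 0 le_rfl (by simpa using hro) k
    simp only [Real.rpow_zero] at h1
    have h2 := (Asymptotics.isLittleO_one_iff ℝ).1 h1
    simpa using h2.add_const (C * (-1) ^ D * ρ k)
  refine ⟨hlim, hEo σ hσ.le hH3 0, ?_⟩
  have hMγ : 1 / 2 < 2 * M - γ := by rw [hγ]; linarith
  obtain ⟨B1, hB1⟩ := exists_abs_sum_mul_abs_rpow_le L c (2 * M) hc γ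
    (by push_cast; linarith)
  obtain ⟨B2, hB2⟩ := exists_abs_finite_difference_le L c (2 * D + d)
    (fun k hk => hc k (by omega)) W hW2 K β hK.le (by linarith) (by rw [hWd]; exact hrK)
  set θ := min (2 * M - γ) (-β) with hθ
  have hθ2 : 1 / 2 < θ := lt_min hMγ (by linarith)
  set B3 := |C| * |P⁻¹| * |B1| + |B2| with hB3
  have hbig : ∀ k : ℤ, 2 * (L : ℤ) + 1 ≤ |k| → ∀ δ : ℝ, 0 < δ → δ ≤ 1 →
      |X k δ| ≤ B3 * |(k : ℝ)| ^ (-θ) := by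
    intro k hk δ hδ hδ1
    have hk1 : 1 ≤ |(k : ℝ)| := by
      have : (1 : ℤ) ≤ |k| := by omega
      exact_mod_cast this
    have e1 : |(k : ℝ)| ^ (γ - (2 * M : ℕ)) ≤ |(k : ℝ)| ^ (-θ) :=
      Real.rpow_le_rpow_of_exponent_le hk1 (by
        have := min_le_left (2 * M - γ) (-β)
        push_cast; linarith)
    have e2 : |(k : ℝ)| ^ β ≤ |(k : ℝ)| ^ (-θ) :=
      Real.rpow_le_rpow_of_exponent_le hk1 (by
        have := min_le_right (2 * M - γ) (-β)
        linarith)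
    have e3 : δ ^ (((2 * D + d : ℕ) : ℝ) + β) ≤ δ ^ γ :=
      Real.rpow_le_rpow_of_exponent_ge hδ hδ1 (by rw [hγ]; push_cast; linarith)
    have f1 : |C * (-1) ^ D * ρ k| ≤ |C| * |P⁻¹| * |B1| * |(k : ℝ)| ^ (-θ) := by
      rw [hρ, abs_mul, abs_mul, abs_mul, abs_neg, abs_pow, abs_neg, abs_one, one_pow, mul_one,
        mul_assoc, mul_assoc |C|]
      gcongr ?_ * (?_ * ?_)
      refine (hB1 k hk).trans ?_
      exact mul_le_mul (le_abs_self _) e1 (by positivity) (abs_nonneg _)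
    have f2 : |E k δ / δ ^ γ| ≤ |B2| * |(k : ℝ)| ^ (-θ) := by
      have hδγ := Real.rpow_pos_of_pos hδ γ
      rw [abs_div, abs_of_pos hδγ, div_le_iff₀ hδγ]
      refine (hB2 k hk δ hδ).trans ?_
      gcongr
      exact le_abs_self _
    rw [hXE k δ hδ, hB3, add_mul]
    exact (abs_sub _ _).trans (add_le_add f1 f2)
  set F := Finset.Icc (-(2 * (L : ℤ))) (2 * L) with hF
  set B4 := ∑ k ∈ F, (|C * (-1) ^ D * ρ k| + 1) * (1 + |(k : ℝ)|) ^ θ with hB4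
  have hB3nn : 0 ≤ B3 := by positivity
  have hB4nn : 0 ≤ B4 := Finset.sum_nonneg fun k _ => by positivity
  refine ⟨B3 * 2 ^ θ + B4, θ, hθ2, ?_⟩
  have hsmall : ∀ᶠ δ in nhdsWithin 0 (Set.Ioi 0), ∀ k ∈ F, |X k δ| < |C * (-1) ^ D * ρ k| + 1 := by
    rw [Filter.eventually_all_finset]
    exact fun k _ => (hlim k).abs.eventually_lt_const (by linarith)
  have hle1 : ∀ᶠ δ : ℝ in nhdsWithin 0 (Set.Ioi 0), δ ≤ 1 :=
    mem_nhdsWithin_of_mem_nhds (Iic_mem_nhds one_pos)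
  filter_upwards [hsmall, hle1, self_mem_nhdsWithin] with δ h1 h2 h3 k
  have hk0 : 0 < 1 + |(k : ℝ)| := by positivity
  by_cases hk : k ∈ F
  · refine (h1 k hk).le.trans ?_
    have h4 := Finset.single_le_sum (s := F)
      (f := fun k : ℤ => (|C * (-1) ^ D * ρ k| + 1) * (1 + |(k : ℝ)|) ^ θ)
      (fun k _ => by positivity) hk
    rw [Real.rpow_neg hk0.le, ← div_eq_mul_inv, le_div_iff₀ (Real.rpow_pos_of_pos hk0 _)]
    have : 0 ≤ B3 * (2 : ℝ) ^ θ := by positivity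
    linarith
  · have hk' : 2 * (L : ℤ) + 1 ≤ |k| := by
      rw [hF, Finset.mem_Icc, ← abs_le] at hk
      omega
    have hk1 : 1 ≤ |(k : ℝ)| := by
      have : (1 : ℤ) ≤ |k| := by omega
      exact_mod_cast this
    refine (hbig k hk' δ h3 h2).trans ?_
    have h4 : |(k : ℝ)| ^ (-θ) ≤ 2 ^ θ * (1 + |(k : ℝ)|) ^ (-θ) := by
      have h5 : |(k : ℝ)| ^ (-θ) ≤ ((1 + |(k : ℝ)|) / 2) ^ (-θ) :=
        Real.rpow_le_rpow_of_nonpos (by positivity) (by linarith) (by linarith)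
      refine h5.trans_eq ?_
      rw [Real.div_rpow hk0.le zero_le_two, Real.rpow_neg zero_le_two, div_inv_eq_mul, mul_comm]
    calc B3 * |(k : ℝ)| ^ (-θ) ≤ B3 * (2 ^ θ * (1 + |(k : ℝ)|) ^ (-θ)) := by gcongr
      _ = B3 * 2 ^ θ * (1 + |(k : ℝ)|) ^ (-θ) := by ring
      _ ≤ _ := by gcongr; linarith

theorem summable_one_add_abs_rpow_neg {p : ℝ} (hp : 1 < p) :
    Summable fun k : ℤ => (1 + |(k : ℝ)|) ^ (-p) := by
  refine Summable.of_nonneg_of_le (fun k => by positivity) (fun k => ?_)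
    ((Real.summable_one_div_int_add_rpow (1 / 2) p).2 hp)
  have h0 : (k : ℝ) + 1 / 2 ≠ 0 := by
    intro h
    have h1 : ((2 * k + 1 : ℤ) : ℝ) = 0 := by push_cast; linarith
    have h2 : 2 * k + 1 = 0 := by exact_mod_cast h1
    omega
  have h1 : |(k : ℝ) + 1 / 2| ≤ 1 + |(k : ℝ)| := by
    refine (abs_add_le _ _).trans ?_
    rw [abs_of_pos (by norm_num : (0 : ℝ) < 1 / 2)]
    linarith
  rw [one_div, ← Real.rpow_neg (abs_nonneg _)]
  exact Real.rpow_le_rpow_of_nonpos (abs_pos.2 h0) h1 (by linarith)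

theorem sum_fin_eq_sum_Ico_int (m : ℕ) (F : ℤ → ℝ) :
    ∑ i : Fin m, F (i : ℤ) = ∑ i ∈ Finset.Ico (0 : ℤ) m, F i := by
  rw [Fin.sum_univ_eq_sum_range (fun i => F (i : ℤ)) m]
  refine Finset.sum_bij (fun i _ => (i : ℤ)) ?_ ?_ ?_ ?_
  · intro i hi
    rw [Finset.mem_range] at hi
    rw [Finset.mem_Ico]
    omega
  · intro i _ j _ h
    exact_mod_cast h
  · intro j hj
    rw [Finset.mem_Ico] at hj
    exact ⟨j.toNat, by rw [Finset.mem_range]; omega, by omega⟩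
  · intro i _
    rfl

theorem sum_sub_fin_eq (m : ℕ) (f : ℤ → ℝ) (i : ℤ) (hi : i ∈ Finset.Ico (0 : ℤ) m) :
    ∑ j : Fin m, f (i - j) = ∑ k ∈ Finset.Ioo (-(m : ℤ)) m,
      if i - k ∈ Finset.Ico (0 : ℤ) m then f k else 0 := by
  rw [sum_fin_eq_sum_Ico_int m fun j => f (i - j), ← Finset.sum_filter]
  rw [Finset.mem_Ico] at hi
  refine Finset.sum_bij (fun j _ => i - j) ?_ ?_ ?_ ?_
  · intro j hj
    rw [Finset.mem_Ico] at hj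
    rw [Finset.mem_filter, Finset.mem_Ioo, Finset.mem_Ico]
    omega
  · intro j _ k _ h
    omega
  · intro k hk
    rw [Finset.mem_filter] at hk
    exact ⟨i - k, hk.2, by omega⟩
  · intro j _
    rfl

theorem sum_sub_fin_eq_tsum (m : ℕ) (f : ℤ → ℝ) :
    ∑ i : Fin m, ∑ j : Fin m, f (i - j) = ∑' k : ℤ, max ((m : ℝ) - |(k : ℝ)|) 0 * f k := by
  rw [sum_fin_eq_sum_Ico_int m fun i => ∑ j : Fin m, f (i - j),
    Finset.sum_congr rfl (sum_sub_fin_eq m f), Finset.sum_comm,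
    tsum_eq_sum (s := Finset.Ioo (-(m : ℤ)) m)]
  · refine Finset.sum_congr rfl fun k hk => ?_
    rw [Finset.mem_Ioo] at hk
    rw [← Finset.sum_filter, Finset.sum_const, nsmul_eq_mul]
    have h1 : (Finset.Ico (0 : ℤ) m).filter (fun i => i - k ∈ Finset.Ico (0 : ℤ) m)
        = Finset.Ico (max 0 k) (min m (m + k)) := by
      ext i
      simp only [Finset.mem_filter, Finset.mem_Ico]
      omega
    have h2 : ((Finset.Ico (max 0 k) (min (m : ℤ) (m + k))).card : ℤ) = m - |k| := by
      rw [Int.card_Ico]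
      rcases le_total 0 k with h | h
      · rw [abs_of_nonneg h]; omega
      · rw [abs_of_nonpos h]; omega
    have h3 : ((Finset.Ico (max 0 k) (min (m : ℤ) (m + k))).card : ℝ) = m - |(k : ℝ)| := by
      exact_mod_cast h2
    have h4 : |(k : ℝ)| ≤ m := by exact_mod_cast (abs_lt.2 hk).le
    rw [h1, h3, max_eq_left (by linarith)]
  · intro k hk
    rw [Finset.mem_Ioo, ← abs_lt, not_lt] at hk
    have h4 : (m : ℝ) ≤ |(k : ℝ)| := by exact_mod_cast hk
    rw [max_eq_right (by linarith), zero_mul]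

theorem sum_abs_sub_fin_le (m : ℕ) (f g : ℤ → ℝ) (hfg : ∀ k, |f k| ≤ g k) (i : Fin m) :
    ∑ j : Fin m, |f (i - j)| ≤ ∑ k ∈ Finset.Ioo (-(m : ℤ)) m, g k := by
  rw [sum_sub_fin_eq m (fun k => |f k|) i (by rw [Finset.mem_Ico]; omega)]
  refine Finset.sum_le_sum fun k _ => ?_
  split_ifs
  · exact hfg k
  · exact (abs_nonneg _).trans (hfg k)

theorem tendsto_sub_add_one_div (L : ℕ) (t : ℝ) :
    Tendsto (fun n : ℕ => (((n - L + 1 : ℕ) : ℝ) - t) / n) atTop (nhds 1) := by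
  have h1 : Tendsto (fun n : ℕ => 1 + (1 - L - t) / (n : ℝ)) atTop (nhds (1 + 0)) :=
    tendsto_const_nhds.add (tendsto_const_div_atTop_nhds_zero_nat _)
  rw [add_zero] at h1
  refine h1.congr' ?_
  filter_upwards [eventually_ge_atTop (L + 1)] with n hn
  have hn0 : (n : ℝ) ≠ 0 := by
    have : n ≠ 0 := by omega
    exact_mod_cast this
  push_cast [Nat.cast_sub (by omega : L ≤ n)]
  field_simp
  ring

theorem tendsto_sum_sq_div (x : ℕ → ℤ → ℝ) (ρ : ℤ → ℝ) (B θ : ℝ) (hθ : 1 / 2 < θ) (L : ℕ)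
    (hL : 1 ≤ L) (hx : ∀ k, Tendsto (fun n => x n k) atTop (nhds (ρ k)))
    (hb : ∀ᶠ n in atTop, ∀ k, |x n k| ≤ B * (1 + |(k : ℝ)|) ^ (-θ)) :
    Summable (fun k => ρ k ^ 2) ∧
    Tendsto (fun n : ℕ => (∑ i : Fin (n - L + 1), ∑ j : Fin (n - L + 1), x n (i - j) ^ 2) / n)
      atTop (nhds (∑' k, ρ k ^ 2)) := by
  have hs : Summable fun k : ℤ => B ^ 2 * (1 + |(k : ℝ)|) ^ (-(2 * θ)) :=
    (summable_one_add_abs_rpow_neg (by linarith)).mul_left _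
  have hsq : ∀ y : ℝ, ∀ k : ℤ, |y| ≤ B * (1 + |(k : ℝ)|) ^ (-θ) →
      y ^ 2 ≤ B ^ 2 * (1 + |(k : ℝ)|) ^ (-(2 * θ)) := fun y k h => by
    have h1 := pow_le_pow_left₀ (abs_nonneg y) h 2
    rw [sq_abs, mul_pow, ← Real.rpow_natCast _ 2, ← Real.rpow_natCast _ 2, ← Real.rpow_natCast _ 2,
      ← Real.rpow_mul (by positivity)] at h1
    rw [← Real.rpow_natCast, ← Real.rpow_natCast]
    refine h1.trans_eq ?_
    congr 2
    push_cast
    ring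
  refine ⟨Summable.of_nonneg_of_le (fun k => sq_nonneg _) (fun k => hsq _ k ?_) hs, ?_⟩
  · exact le_of_tendsto (hx k).abs (hb.mono fun n h => h k)
  · have h1 : ∀ n : ℕ, (∑ i : Fin (n - L + 1), ∑ j : Fin (n - L + 1), x n (i - j) ^ 2) / (n : ℝ)
        = ∑' k : ℤ, max (((n - L + 1 : ℕ) : ℝ) - |(k : ℝ)|) 0 / n * x n k ^ 2 := fun n => by
      rw [sum_sub_fin_eq_tsum (n - L + 1) fun k => x n k ^ 2, ← tsum_div_const]
      exact tsum_congr fun k => by ring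
    simp only [h1]
    refine tendsto_tsum_of_dominated_convergence hs (fun k => ?_) ?_
    · have h2 := ((tendsto_sub_add_one_div L |(k : ℝ)|).max
        (tendsto_const_nhds (x := (0 : ℝ)))).mul ((hx k).pow 2)
      rw [max_eq_left zero_le_one, one_mul] at h2
      refine h2.congr fun n => ?_
      congr 1
      rw [← zero_div (n : ℝ), max_div_div_right (Nat.cast_nonneg n), zero_div]
    · filter_upwards [hb, eventually_ge_atTop L] with n hn hnL k
      have h2 := hsq _ k (hn k)
      have hn0 : (0 : ℝ) < n := by
        have : 0 < n := by omega
        exact_mod_cast this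
      have h3 : ((n - L + 1 : ℕ) : ℝ) ≤ n := by
        have : n - L + 1 ≤ n := by omega
        exact_mod_cast this
      have h4 : max (((n - L + 1 : ℕ) : ℝ) - |(k : ℝ)|) 0 / n ≤ 1 := by
        rw [div_le_one hn0]
        refine max_le ?_ hn0.le
        have := abs_nonneg (k : ℝ)
        linarith
      rw [Real.norm_eq_abs, abs_of_nonneg (by positivity)]
      refine (mul_le_of_le_one_left (sq_nonneg _) h4).trans h2

theorem tendsto_sum_rpow_div_sqrt (θ : ℝ) (hθ : 1 / 2 < θ) (L : ℕ) (hL : 1 ≤ L) :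
    Tendsto (fun n : ℕ => (∑ k ∈ Finset.Ioo (-((n - L + 1 : ℕ) : ℤ)) (n - L + 1 : ℕ),
      (1 + |(k : ℝ)|) ^ (-θ)) / √(n : ℝ)) atTop (nhds 0) := by
  have hs : Summable fun k : ℤ => (1 + |(k : ℝ)|) ^ (-(θ + 1 / 2)) :=
    summable_one_add_abs_rpow_neg (by linarith)
  have h0 : ∀ n : ℕ, (∑ k ∈ Finset.Ioo (-((n - L + 1 : ℕ) : ℤ)) (n - L + 1 : ℕ),
      (1 + |(k : ℝ)|) ^ (-θ)) / √(n : ℝ) = ∑' k : ℤ,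
        (if k ∈ Finset.Ioo (-((n - L + 1 : ℕ) : ℤ)) (n - L + 1 : ℕ)
          then (1 + |(k : ℝ)|) ^ (-θ) / √(n : ℝ) else 0) := fun n => by
    rw [tsum_eq_sum (s := Finset.Ioo (-((n - L + 1 : ℕ) : ℤ)) (n - L + 1 : ℕ))
      (fun k hk => if_neg hk), Finset.sum_div]
    exact Finset.sum_congr rfl fun k hk => (if_pos hk).symm
  simp only [h0]
  have hsq : Tendsto (fun n : ℕ => √(n : ℝ)) atTop atTop :=
    Real.tendsto_sqrt_atTop.comp tendsto_natCast_atTop_atTop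
  suffices h : Tendsto _ atTop (nhds (∑' _ : ℤ, (0 : ℝ))) by rwa [tsum_zero] at h
  refine tendsto_tsum_of_dominated_convergence hs (fun k => ?_) ?_
  · have h2 : Tendsto (fun n : ℕ => (1 + |(k : ℝ)|) ^ (-θ) / √(n : ℝ)) atTop (nhds 0) :=
      hsq.const_div_atTop _
    refine squeeze_zero (fun n => ?_) (fun n => ?_) h2
    · split_ifs <;> positivity
    · split_ifs
      · exact le_rfl
      · positivity
  · filter_upwards [eventually_ge_atTop L] with n hnL k
    split_ifs with hk
    · rw [Finset.mem_Ioo, ← abs_lt] at hk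
      have h3 : 1 + |(k : ℝ)| ≤ n := by
        have : 1 + |k| ≤ n := by omega
        exact_mod_cast this
      have hk0 : 0 < 1 + |(k : ℝ)| := by positivity
      rw [Real.norm_eq_abs, abs_of_nonneg (by positivity), neg_add, Real.rpow_add hk0,
        div_eq_mul_inv]
      gcongr
      rw [Real.rpow_neg hk0.le, Real.sqrt_eq_rpow]
      gcongr
    · rw [norm_zero]
      positivity

/-- under (H0)–(H3), `δ_n = n^{−α}`, a variation sequence `a` of length `L`
and order `M > D + s/2 + 1/4`, the estimator `C_{a,n} = V_{a,n}/(n(−1)^D δ_n^{2D+s} R₀)`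
satisfies `(C_{a,n} − C)/√Var(C_{a,n}) → N(0,1)` in distribution, and `n·Var(C_{a,n})`
converges to the finite positive constant `2C² Σ_{i∈ℤ} R_i² / R₀²`. -/
theorem stmt_11 (V r : ℝ → ℝ) (D : ℕ) (C s α : ℝ)
    (hC : 0 < C) (hs0 : 0 < s) (hs2 : s < 2) (hα0 : 0 < α) (hα1 : α ≤ 1)
    -- (H0)
    (hEven : ∀ h : ℝ, V (-h) = V h) (hSmooth : ContDiffOn ℝ (⊤ : ℕ∞) V (Set.Ioi 0))
    -- (H1)
    (hV2D : ContDiff ℝ ((2 * D : ℕ) : ℕ∞) V)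
    (hExp : ∀ h : ℝ, iteratedDeriv (2 * D) V h
      = iteratedDeriv (2 * D) V 0 + C * (-1 : ℝ) ^ D * |h| ^ s + r h)
    (hro : r =o[nhds (0:ℝ)] fun h => |h| ^ s)
    -- (H2), with d = 2 if s < 3/2 and d = 3 otherwise
    (hrd : ContDiffOn ℝ ((if s < 3/2 then 2 else 3 : ℕ) : ℕ∞) r {(0:ℝ)}ᶜ)
    (hH2 : ∃ β K : ℝ, s - (if s < 3/2 then 2 else 3 : ℕ) < β ∧ β < -(1/2) ∧ 0 < K ∧
      (∀ h : ℝ, h ≠ 0 → |iteratedDeriv (if s < 3/2 then 2 else 3 : ℕ) r h| ≤ K * |h| ^ β) ∧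
      (∀ h : ℝ, 1 < |h| → |r h| ≤ K * |h| ^ s))
    -- (H3)
    (hH3 : r =o[nhds (0:ℝ)] fun h => |h| ^ (s + 1 / (2 * α)))
    -- variation sequence of length L and order M
    (a : ℤ → ℝ) (L M : ℕ) (hL : 1 ≤ L) (hM : 1 ≤ M)
    (hsupp : ∀ j : ℤ, a j ≠ 0 → 0 ≤ j ∧ j ≤ (L : ℤ) - 1)
    (ha0 : a 0 ≠ 0) (haL : a ((L : ℤ) - 1) ≠ 0)
    (hmom : ∀ k : ℕ, k < M → ∑ᶠ j : ℤ, a j * (j : ℝ) ^ k = 0)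
    (hmomM : ∑ᶠ j : ℤ, a j * (j : ℝ) ^ M ≠ 0)
    (hMD : (D : ℝ) + s / 2 + 1 / 4 < M)
    -- the Gaussian vector Z^{(n)}, realized as A_n G_n with A_n A_nᵀ = Σ_n
    (A : (n : ℕ) → Matrix (Fin (n - L + 1)) (Fin (n - L + 1)) ℝ)
    (hA : ∀ n : ℕ, ∀ i i' : Fin (n - L + 1),
      (A n * (A n)ᵀ) i i'
        = -∑ᶠ j : ℤ, seqConv a a j * V (((i : ℤ) - (i' : ℤ) + j) * (n : ℝ) ^ (-α))) :
    -- (1) CLT for the estimator C_{a,n}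
    (∀ g : BoundedContinuousFunction ℝ ℝ,
      Tendsto (fun n : ℕ =>
          ∫ z, g ((quadVar (n - L + 1) z / denom a D s α n - C)
              / Real.sqrt (varV L A n / (denom a D s α n) ^ 2))
            ∂(gaussVec L A n))
        atTop (nhds (∫ x, g x ∂(gaussianReal 0 1))))
    ∧
    -- (2) n · Var(C_{a,n}) converges to a finite positive constant
    Summable (fun i : ℤ => (Rq i 1 (2 * D) (fun x => |x| ^ s) (seqConv a a)) ^ 2)
    ∧
    0 < 2 * C ^ 2 * (∑' i : ℤ, (Rq i 1 (2 * D) (fun x => |x| ^ s) (seqConv a a)) ^ 2)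
        / (Rq 0 1 (2 * D) (fun x => |x| ^ s) (seqConv a a)) ^ 2
    ∧
    Tendsto (fun n : ℕ => (n : ℝ) * (varV L A n / (denom a D s α n) ^ 2))
      atTop (nhds (2 * C ^ 2
        * (∑' i : ℤ, (Rq i 1 (2 * D) (fun x => |x| ^ s) (seqConv a a)) ^ 2)
        / (Rq 0 1 (2 * D) (fun x => |x| ^ s) (seqConv a a)) ^ 2)) := by
  set γ : ℝ := 2 * D + s with hγ
  set c := seqConv a a with hc
  set ρ : ℤ → ℝ := fun k => Rq k 1 (2 * D) (fun x => |x| ^ s) c with hρ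
  have hDM : D < M := by
    have : (D : ℝ) < M := by linarith
    exact_mod_cast this
  have hρeq : ∀ k, ρ k = -(fallingProd γ (2 * D))⁻¹ *
      ∑ j ∈ Finset.Icc (-(L : ℤ)) L, c j * |(k : ℝ) + j| ^ γ :=
    Rq_abs_rpow_eq a L M D hs0 hsupp hmom hDM
  have hρ0 : ρ 0 ≠ 0 := by
    have h := sum_seqConv_mul_abs_rpow_ne_zero a L M D hs0 hs2 hsupp ha0 hmom hDM
    rw [hρeq]
    simp only [Int.cast_zero, zero_add]
    exact mul_ne_zero (neg_ne_zero.2 (inv_ne_zero (fallingProd_pos D hs0).ne')) h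
  set d : ℕ := if s < 3 / 2 then 2 else 3 with hd
  have hdM : 2 * D + d ≤ 2 * M := by
    rw [hd]
    split_ifs with h
    · omega
    · have : (D : ℝ) + 1 < M := by linarith
      have : D + 1 < M := by exact_mod_cast this
      omega
  obtain ⟨β, K, hβ1, hβ2, hK, hrK, -⟩ := hH2
  set X : ℤ → ℝ → ℝ := fun k δ =>
    -(∑ j ∈ Finset.Icc (-(L : ℤ)) L, c j * V ((k + j) * δ)) / δ ^ γ with hX
  obtain ⟨hlim, hrate, B, θ, hθ, hbd⟩ := rescaled_covariance_asymptotics V r D d C s β K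
    (1 / (2 * α)) hs0 hV2D hExp hro hrd hβ1 hβ2 hK hrK (by positivity) hH3 c L M
    (fun k hk => seqConv_moment a L M hsupp hmom k hk) hMD hdM ρ hρeq X fun k δ => rfl
  have hδ : Tendsto (fun n : ℕ => (n : ℝ) ^ (-α)) atTop (nhdsWithin 0 (Set.Ioi 0)) := by
    rw [tendsto_nhdsWithin_iff]
    refine ⟨(tendsto_rpow_neg_atTop hα0).comp tendsto_natCast_atTop_atTop, ?_⟩
    filter_upwards [eventually_gt_atTop 0] with n hn
    exact Real.rpow_pos_of_pos (by exact_mod_cast hn) _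
  set x : ℕ → ℤ → ℝ := fun n k => X k ((n : ℝ) ^ (-α)) with hx
  have hxlim : ∀ k, Tendsto (fun n => x n k) atTop (nhds (C * (-1) ^ D * ρ k)) :=
    fun k => (hlim k).comp hδ
  have hxbd : ∀ᶠ n in atTop, ∀ k, |x n k| ≤ B * (1 + |(k : ℝ)|) ^ (-θ) := hδ.eventually hbd
  have hpos : ∀ᶠ n : ℕ in atTop, 0 < (n : ℝ) := by
    filter_upwards [eventually_gt_atTop 0] with n hn
    exact_mod_cast hn
  have hcov : ∀ n : ℕ, 0 < (n : ℝ) → ∀ i i' : Fin (n - L + 1),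
      (A n * (A n)ᵀ) i i' = ((n : ℝ) ^ (-α)) ^ γ * x n (i - i') := by
    intro n hn i i'
    have h1 : 0 < ((n : ℝ) ^ (-α)) ^ γ := by positivity
    rw [hA, finsum_seqConv_eq_sum a _ L hsupp]
    simp only [hx, hX]
    rw [mul_div_cancel₀ _ h1.ne']
    push_cast
    rfl
  have hdenom : ∀ n : ℕ, denom a D s α n = n * (-1) ^ D * ((n : ℝ) ^ (-α)) ^ γ * ρ 0 :=
    fun n => rfl
  have hsgn : ((-1 : ℝ) ^ D) ^ 2 = 1 := by rw [← pow_mul, mul_comm, pow_mul]; simp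
  obtain ⟨hsum, hsq⟩ := tendsto_sum_sq_div x _ B θ hθ L hL hxlim hxbd
  have hsq' : ∀ k, (C * (-1) ^ D * ρ k) ^ 2 = C ^ 2 * ρ k ^ 2 := fun k => by
    rw [mul_pow, mul_pow, hsgn, mul_one]
  simp only [hsq', tsum_mul_left] at hsum hsq
  have hsumρ : Summable fun k => ρ k ^ 2 :=
    (summable_mul_left_iff (pow_ne_zero 2 hC.ne')).1 hsum
  have hlimpos : 0 < 2 * C ^ 2 * (∑' k, ρ k ^ 2) / ρ 0 ^ 2 := by
    have h1 : 0 < ∑' k, ρ k ^ 2 := hsumρ.tsum_pos (fun k => sq_nonneg _) 0 (by positivity)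
    positivity
  have hvar : Tendsto (fun n : ℕ => (n : ℝ) * (varV L A n / (denom a D s α n) ^ 2)) atTop
      (nhds (2 * C ^ 2 * (∑' k, ρ k ^ 2) / ρ 0 ^ 2)) := by
    have h1 := hsq.const_mul (2 / ρ 0 ^ 2)
    have h2 : 2 / ρ 0 ^ 2 * (C ^ 2 * ∑' k, ρ k ^ 2) = 2 * C ^ 2 * (∑' k, ρ k ^ 2) / ρ 0 ^ 2 := by
      ring
    rw [h2] at h1
    refine h1.congr' ?_
    filter_upwards [hpos] with n hn
    have h3 : ((n : ℝ) ^ (-α)) ^ γ ≠ 0 := by positivity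
    rw [varV_eq, hdenom]
    simp only [hcov n hn, mul_pow, hsgn, ← Finset.mul_sum]
    field_simp
  refine ⟨?_, hsumρ, hlimpos, hvar⟩
  refine tendsto_integral_quadVar L A (denom a D s α) (fun n => ((n : ℝ) ^ (-α)) ^ γ *
    (B * ∑ k ∈ Finset.Ioo (-((n - L + 1 : ℕ) : ℤ)) (n - L + 1 : ℕ), (1 + |(k : ℝ)|) ^ (-θ)))
    C _ hlimpos hvar ?_ ?_ ?_
  · have hsqrt : Tendsto (fun n : ℕ => √(n : ℝ)) atTop atTop :=
      Real.tendsto_sqrt_atTop.comp tendsto_natCast_atTop_atTop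
    have h1 : Tendsto (fun n : ℕ => √(n : ℝ) * (x n 0 - C * (-1) ^ D * ρ 0)) atTop (nhds 0) := by
      have h2 := (hrate.comp_tendsto hδ).tendsto_div_nhds_zero
      refine h2.congr' ?_
      filter_upwards [hpos] with n hn
      have h3 : ((n : ℝ) ^ (-α)) ^ (1 / (2 * α)) = (√(n : ℝ))⁻¹ := by
        rw [← Real.rpow_mul hn.le, Real.sqrt_eq_rpow, ← Real.rpow_neg hn.le]
        congr 1
        field_simp
      simp only [Function.comp_apply, h3, div_inv_eq_mul]
      ring
    have h4 : Tendsto (fun n : ℕ => √(n : ℝ) * (((n - L + 1 : ℕ) : ℝ) / n - 1)) atTop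
        (nhds 0) := by
      refine (hsqrt.const_div_atTop (1 - (L : ℝ))).congr' ?_
      filter_upwards [hpos, eventually_ge_atTop L] with n hn hnL
      have h5 : √(n : ℝ) * √(n : ℝ) = n := Real.mul_self_sqrt hn.le
      have h6 : √(n : ℝ) ≠ 0 := (Real.sqrt_pos.2 hn).ne'
      push_cast [Nat.cast_sub hnL]
      rw [div_eq_iff h6]
      field_simp
      linear_combination (L - 1 : ℝ) * h5
    have h5 := (h4.const_mul C).add
      (((tendsto_sub_add_one_div L 0).mul h1).mul_const ((-1) ^ D / ρ 0))
    simp only [mul_zero, zero_mul, add_zero, sub_zero] at h5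
    refine h5.congr' ?_
    filter_upwards [hpos] with n hn
    have h3 : ((n : ℝ) ^ (-α)) ^ γ ≠ 0 := by positivity
    have h6 : expV L A n = ((n - L + 1 : ℕ) : ℝ) * (((n : ℝ) ^ (-α)) ^ γ * x n 0) := by
      rw [expV_eq_trace, Matrix.trace]
      simp [hcov n hn]
    have h7 : (-1 : ℝ) ^ D ≠ 0 := by positivity
    have h8 : expV L A n / denom a D s α n
        = ((n - L + 1 : ℕ) : ℝ) / n * ((-1) ^ D * x n 0 / ρ 0) := by
      rw [h6, hdenom]
      field_simp
      linear_combination (-(x n 0)) * hsgn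
    rw [h8]
    field_simp
    linear_combination (-(C * ((n - L + 1 : ℕ) : ℝ) * ρ 0)) * hsgn
  · filter_upwards [hpos, hxbd] with n hn hb i
    have h3 : 0 ≤ ((n : ℝ) ^ (-α)) ^ γ := by positivity
    simp only [hcov n hn, abs_mul, abs_of_nonneg h3, ← Finset.mul_sum]
    refine mul_le_mul_of_nonneg_left ?_ h3
    rw [Finset.mul_sum]
    exact sum_abs_sub_fin_le _ (x n) _ hb i
  · have h1 := (tendsto_sum_rpow_div_sqrt θ hθ L hL).const_mul (B / |ρ 0|)
    rw [mul_zero] at h1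
    refine h1.congr' ?_
    filter_upwards [hpos] with n hn
    have h3 : 0 < ((n : ℝ) ^ (-α)) ^ γ := by positivity
    have h5 : √(n : ℝ) ^ 2 = n := Real.sq_sqrt hn.le
    have h6 : √(n : ℝ) ≠ 0 := (Real.sqrt_pos.2 hn).ne'
    have h7 : |ρ 0| ≠ 0 := abs_ne_zero.2 hρ0
    rw [hdenom, abs_mul, abs_mul, abs_mul, abs_pow, abs_neg, abs_one, one_pow, mul_one,
      abs_of_pos hn, abs_of_pos h3]
    field_simp
    rw [h5]
end
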